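/- arXiv:1603.02321 — 5 statements merged into one kernel-verified Lean document; each statement's English description precedes it below -/
import Mathlib

section
/- There exists a universal constant C > 0 such that for every finite metric space (X,d) with |X| = n ≥ 2, every set of terminals K ⊆ X with |K| = k ≥ 2, and every real p ≥ 1, there exist a natural number m ≤ C·(log n + (log k)²), a map F : X → ℝ^m, and constants c > 0 and c' > 0 such that: for all v ∈ K and u ∈ X, d(v,u) ≤ c·‖F(v)−F(u)‖_p ≤ C·(log k)·d(v,u); and for all u,w ∈ X, d(u,w) ≤ c'·‖F(u)−F(w)‖_p ≤ C·(log n)·d(u,w). Here ‖·‖_p is the ℓ_p norm on ℝ^m and log denotes the natural logarithm. -/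
/-- The ℓ_p norm (for a real exponent `p`) of a vector in `ℝ^m`. -/
noncomputable def lpNorm {m : ℕ} (p : ℝ) (x : Fin m → ℝ) : ℝ :=
  (∑ i, |x i| ^ p) ^ (1 / p)

open Finset

/-- If each of fewer than `4 ^ κ` events has probability at least `1 / 16`, then some sequence of
`128 * κ` samples meets every one of them at least `κ` times. -/
theorem exists_sample_forall_le_card {Ω P : Type*} [Fintype Ω] [Nonempty Ω] [Fintype P]
    (good : P → Ω → Prop) [∀ q, DecidablePred (good q)]
    (h : ∀ q, Fintype.card Ω ≤ 16 * #{ω | good q ω}) (κ : ℕ) (hP : Fintype.card P < 4 ^ κ) :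
    ∃ w : Fin (128 * κ) → Ω, ∀ q, κ ≤ #{i | good q (w i)} := by
  by_contra! hcon
  set wt : P → Ω → ℝ := fun q ω => if good q ω then 1 / 2 else 1 with hwt
  have hΩ : (0 : ℝ) < Fintype.card Ω := by exact_mod_cast Fintype.card_pos
  have hsum : ∀ q, ∑ ω, wt q ω ≤ 31 / 32 * (Fintype.card Ω : ℝ) := by
    intro q
    have h1 : ∑ ω, wt q ω = (Fintype.card Ω : ℝ) - (#{ω | good q ω} : ℝ) / 2 := by
      have : ∀ ω, wt q ω = 1 - (if good q ω then 1 else 0) / 2 := by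
        intro ω; simp only [hwt]; split_ifs <;> norm_num
      simp only [this, sum_sub_distrib, ← sum_div]
      simp
    have h2 : (Fintype.card Ω : ℝ) ≤ 16 * (#{ω | good q ω} : ℝ) := by exact_mod_cast h q
    linarith
  have hwt0 : ∀ q ω, 0 ≤ wt q ω := fun q ω => by simp only [hwt]; split_ifs <;> norm_num
  have hlow : ∀ w : Fin (128 * κ) → Ω, (1 / 2 : ℝ) ^ κ ≤ ∑ q, ∏ i, wt q (w i) := by
    intro w
    obtain ⟨q, hq⟩ := hcon w
    have h1 : ∏ i, wt q (w i) = (1 / 2 : ℝ) ^ #{i | good q (w i)} := by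
      simp [hwt, prod_ite]
    calc (1 / 2 : ℝ) ^ κ ≤ (1 / 2 : ℝ) ^ #{i | good q (w i)} :=
          pow_le_pow_of_le_one (by norm_num) (by norm_num) hq.le
      _ = ∏ i, wt q (w i) := h1.symm
      _ ≤ _ := single_le_sum (f := fun q => ∏ i, wt q (w i))
          (fun q _ => prod_nonneg fun i _ => hwt0 q _) (mem_univ q)
  have h3 : (Fintype.card Ω : ℝ) ^ (128 * κ) * (1 / 2) ^ κ
      ≤ Fintype.card P * (31 / 32 * (Fintype.card Ω : ℝ)) ^ (128 * κ) := by
    calc (Fintype.card Ω : ℝ) ^ (128 * κ) * (1 / 2) ^ κ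
        = ∑ w : Fin (128 * κ) → Ω, (1 / 2 : ℝ) ^ κ := by simp
      _ ≤ ∑ w : Fin (128 * κ) → Ω, ∑ q, ∏ i, wt q (w i) := sum_le_sum fun w _ => hlow w
      _ = ∑ q, (∑ ω, wt q ω) ^ (128 * κ) := by
          rw [sum_comm]; simp only [Fintype.sum_pow]
      _ ≤ ∑ q : P, (31 / 32 * (Fintype.card Ω : ℝ)) ^ (128 * κ) :=
          sum_le_sum fun q _ => pow_le_pow_left₀ (sum_nonneg fun ω _ => hwt0 q ω) (hsum q) _
      _ = _ := by simp
  replace h3 := le_of_mul_le_mul_left (h3.trans_eq (by rw [mul_pow, mul_left_comm, mul_comm,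
    mul_assoc, mul_left_comm])) (pow_pos hΩ (128 * κ))
  rw [pow_mul] at h3
  have h4 : ((31 / 32 : ℝ) ^ 128) ^ κ ≤ (1 / 8 : ℝ) ^ κ :=
    pow_le_pow_left₀ (by positivity) (by norm_num) _
  have h5 : (Fintype.card P : ℝ) < 4 ^ κ := by exact_mod_cast hP
  have h6 : (1 / 2 : ℝ) ^ κ = 4 ^ κ * (1 / 8) ^ κ := by rw [← mul_pow]; norm_num
  have h7 : (0 : ℝ) < (1 / 8) ^ κ := by positivity
  nlinarith [mul_le_mul_of_nonneg_left h4 (Nat.cast_nonneg (α := ℝ) (Fintype.card P))]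

/-- A lower bound for the density of `r` in a product from bounds in the two factors. -/
theorem card_prod_le_mul_card_filter {A B : Type*} [Fintype A] [Fintype B] {p : A → Prop}
    [DecidablePred p] {r : A × B → Prop} [DecidablePred r] {α β : ℕ}
    (hp : Fintype.card A ≤ α * #{a | p a})
    (hr : ∀ a, p a → Fintype.card B ≤ β * #{b | r (a, b)}) :
    Fintype.card (A × B) ≤ α * β * #{x | r x} := by
  have h1 : #{x : A × B | r x} = ∑ a, #{b | r (a, b)} := by
    simp only [card_filter, Fintype.sum_prod_type]
  have h2 : #{a | p a} * Fintype.card B ≤ β * #{x | r x} := by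
    rw [h1, mul_sum, ← smul_eq_mul, ← sum_const]
    exact (sum_le_sum fun a ha => hr a (by simpa using ha)).trans
      (sum_le_sum_of_subset (filter_subset _ _))
  rw [Fintype.card_prod]
  calc Fintype.card A * Fintype.card B ≤ α * #{a | p a} * Fintype.card B :=
        Nat.mul_le_mul_right _ hp
    _ = α * (#{a | p a} * Fintype.card B) := by ring
    _ ≤ α * (β * #{x | r x}) := Nat.mul_le_mul_left _ h2
    _ = _ := by ring

/-- Two distinct points get the labels `true` and `false` with probability one quarter. -/
theorem card_bool_fun_le {Y : Type*} [Fintype Y] [DecidableEq Y] {z z' : Y} (h : z ≠ z') :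
    Fintype.card (Y → Bool) ≤ 4 * #{b : Y → Bool | b z = true ∧ b z' = false} := by
  have := Fintype.card_le_of_injective
    (β := {b : Y → Bool // b z = true ∧ b z' = false} × (Bool × Bool))
    (fun b => (⟨Function.update (Function.update b z true) z' false, by simp [h]⟩, (b z, b z')))
    (by
      intro b c hbc
      simp only [Prod.mk.injEq, Subtype.mk.injEq] at hbc
      obtain ⟨h1, h2, h3⟩ := hbc
      funext w
      by_cases hz : w = z
      · rw [hz, h2]
      by_cases hz' : w = z'
      · rw [hz', h3]
      simpa [hz, hz'] using congrFun h1 w)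
  rw [Fintype.card_prod, Fintype.card_subtype] at this
  simp only [Fintype.card_prod, Fintype.card_bool] at this
  linarith

/-- A random signed sum is at least as large as any fixed term with probability one half. -/
theorem card_sign_le {S : Type*} [Fintype S] [DecidableEq S] (g : S → ℝ) (s : S) :
    Fintype.card (S → Bool) ≤
      2 * #{σ : S → Bool | |g s| ≤ |∑ i, (if σ i then 1 else -1) * g i|} := by
  set P : (S → Bool) → Prop := fun σ => |g s| ≤ |∑ i, (if σ i then 1 else -1) * g i| with hP
  have hflip : ∀ σ, ¬ P σ → P (Function.update σ s (!σ s)) := by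
    intro σ hσ
    simp only [hP, ← add_sum_erase _ _ (mem_univ s)] at hσ ⊢
    have : ∑ i ∈ univ.erase s, (if Function.update σ s (!σ s) i then (1 : ℝ) else -1) * g i
        = ∑ i ∈ univ.erase s, (if σ i then 1 else -1) * g i :=
      sum_congr rfl fun i hi => by rw [Function.update_of_ne (ne_of_mem_erase hi)]
    rw [this]
    set A := ∑ i ∈ univ.erase s, (if σ i then 1 else -1) * g i
    rcases hs : σ s with _ | _ <;> simp only [hs, Function.update_self, not_le] at hσ ⊢ <;>
      norm_num at hσ ⊢ <;> cases abs_cases (g s) <;> cases abs_cases (g s + A) <;>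
      cases abs_cases (-g s + A) <;> linarith
  classical
  have := Fintype.card_le_of_injective (β := {σ // P σ} × Bool)
    (fun σ => if h : P σ then (⟨σ, h⟩, true) else (⟨_, hflip σ h⟩, false))
    (by
      intro σ τ hστ
      by_cases h1 : P σ <;> by_cases h2 : P τ <;> simp only [h1, h2, dite_true, dite_false,
        Prod.mk.injEq, Subtype.mk.injEq, reduceCtorEq, and_false, and_true] at hστ
      · exact hστ
      · have h3 := congrFun hστ s
        simp only [Function.update_self, Bool.not_inj_iff] at h3
        funext i
        by_cases hi : i = s
        · rw [hi, h3]
        · simpa [hi] using congrFun hστ i)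
  rw [Fintype.card_prod, Fintype.card_subtype, Fintype.card_bool] at this
  rw [mul_comm]
  convert this

/-- The first element of `S` in a uniformly random order lies in `B` with probability `#B / #S`. -/
theorem card_mul_card_equiv_le {Y : Type*} [Fintype Y] [DecidableEq Y] {B S : Finset Y}
    (hBS : B ⊆ S) (hS : S.Nonempty) :
    #B * Fintype.card (Y ≃ Fin (Fintype.card Y)) ≤
      #S * #{e : Y ≃ Fin (Fintype.card Y) | ∃ z ∈ B, ∀ w ∈ S, e z ≤ e w} := by
  set M : Y → Finset (Y ≃ Fin (Fintype.card Y)) := fun z => {e | ∀ w ∈ S, e z ≤ e w} with hM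
  have hdisj : ∀ T ⊆ S, (T : Set Y).PairwiseDisjoint M := by
    intro T hT z hz w hw hzw
    rw [Function.onFun, Finset.disjoint_left]
    intro e he he'
    simp only [hM, mem_filter, mem_univ, true_and] at he he'
    exact hzw (e.injective (le_antisymm (he w (hT hw)) (he' z (hT hz))))
  have hle : ∀ z ∈ S, ∀ w ∈ S, #(M z) ≤ #(M w) := by
    intro z hz w hw
    refine card_le_card_of_injOn (fun e => (Equiv.swap z w).trans e) ?_ ?_
    · intro e he
      simp only [hM, coe_filter, mem_univ, true_and, Set.mem_ofPred_eq, Equiv.trans_apply,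
        Equiv.swap_apply_right] at he ⊢
      intro v hv
      apply he
      by_cases h1 : v = z
      · subst h1; simpa using hw
      by_cases h2 : v = w
      · subst h2; simpa using hz
      rwa [Equiv.swap_apply_of_ne_of_ne h1 h2]
    · intro e _ e' _ h
      refine Equiv.ext fun v => ?_
      have := congrArg (fun f => f (Equiv.swap z w v)) h
      simpa using this
  obtain ⟨z₀, hz₀⟩ := hS
  have hcard : ∀ z ∈ S, #(M z) = #(M z₀) := fun z hz =>
    le_antisymm (hle z hz z₀ hz₀) (hle z₀ hz₀ z hz)
  have htot : Fintype.card (Y ≃ Fin (Fintype.card Y)) = #S * #(M z₀) := by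
    rw [← smul_eq_mul, ← sum_const, ← sum_congr rfl hcard, ← card_biUnion (hdisj S subset_rfl),
      ← card_univ]
    congr 1
    ext e
    simp only [mem_univ, mem_biUnion, true_iff, hM, mem_filter, true_and]
    exact exists_min_image S e ⟨z₀, hz₀⟩
  have hB : #{e : Y ≃ Fin (Fintype.card Y) | ∃ z ∈ B, ∀ w ∈ S, e z ≤ e w} = #B * #(M z₀) := by
    rw [← smul_eq_mul, ← sum_const, ← sum_congr rfl fun z hz => hcard z (hBS hz),
      ← card_biUnion (hdisj B hBS)]
    congr 1
    ext e
    simp [hM]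
  rw [htot, hB]
  exact le_of_eq (by ring)

theorem sum_range_shift_sub (g : ℕ → ℝ) (N c : ℕ) :
    ∑ j ∈ range N, (g (j + c) - g j) = ∑ i ∈ range c, (g (N + i) - g i) := by
  have h1 := sum_range_add g N c
  have h2 := sum_range_add g c N
  rw [add_comm c N, h1] at h2
  simp only [sum_sub_distrib, add_comm _ c]
  linarith

section Embedding

variable {X Y : Type*} [MetricSpace X] [Fintype Y]

open Classical in
/-- The points of `Y` whose image lies in the closed ball of radius `r` around `x`. -/
noncomputable def ballFinset (ι : Y → X) (x : X) (r : ℝ) : Finset Y :=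
  {z | dist x (ι z) ≤ r}

theorem mem_ballFinset {ι : Y → X} {x : X} {r : ℝ} {z : Y} :
    z ∈ ballFinset ι x r ↔ dist x (ι z) ≤ r := by
  simp [ballFinset]

theorem ballFinset_subset {ι : Y → X} {x y : X} {r r' : ℝ} (h : dist x y + r ≤ r') :
    ballFinset ι y r ⊆ ballFinset ι x r' := by
  intro z hz
  rw [mem_ballFinset] at hz ⊢
  linarith [dist_triangle x y (ι z)]

theorem ballFinset_mono (ι : Y → X) (x : X) {r r' : ℝ} (h : r ≤ r') :
    ballFinset ι x r ⊆ ballFinset ι x r' :=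
  ballFinset_subset (by simpa using h)

/-- The least radius at which a ball around `x` contains `2 ^ t` points of `Y`. -/
noncomputable def growthRadius (ι : Y → X) (t : ℕ) (x : X) : ℝ :=
  sInf {r : ℝ | 2 ^ t ≤ #(ballFinset ι x r)}

theorem nonneg_of_two_pow_le_card {ι : Y → X} {t : ℕ} {x : X} {r : ℝ}
    (h : 2 ^ t ≤ #(ballFinset ι x r)) : 0 ≤ r := by
  obtain ⟨z, hz⟩ := card_pos.mp ((Nat.two_pow_pos t).trans_le h)
  exact dist_nonneg.trans (mem_ballFinset.mp hz)

theorem growthRadius_le {ι : Y → X} {t : ℕ} {x : X} {r : ℝ}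
    (h : 2 ^ t ≤ #(ballFinset ι x r)) : growthRadius ι t x ≤ r :=
  csInf_le ⟨0, fun _ hr => nonneg_of_two_pow_le_card hr⟩ h

theorem exists_two_pow_le_card_ballFinset (ι : Y → X) {t : ℕ} (ht : 2 ^ t ≤ Fintype.card Y)
    (x : X) : ∃ r, 2 ^ t ≤ #(ballFinset ι x r) := by
  refine ⟨∑ z, dist x (ι z), ht.trans (le_of_eq ?_)⟩
  rw [← card_univ]
  congr 1
  ext z
  simp only [mem_univ, true_iff, mem_ballFinset]
  exact single_le_sum (f := fun z => dist x (ι z)) (fun _ _ => dist_nonneg) (mem_univ z)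

theorem le_growthRadius {ι : Y → X} {t : ℕ} {x : X} {r : ℝ} (ht : 2 ^ t ≤ Fintype.card Y)
    (h : #(ballFinset ι x r) < 2 ^ t) : r ≤ growthRadius ι t x := by
  refine le_csInf (exists_two_pow_le_card_ballFinset ι ht x) fun r' hr' => ?_
  by_contra! hlt
  exact absurd (h.trans_le hr') (not_lt.mpr (card_le_card (ballFinset_mono ι x hlt.le)))

theorem growthRadius_le_add_dist (ι : Y → X) {t : ℕ} (ht : 2 ^ t ≤ Fintype.card Y) (x y : X) :
    growthRadius ι t x ≤ growthRadius ι t y + dist x y := by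
  rw [← sub_le_iff_le_add]
  refine le_csInf (exists_two_pow_le_card_ballFinset ι ht y) fun r hr => ?_
  rw [sub_le_iff_le_add]
  exact growthRadius_le (hr.trans (card_le_card (ballFinset_subset (add_comm _ _).le)))

theorem abs_growthRadius_sub_le (ι : Y → X) {t : ℕ} (ht : 2 ^ t ≤ Fintype.card Y) (x y : X) :
    |growthRadius ι t x - growthRadius ι t y| ≤ dist x y := by
  have h1 := growthRadius_le_add_dist ι ht x y
  have h2 := growthRadius_le_add_dist ι ht y x
  rw [dist_comm y x] at h2
  exact abs_sub_le_iff.mpr ⟨by linarith, by linarith⟩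

/-- A piecewise linear bump supported on radii comparable to `D`. -/
noncomputable def tent (D r : ℝ) : ℝ :=
  max 0 (min (r - D / 32) (8 * D - r))

theorem tent_nonneg (D r : ℝ) : 0 ≤ tent D r := le_max_left _ _

theorem abs_tent_sub_le (D r r' : ℝ) : |tent D r - tent D r'| ≤ |r - r'| := by
  unfold tent
  refine (abs_max_sub_max_le_max _ _ _ _).trans (max_le (by simp) ?_)
  refine (abs_min_sub_min_le_max _ _ _ _).trans (max_le (by simp) ?_)
  rw [sub_sub_sub_cancel_left, abs_sub_comm]

theorem le_tent {D r : ℝ} (h1 : D / 16 ≤ r) (h2 : r ≤ 4 * D) :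
    D / 32 ≤ tent D r :=
  (le_min (by linarith) (by linarith)).trans (le_max_right _ _)

theorem lt_and_lt_of_tent_ne_zero {D r : ℝ} (h : tent D r ≠ 0) : D / 32 < r ∧ r < 8 * D := by
  by_contra hcon
  apply h
  refine max_eq_left ?_
  by_cases h1 : D / 32 < r
  · exact (min_le_right _ _).trans (by linarith [not_lt.mp fun h2 => hcon ⟨h1, h2⟩])
  · exact (min_le_left _ _).trans (by linarith [not_lt.mp h1])

theorem card_filter_tent_ne_zero_le (S : Finset ℤ) (r : ℝ) :
    #{s ∈ S | tent ((2 : ℝ) ^ s) r ≠ 0} ≤ 8 := by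
  have : ({s ∈ S | tent ((2 : ℝ) ^ s) r ≠ 0} : Finset ℤ)
      ⊆ Icc (Int.log 2 r - 2) (Int.log 2 r + 5) := by
    intro s hs
    obtain ⟨h1, h2⟩ := lt_and_lt_of_tent_ne_zero (mem_filter.mp hs).2
    have h0 : (0 : ℝ) < 2 ^ s := by positivity
    have hr : 0 < r := lt_trans (by positivity) h1
    have h3 : (2 : ℝ) ^ Int.log 2 r ≤ r := by exact_mod_cast Int.zpow_log_le_self one_lt_two hr
    have h4 : r < (2 : ℝ) ^ (Int.log 2 r + 1) := by
      exact_mod_cast Int.lt_zpow_succ_log_self one_lt_two r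
    have h5 : (2 : ℝ) ^ (s - 5) < 2 ^ (Int.log 2 r + 1) := by
      refine lt_trans ?_ h4
      rw [zpow_sub₀ two_ne_zero]
      norm_num at h1 ⊢
      exact h1
    have h6 : (2 : ℝ) ^ Int.log 2 r < 2 ^ (s + 3) := by
      refine h3.trans_lt ?_
      rw [zpow_add₀ two_ne_zero]
      norm_num at h2 ⊢
      linarith
    rw [zpow_lt_zpow_iff_right₀ one_lt_two] at h5 h6
    rw [mem_Icc]
    omega
  refine (card_le_card this).trans ?_
  rw [Int.card_Icc]
  omega

/-- Each point is assigned to the first centre, in the order given by `e`, within distance `R`;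
this is the union of the clusters whose centre has label `false`. -/
def carvedSet (ι : Y → X) (e : Y ≃ Fin (Fintype.card Y)) (R : ℝ) (b : Y → Bool) : Set X :=
  {w | ∃ z, dist w (ι z) ≤ R ∧ (∀ z', dist w (ι z') ≤ R → e z ≤ e z') ∧ b z = false}

/-- The part of a random coordinate that lives at scale `D`. -/
noncomputable def scaleCoord (ι : Y → X) (D : ℝ) (A : Set X) (x : X) : ℝ :=
  ∑ t ∈ Icc 1 (Nat.log 2 (Fintype.card Y)),
    min (tent D (growthRadius ι t x)) (Metric.infDist x A)

theorem abs_infDist_sub_le (A : Set X) (x y : X) :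
    |Metric.infDist x A - Metric.infDist y A| ≤ dist x y := by
  have h1 := Metric.infDist_le_infDist_add_dist (s := A) (x := x) (y := y)
  have h2 := Metric.infDist_le_infDist_add_dist (s := A) (x := y) (y := x)
  rw [dist_comm y x] at h2
  exact abs_sub_le_iff.mpr ⟨by linarith, by linarith⟩

theorem sum_abs_scaleCoord_sub_le (ι : Y → X) (S : Finset ℤ) (A : ℤ → Set X) (x y : X)
    [Nonempty Y] :
    ∑ s ∈ S, |scaleCoord ι (2 ^ s) (A s) x - scaleCoord ι (2 ^ s) (A s) y| ≤
      16 * Nat.log 2 (Fintype.card Y) * dist x y := by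
  set T := Icc 1 (Nat.log 2 (Fintype.card Y)) with hT
  set g : ℤ → ℕ → X → ℝ := fun s t x =>
    min (tent (2 ^ s) (growthRadius ι t x)) (Metric.infDist x (A s)) with hg
  have hlip : ∀ s, ∀ t ∈ T, |g s t x - g s t y| ≤ dist x y := by
    intro s t ht
    refine (abs_min_sub_min_le_max _ _ _ _).trans (max_le ?_ (abs_infDist_sub_le _ _ _))
    refine (abs_tent_sub_le _ _ _).trans (abs_growthRadius_sub_le ι ?_ x y)
    exact Nat.pow_le_of_le_log Fintype.card_ne_zero (mem_Icc.mp ht).2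
  have hzero : ∀ s t x, tent ((2 : ℝ) ^ s) (growthRadius ι t x) = 0 → g s t x = 0 := by
    intro s t x h
    simp only [hg, h]
    exact min_eq_left Metric.infDist_nonneg
  have hrow : ∀ t ∈ T, ∑ s ∈ S, |g s t x - g s t y| ≤ 16 * dist x y := by
    intro t ht
    set act : X → Finset ℤ := fun x => {s ∈ S | tent ((2 : ℝ) ^ s) (growthRadius ι t x) ≠ 0}
    have h1 : ∑ s ∈ S, |g s t x - g s t y| = ∑ s ∈ act x ∪ act y, |g s t x - g s t y| := by
      refine (sum_subset (union_subset (filter_subset _ _) (filter_subset _ _)) ?_).symm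
      intro s hs hs'
      simp only [mem_union, mem_filter, hs, true_and, not_or, not_not] at hs'
      rw [hzero s t x hs'.1, hzero s t y hs'.2]
      simp
    have h2 : #(act x ∪ act y) ≤ 16 :=
      (card_union_le _ _).trans
        (Nat.add_le_add (card_filter_tent_ne_zero_le _ _) (card_filter_tent_ne_zero_le _ _))
    rw [h1]
    refine (sum_le_card_nsmul _ _ _ fun s _ => hlip s t ht).trans ?_
    rw [nsmul_eq_mul]
    exact mul_le_mul_of_nonneg_right (by exact_mod_cast h2) dist_nonneg
  calc ∑ s ∈ S, |scaleCoord ι (2 ^ s) (A s) x - scaleCoord ι (2 ^ s) (A s) y|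
      ≤ ∑ s ∈ S, ∑ t ∈ T, |g s t x - g s t y| := by
        refine sum_le_sum fun s _ => ?_
        simp only [scaleCoord, ← sum_sub_distrib]
        exact abs_sum_le_sum_abs _ _
    _ = ∑ t ∈ T, ∑ s ∈ S, |g s t x - g s t y| := sum_comm
    _ ≤ ∑ t ∈ T, 16 * dist x y := sum_le_sum hrow
    _ = _ := by
        simp [hT]; ring

theorem scaleCoord_eq_zero {ι : Y → X} {D : ℝ} {A : Set X} {x : X} (h : x ∈ A) :
    scaleCoord ι D A x = 0 := by
  refine sum_eq_zero fun t _ => ?_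
  rw [Metric.infDist_zero_of_mem h]
  exact min_eq_right (tent_nonneg _ _)

theorem le_scaleCoord {ι : Y → X} {D : ℝ} {A : Set X} {x : X} (hD : 0 ≤ D)
    {L : ℕ} (hL1 : 1 ≤ L) (hx : (ballFinset ι x (D / 16)).Nonempty)
    (hL : Nat.log 2 #(ballFinset ι x (D / 16)) + L = Nat.log 2 #(ballFinset ι x (4 * D)))
    (hA : D / (64 * L) ≤ Metric.infDist x A) :
    D / 64 ≤ scaleCoord ι D A x := by
  set u := #(ballFinset ι x (D / 16))
  set U := #(ballFinset ι x (4 * D)) with hU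
  have hu : u ≠ 0 := card_ne_zero.mpr hx
  have hL0 : (0 : ℝ) < L := by exact_mod_cast hL1
  have hL1' : (1 : ℝ) ≤ L := by exact_mod_cast hL1
  have hUY : U ≤ Fintype.card Y := card_le_univ _
  have hUne : U ≠ 0 := by
    intro h
    rw [h] at hL
    simp at hL
    omega
  have hle : Nat.log 2 U ≤ Nat.log 2 (Fintype.card Y) := Nat.log_mono_right hUY
  calc D / 64 = ∑ t ∈ Ioc (Nat.log 2 u) (Nat.log 2 U), D / (64 * L) := by
        rw [sum_const, Nat.card_Ioc, ← hL, Nat.add_sub_cancel_left, nsmul_eq_mul]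
        field_simp
    _ ≤ ∑ t ∈ Ioc (Nat.log 2 u) (Nat.log 2 U),
          min (tent D (growthRadius ι t x)) (Metric.infDist x A) := by
        refine sum_le_sum fun t ht => le_min ?_ hA
        rw [mem_Ioc] at ht
        have h1 : 2 ^ t ≤ U := Nat.pow_le_of_le_log hUne ht.2
        have h2 : u < 2 ^ t := Nat.lt_pow_of_log_lt one_lt_two ht.1
        refine le_trans ?_ (le_tent (le_growthRadius (h1.trans hUY) h2) (growthRadius_le h1))
        gcongr
        linarith
    _ ≤ _ := by
        refine sum_le_sum_of_subset_of_nonneg (fun t ht => ?_) fun t _ _ =>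
          le_min (tent_nonneg _ _) Metric.infDist_nonneg
        rw [mem_Ioc] at ht
        rw [mem_Icc]
        omega

theorem notMem_carvedSet {ι : Y → X} {e : Y ≃ Fin (Fintype.card Y)} {R τ : ℝ} {b : Y → Bool}
    {x w : X} {z : Y} (hz : dist x (ι z) ≤ R - τ)
    (hmin : ∀ z', dist x (ι z') ≤ R + τ → e z ≤ e z') (hb : b z = true) (hw : dist x w ≤ τ) :
    w ∉ carvedSet ι e R b := by
  rintro ⟨z', h1, h2, h3⟩
  have h4 : e z' ≤ e z := h2 z (by linarith [dist_triangle_left w (ι z) x])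
  have h5 : e z ≤ e z' := hmin z' (by linarith [dist_triangle x w (ι z')])
  rw [e.injective (le_antisymm h4 h5), hb] at h3
  exact absurd h3 (by simp)

/-- With probability at least one half, the ball of radius `D / (64 * L)` around `x` falls inside
one cluster, when the radius of the clusters is drawn from a grid in `[D / 8, D / 4)`. -/
theorem card_order_radius_le (ι : Y → X) (x : X) {D : ℝ} (hD : 0 < D) {L c N : ℕ} (hL1 : 1 ≤ L)
    (hc : 0 < c) (hN : N = 8 * (L * c)) (hx : (ballFinset ι x (D / 16)).Nonempty)
    (hL : Nat.log 2 #(ballFinset ι x (D / 16)) + L = Nat.log 2 #(ballFinset ι x (4 * D)))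
    {P : (Y ≃ Fin (Fintype.card Y)) × Fin N → Prop} [DecidablePred P]
    [DecidableEq Y]
    (hP : ∀ e (j : Fin N), (∃ z, dist x (ι z) ≤ D / 8 * (1 + (j : ℕ) / (N : ℕ)) - D / (64 * L) ∧
      ∀ z', dist x (ι z') ≤ D / 8 * (1 + (j : ℕ) / (N : ℕ)) + D / (64 * L) → e z ≤ e z') →
        P (e, j)) :
    Fintype.card ((Y ≃ Fin (Fintype.card Y)) × Fin N) ≤ 2 * #{a | P a} := by
  have hcR : (0 : ℝ) < c := by exact_mod_cast hc
  have hL1' : (1 : ℝ) ≤ L := by exact_mod_cast hL1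
  have hN0 : 0 < N := by rw [hN]; positivity
  have hNR : (N : ℝ) = 8 * L * c := by rw [hN]; push_cast; ring
  set ρ : ℕ → ℝ := fun i => D / 8 * (1 + ((i : ℝ) - c) / N) with hρ
  set V : ℕ → ℕ := fun i => #(ballFinset ι x (ρ i)) with hV
  set E : ℝ := ((Fintype.card (Y ≃ Fin (Fintype.card Y)) : ℕ) : ℝ) with hE
  have hlo : ∀ i, D / 16 ≤ ρ i := by
    intro i
    have : -(1 / 2 : ℝ) ≤ ((i : ℝ) - c) / N := by
      rw [le_div_iff₀ (by positivity), hNR]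
      have : (0 : ℝ) ≤ i := by positivity
      nlinarith
    simp only [hρ]
    nlinarith
  have hhi : ∀ i ≤ N + 2 * c, ρ i ≤ 4 * D := by
    intro i hi
    have hi' : (i : ℝ) ≤ N + 2 * c := by exact_mod_cast hi
    have : ((i : ℝ) - c) / N ≤ 2 := by
      rw [div_le_iff₀ (by positivity)]
      rw [hNR] at hi' ⊢
      nlinarith
    simp only [hρ]
    nlinarith
  have hVpos : ∀ i, 0 < V i := fun i =>
    card_pos.mpr (hx.mono (ballFinset_mono ι x (hlo i)))
  have hVR : ∀ i, (0 : ℝ) < V i := fun i => by exact_mod_cast hVpos i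
  set u := #(ballFinset ι x (D / 16)) with hu
  set U := #(ballFinset ι x (4 * D)) with hU
  have hu0 : 0 < u := card_pos.mpr hx
  have hu0' : (0 : ℝ) < u := by exact_mod_cast hu0
  have hUu : (U : ℝ) ≤ 2 ^ (L + 1) * u := by
    have h1 : U < 2 ^ (Nat.log 2 u + L + 1) := by
      rw [hL]; exact Nat.lt_pow_succ_log_self one_lt_two _
    have h2 : 2 ^ Nat.log 2 u ≤ u := Nat.pow_log_le_self 2 hu0.ne'
    have h3 : U ≤ 2 ^ (L + 1) * u := by
      calc U ≤ 2 ^ (Nat.log 2 u + L + 1) := h1.le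
        _ = 2 ^ (L + 1) * 2 ^ Nat.log 2 u := by ring
        _ ≤ _ := Nat.mul_le_mul_left _ h2
    exact_mod_cast h3
  have hgrowth : ∀ i ≤ N + 2 * c, Real.log (V i) - Real.log u ≤ 2 * L := by
    intro i hi
    have h1 : (V i : ℝ) ≤ 2 ^ (L + 1) * u := by
      refine le_trans ?_ hUu
      exact_mod_cast card_le_card (ballFinset_mono ι x (hhi i hi))
    have h2 := Real.log_le_log (hVR i) h1
    rw [Real.log_mul (by positivity) hu0'.ne', Real.log_pow] at h2
    push_cast at h2
    nlinarith [Real.log_two_lt_d9, Real.log_two_gt_d9]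
  have hlog_lo : ∀ i, Real.log u ≤ Real.log (V i) := fun i =>
    Real.log_le_log hu0' (by exact_mod_cast card_le_card (ballFinset_mono ι x (hlo i)))
  have hsum : ∑ j ∈ range N, (Real.log (V (j + 2 * c)) - Real.log (V j)) ≤ N / 2 := by
    rw [sum_range_shift_sub (fun i => Real.log (V i))]
    refine (sum_le_card_nsmul _ _ (2 * L : ℝ) fun i hi => ?_).trans ?_
    · rw [mem_range] at hi
      linarith [hgrowth (N + i) (by omega), hlog_lo i]
    · rw [card_range, nsmul_eq_mul, hNR]
      push_cast
      nlinarith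
  have hcol : ∀ j : Fin N,
      E * (1 - (Real.log (V (j + 2 * c)) - Real.log (V j))) ≤ #{e | P (e, j)} := by
    intro j
    have hsub : ρ j = D / 8 * (1 + (j : ℕ) / (N : ℕ)) - D / (64 * L) := by
      simp only [hρ, hNR]; field_simp; ring
    have hadd : ρ (j + 2 * c) = D / 8 * (1 + (j : ℕ) / (N : ℕ)) + D / (64 * L) := by
      simp only [hρ, hNR]; push_cast; field_simp; ring
    have hmono : ballFinset ι x (ρ j) ⊆ ballFinset ι x (ρ (j + 2 * c)) := by
      apply ballFinset_mono
      rw [hsub, hadd]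
      have : 0 ≤ D / (64 * L) := by positivity
      linarith
    have h1 := card_mul_card_equiv_le hmono (card_pos.mp (hVpos _))
    have h2 : #{e : Y ≃ Fin (Fintype.card Y) | ∃ z ∈ ballFinset ι x (ρ j),
        ∀ w ∈ ballFinset ι x (ρ (j + 2 * c)), e z ≤ e w} ≤ #{e | P (e, j)} := by
      refine card_le_card fun e he => ?_
      simp only [mem_filter, mem_univ, true_and, mem_ballFinset, hsub, hadd] at he ⊢
      exact hP e j he
    have h3 : (V j : ℝ) * E ≤ V (j + 2 * c) * (#{e | P (e, j)} : ℝ) := by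
      rw [hE]
      simp only [hV]
      exact_mod_cast h1.trans (Nat.mul_le_mul_left _ h2)
    have h4 : 1 - (Real.log (V (j + 2 * c)) - Real.log (V j)) ≤ V j / V (j + 2 * c) := by
      have := Real.log_le_sub_one_of_pos (div_pos (hVR j) (hVR (j + 2 * c)))
      rw [Real.log_div (hVR _).ne' (hVR _).ne'] at this
      linarith
    calc E * (1 - (Real.log (V (j + 2 * c)) - Real.log (V j)))
        ≤ E * (V j / V (j + 2 * c)) := mul_le_mul_of_nonneg_left h4 (Nat.cast_nonneg _)
      _ = (V j * E) / V (j + 2 * c) := by ring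
      _ ≤ _ := by rw [div_le_iff₀ (hVR _)]; linarith
  have htotal : (#{a | P a} : ℝ) = ∑ j : Fin N, (#{e | P (e, j)} : ℝ) := by
    simp only [card_filter, Fintype.sum_prod_type_right]
    push_cast
    rfl
  have hfin : E * N ≤ 2 * (#{a | P a} : ℝ) := by
    have h1 := sum_le_sum fun j (_ : j ∈ (univ : Finset (Fin N))) => hcol j
    rw [← htotal, ← mul_sum, sum_sub_distrib,
      Fin.sum_univ_eq_sum_range (fun j => Real.log (V (j + 2 * c)) - Real.log (V j))] at h1
    simp only [sum_const, card_univ, Fintype.card_fin, nsmul_eq_mul, mul_one] at h1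
    have h2 : (0 : ℝ) ≤ E := Nat.cast_nonneg _
    nlinarith
  rw [Fintype.card_prod, Fintype.card_fin]
  rw [hE] at hfin
  exact_mod_cast hfin

/-- A random coordinate, as a function of an order, a radius, a labelling of the centres and a
sign for every scale in `S`. -/
noncomputable def randomCoord (ι : Y → X) (S : Finset ℤ) {N : ℕ}
    (ω : (((Y ≃ Fin (Fintype.card Y)) × Fin N) × (Y → Bool)) × (S → Bool)) (x : X) : ℝ :=
  ∑ s : S, (if ω.2 s then 1 else -1) * scaleCoord ι (2 ^ (s : ℤ))
    (carvedSet ι ω.1.1.1 (2 ^ (s : ℤ) / 8 * (1 + (ω.1.1.2 : ℕ) / (N : ℕ))) ω.1.2) x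

theorem randomCoord_sub (ι : Y → X) (S : Finset ℤ) {N : ℕ}
    (ω : (((Y ≃ Fin (Fintype.card Y)) × Fin N) × (Y → Bool)) × (S → Bool)) (x y : X) :
    randomCoord ι S ω x - randomCoord ι S ω y =
      ∑ s : S, (if ω.2 s then 1 else -1) *
        (scaleCoord ι (2 ^ (s : ℤ)) (carvedSet ι ω.1.1.1
          (2 ^ (s : ℤ) / 8 * (1 + (ω.1.1.2 : ℕ) / (N : ℕ))) ω.1.2) x -
        scaleCoord ι (2 ^ (s : ℤ)) (carvedSet ι ω.1.1.1
          (2 ^ (s : ℤ) / 8 * (1 + (ω.1.1.2 : ℕ) / (N : ℕ))) ω.1.2) y) := by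
  simp only [randomCoord, ← sum_sub_distrib, mul_sub]

theorem abs_randomCoord_sub_le [Nonempty Y] (ι : Y → X) (S : Finset ℤ) {N : ℕ}
    (ω : (((Y ≃ Fin (Fintype.card Y)) × Fin N) × (Y → Bool)) × (S → Bool)) (x y : X) :
    |randomCoord ι S ω x - randomCoord ι S ω y| ≤
      16 * Nat.log 2 (Fintype.card Y) * dist x y := by
  set A : ℤ → Set X := fun s =>
    carvedSet ι ω.1.1.1 (2 ^ s / 8 * (1 + (ω.1.1.2 : ℕ) / (N : ℕ))) ω.1.2
  refine le_trans ?_ (sum_abs_scaleCoord_sub_le ι S A x y)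
  rw [randomCoord_sub, ← sum_coe_sort S]
  refine (abs_sum_le_sum_abs _ _).trans (sum_le_sum fun s _ => ?_)
  rw [abs_mul]
  split_ifs <;> simp [A]

theorem exists_first_center (ι : Y → X) (e : Y ≃ Fin (Fintype.card Y)) {R : ℝ} (hR : 0 ≤ R)
    (a : Y) : ∃ z, dist (ι a) (ι z) ≤ R ∧ ∀ z', dist (ι a) (ι z') ≤ R → e z ≤ e z' := by
  obtain ⟨z, hz, hmin⟩ := exists_min_image (ballFinset ι (ι a) R) e
    ⟨a, mem_ballFinset.mpr (by simpa using hR)⟩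
  exact ⟨z, mem_ballFinset.mp hz, fun z' hz' => hmin z' (mem_ballFinset.mpr hz')⟩

open Classical in
theorem card_le_card_randomCoord_of_card_le (ι : Y → X) {S : Finset ℤ} {s : ℤ} (hs : s ∈ S)
    {a b : Y} (hsd : (2 : ℝ) ^ s ≤ dist (ι a) (ι b)) (hds : dist (ι a) (ι b) < 2 ^ (s + 1))
    (hab : #(ballFinset ι (ι a) (2 ^ s / 16)) ≤ #(ballFinset ι (ι b) (2 ^ s / 16)))
    {N : ℕ} (hN : N = 8 * (Fintype.card Y).factorial) :
    Fintype.card ((((Y ≃ Fin (Fintype.card Y)) × Fin N) × (Y → Bool)) × (S → Bool)) ≤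
      16 * #{ω : (((Y ≃ Fin (Fintype.card Y)) × Fin N) × (Y → Bool)) × (S → Bool) |
        dist (ι a) (ι b) / 128 ≤ |randomCoord ι S ω (ι a) - randomCoord ι S ω (ι b)|} := by
  rw [zpow_add_one₀ two_ne_zero] at hds
  set D : ℝ := 2 ^ s with hDdef
  have hD : 0 < D := by positivity
  set x := ι a
  set y := ι b
  have hx : (ballFinset ι x (D / 16)).Nonempty :=
    ⟨a, mem_ballFinset.mpr (by simp only [x, dist_self]; positivity)⟩
  set u := #(ballFinset ι x (D / 16)) with hu
  set U := #(ballFinset ι x (4 * D)) with hU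
  have hu0 : u ≠ 0 := card_ne_zero.mpr hx
  have hdouble : 2 * u ≤ U := by
    have hdisj : Disjoint (ballFinset ι x (D / 16)) (ballFinset ι y (D / 16)) := by
      rw [Finset.disjoint_left]
      intro z h1 h2
      rw [mem_ballFinset] at h1 h2
      linarith [dist_triangle_right x y (ι z)]
    have hsub : ballFinset ι x (D / 16) ∪ ballFinset ι y (D / 16) ⊆ ballFinset ι x (4 * D) :=
      union_subset (ballFinset_mono ι x (by linarith)) (ballFinset_subset (by linarith))
    have := card_le_card hsub
    rw [card_union_of_disjoint hdisj] at this
    omega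
  obtain ⟨L, hL1, hL⟩ : ∃ L, 1 ≤ L ∧ Nat.log 2 u + L = Nat.log 2 U := by
    have h1 : Nat.log 2 (u * 2) ≤ Nat.log 2 U := Nat.log_mono_right (by omega)
    rw [Nat.log_mul_base one_lt_two hu0] at h1
    exact ⟨Nat.log 2 U - Nat.log 2 u, by omega, by omega⟩
  have hLY : L ≤ Fintype.card Y :=
    calc L ≤ Nat.log 2 U := by omega
      _ ≤ U := Nat.log_le_self 2 U
      _ ≤ _ := card_le_univ _
  obtain ⟨c, hc⟩ := Nat.dvd_factorial hL1 hLY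
  have hc0 : 0 < c := Nat.pos_of_mul_pos_left (hc ▸ Nat.factorial_pos _)
  have hL1' : (1 : ℝ) ≤ L := by exact_mod_cast hL1
  have hτ : D / (64 * L) ≤ D / 64 := by gcongr; linarith
  have hτ0 : 0 < D / (64 * L) := by positivity
  set R : Fin N → ℝ := fun j => D / 8 * (1 + (j : ℕ) / (N : ℕ)) with hR
  have hR0 : ∀ j, D / 8 ≤ R j ∧ R j ≤ D / 4 := by
    intro j
    have h1 : (0 : ℝ) ≤ (j : ℕ) / (N : ℕ) := by positivity
    have h2 : ((j : ℕ) : ℝ) / (N : ℕ) ≤ 1 := by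
      refine div_le_one_of_le₀ ?_ (Nat.cast_nonneg _)
      exact_mod_cast j.2.le
    simp only [hR]
    constructor <;> nlinarith
  have h1 := card_order_radius_le ι x hD hL1 hc0 (hN.trans (by rw [hc])) hx hL
    (P := fun ej => ∃ z, dist x (ι z) ≤ R ej.2 - D / (64 * L) ∧
      ∀ z', dist x (ι z') ≤ R ej.2 + D / (64 * L) → ej.1 z ≤ ej.1 z') (fun e j h => h)
  have h2 := card_prod_le_mul_card_filter (B := Y → Bool) (β := 4) h1
    (r := fun ejb => D / 64 ≤ |scaleCoord ι D (carvedSet ι ejb.1.1 (R ejb.1.2) ejb.2) x -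
      scaleCoord ι D (carvedSet ι ejb.1.1 (R ejb.1.2) ejb.2) y|) (by
    rintro ⟨e, j⟩ ⟨z, hz, hmin⟩
    dsimp only at hz hmin ⊢
    obtain ⟨z', hz', hmin'⟩ := exists_first_center ι e
      (by linarith [(hR0 j).1] : 0 ≤ R j) b
    have hzz' : z ≠ z' := by
      rintro rfl
      linarith [(hR0 j).2, dist_triangle_right x y (ι z)]
    refine (card_bool_fun_le hzz').trans (Nat.mul_le_mul_left _ (card_le_card ?_))
    intro β hβ
    simp only [mem_filter, mem_univ, true_and] at hβ ⊢
    have hy : y ∈ carvedSet ι e (R j) β := ⟨z', hz', hmin', hβ.2⟩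
    rw [scaleCoord_eq_zero hy, sub_zero]
    refine (le_scaleCoord hD.le hL1 hx hL ?_).trans (le_abs_self _)
    rw [Metric.le_infDist ⟨y, hy⟩]
    intro w hw
    by_contra! hlt
    exact notMem_carvedSet hz hmin hβ.1 hlt.le hw)
  refine card_prod_le_mul_card_filter (β := 2) h2 ?_
  rintro ⟨⟨e, j⟩, β⟩ hgood
  dsimp only at hgood
  refine (card_sign_le (fun i : S => scaleCoord ι (2 ^ (i : ℤ))
      (carvedSet ι e (2 ^ (i : ℤ) / 8 * (1 + (j : ℕ) / (N : ℕ))) β) x -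
    scaleCoord ι (2 ^ (i : ℤ))
      (carvedSet ι e (2 ^ (i : ℤ) / 8 * (1 + (j : ℕ) / (N : ℕ))) β) y) ⟨s, hs⟩).trans
    (Nat.mul_le_mul_left _ (card_le_card ?_))
  intro σ hσ
  simp only [mem_filter, mem_univ, true_and] at hσ ⊢
  rw [randomCoord_sub]
  refine le_trans ?_ (hgood.trans hσ)
  linarith

open Classical in
/-- Every finite subset of `X` has `O(log)` many functions on `X`, each `O(log)`-Lipschitz on
all of `X`, a fixed proportion of which separate any two points of the subset. -/
theorem exists_coords [Nonempty Y] (ι : Y → X) {κ : ℕ} (hκ : Fintype.card Y < 2 ^ κ) :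
    ∃ f : Fin (128 * κ) → X → ℝ,
      (∀ i x y, |f i x - f i y| ≤ 16 * Nat.log 2 (Fintype.card Y) * dist x y) ∧
      ∀ a b : Y, κ ≤ #{i | dist (ι a) (ι b) / 128 ≤ |f i (ι a) - f i (ι b)|} := by
  set S : Finset ℤ := univ.image fun ab : Y × Y => Int.log 2 (dist (ι ab.1) (ι ab.2))
  set N := 8 * (Fintype.card Y).factorial with hN
  have hN0 : 0 < N := Nat.mul_pos (by norm_num) (Nat.factorial_pos _)
  set Ω := (((Y ≃ Fin (Fintype.card Y)) × Fin N) × (Y → Bool)) × (S → Bool)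
  have : Nonempty Ω :=
    ⟨(((Fintype.equivFin Y, ⟨0, hN0⟩), fun _ => true), fun _ => true)⟩
  obtain ⟨w, hw⟩ := exists_sample_forall_le_card (Ω := Ω) (P := Y × Y)
    (fun ab ω => dist (ι ab.1) (ι ab.2) / 128 ≤
      |randomCoord ι S ω (ι ab.1) - randomCoord ι S ω (ι ab.2)|) (by
    rintro ⟨a, b⟩
    dsimp only
    rcases (dist_nonneg (x := ι a) (y := ι b)).eq_or_lt with h0 | hpos
    · simp only [← h0, zero_div, abs_nonneg, filter_true, card_univ]
      omega
    have hlo : (2 : ℝ) ^ Int.log 2 (dist (ι a) (ι b)) ≤ dist (ι a) (ι b) := by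
      exact_mod_cast Int.zpow_log_le_self one_lt_two hpos
    have hhi : dist (ι a) (ι b) < (2 : ℝ) ^ (Int.log 2 (dist (ι a) (ι b)) + 1) := by
      exact_mod_cast Int.lt_zpow_succ_log_self one_lt_two (dist (ι a) (ι b))
    have hmem : Int.log 2 (dist (ι a) (ι b)) ∈ S := mem_image_of_mem _ (mem_univ (a, b))
    rcases le_total #(ballFinset ι (ι a) (2 ^ Int.log 2 (dist (ι a) (ι b)) / 16))
      #(ballFinset ι (ι b) (2 ^ Int.log 2 (dist (ι a) (ι b)) / 16)) with h | h
    · exact card_le_card_randomCoord_of_card_le ι hmem hlo hhi h hN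
    · have := card_le_card_randomCoord_of_card_le ι hmem (hlo.trans_eq (dist_comm _ _))
        ((dist_comm _ _).trans_lt hhi) h hN
      simpa only [abs_sub_comm (randomCoord ι S _ (ι b)), dist_comm (ι b)] using this) κ (by
    rw [Fintype.card_prod, show 4 = 2 * 2 from rfl, mul_pow]
    exact Nat.mul_lt_mul'' hκ hκ)
  exact ⟨fun i => randomCoord ι S (w i), fun i => abs_randomCoord_sub_le ι S (w i),
    fun a b => hw (a, b)⟩

end Embedding

theorem lpNorm_le_of_forall_abs_le {m : ℕ} {p B : ℝ} (hp : 1 ≤ p) (hB : 0 ≤ B) {x : Fin m → ℝ}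
    (h : ∀ i, |x i| ≤ B) : lpNorm p x ≤ (m : ℝ) ^ (1 / p) * B := by
  have hp0 : 0 < p := by linarith
  have h1 : ∑ i, |x i| ^ p ≤ m * B ^ p := by
    refine (sum_le_card_nsmul _ _ (B ^ p) fun i _ =>
      Real.rpow_le_rpow (abs_nonneg _) (h i) hp0.le).trans_eq ?_
    simp
  calc lpNorm p x ≤ (m * B ^ p) ^ (1 / p) :=
        Real.rpow_le_rpow (sum_nonneg fun i _ => by positivity) h1 (by positivity)
    _ = (m : ℝ) ^ (1 / p) * B := by
        rw [Real.mul_rpow (by positivity) (by positivity), ← Real.rpow_mul hB,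
          mul_one_div_cancel hp0.ne', Real.rpow_one]

theorem le_lpNorm_of_le_card {m κ a : ℕ} {p b : ℝ} (hp : 1 ≤ p) (hb : 0 ≤ b) (ha : 0 < a)
    (hm : m ≤ a * κ) {x : Fin m → ℝ} (h : κ ≤ #{i | b ≤ |x i|}) :
    (m : ℝ) ^ (1 / p) * b / a ≤ lpNorm p x := by
  have hp0 : 0 < p := by linarith
  have haR : (1 : ℝ) ≤ a := by exact_mod_cast ha
  have h1 : (m / a : ℝ) * b ^ p ≤ ∑ i, |x i| ^ p := by
    calc (m / a : ℝ) * b ^ p ≤ κ * b ^ p := by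
          gcongr
          rw [div_le_iff₀ (by positivity), mul_comm]
          exact_mod_cast hm
      _ ≤ #{i | b ≤ |x i|} * b ^ p := by gcongr
      _ = ∑ i with b ≤ |x i|, b ^ p := by simp
      _ ≤ ∑ i with b ≤ |x i|, |x i| ^ p :=
          sum_le_sum fun i hi => Real.rpow_le_rpow hb (mem_filter.mp hi).2 hp0.le
      _ ≤ _ := sum_le_sum_of_subset_of_nonneg (filter_subset _ _) fun i _ _ => by positivity
  have h2 : (a : ℝ) ^ (1 / p) ≤ a := by
    calc (a : ℝ) ^ (1 / p) ≤ (a : ℝ) ^ (1 : ℝ) :=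
          Real.rpow_le_rpow_of_exponent_le haR ((div_le_one hp0).mpr hp)
      _ = a := Real.rpow_one _
  calc (m : ℝ) ^ (1 / p) * b / a ≤ (m : ℝ) ^ (1 / p) * b / (a : ℝ) ^ (1 / p) := by gcongr
    _ = ((m / a : ℝ) * b ^ p) ^ (1 / p) := by
        rw [Real.mul_rpow (by positivity) (by positivity), ← Real.rpow_mul hb,
          mul_one_div_cancel hp0.ne', Real.rpow_one, Real.div_rpow (by positivity) (by positivity)]
        ring
    _ ≤ lpNorm p x := Real.rpow_le_rpow (by positivity) h1 (by positivity)

theorem natLog_two_le_two_mul_log {n : ℕ} (hn : n ≠ 0) : (Nat.log 2 n : ℝ) ≤ 2 * Real.log n := by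
  have h1 : ((2 ^ Nat.log 2 n : ℕ) : ℝ) ≤ n := by exact_mod_cast Nat.pow_log_le_self 2 hn
  have h2 := Real.log_le_log (by positivity) h1
  rw [Nat.cast_pow, Real.log_pow, Nat.cast_ofNat] at h2
  nlinarith [Real.log_two_gt_d9, Nat.cast_nonneg (α := ℝ) (Nat.log 2 n)]

theorem one_le_two_mul_log {n : ℕ} (hn : 2 ≤ n) : 1 ≤ 2 * Real.log n := by
  have : Real.log 2 ≤ Real.log n := Real.log_le_log two_pos (by exact_mod_cast hn)
  linarith [Real.log_two_gt_d9]

open Classical in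
/-- The functions of `exists_coords`, rescaled to be nonexpansive. -/
theorem exists_nonexpansive_coords {X Y : Type*} [MetricSpace X] [Fintype Y] (ι : Y → X) {κ : ℕ}
    (hY : 2 ≤ Fintype.card Y) (hκ : Fintype.card Y < 2 ^ κ) :
    ∃ f : Fin (128 * κ) → X → ℝ, (∀ i x y, |f i x - f i y| ≤ dist x y) ∧
      ∀ a b : Y, κ ≤ #{i | dist (ι a) (ι b) / (4096 * Real.log (Fintype.card Y)) ≤
        |f i (ι a) - f i (ι b)|} := by
  have : Nonempty Y := Fintype.card_pos_iff.mp (by omega)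
  obtain ⟨f, hf, hgood⟩ := exists_coords ι hκ
  set l := Real.log (Fintype.card Y)
  have hl : 1 ≤ 2 * l := one_le_two_mul_log hY
  have hl0 : 0 < 32 * l := by linarith
  have hL : (Nat.log 2 (Fintype.card Y) : ℝ) ≤ 2 * l := natLog_two_le_two_mul_log (by omega)
  have habs : ∀ i x y, |f i x / (32 * l) - f i y / (32 * l)| = |f i x - f i y| / (32 * l) := by
    intro i x y
    rw [← sub_div, abs_div, abs_of_pos hl0]
  refine ⟨fun i x => f i x / (32 * l), fun i x y => ?_, fun a b => (hgood a b).trans ?_⟩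
  · rw [habs, div_le_iff₀ hl0]
    nlinarith [hf i x y, dist_nonneg (x := x) (y := y)]
  · refine card_le_card fun i hi => ?_
    simp only [mem_filter, mem_univ, true_and] at hi ⊢
    rw [habs, show 4096 * l = 128 * (32 * l) by ring, ← div_div]
    gcongr

/-- Every finite metric space on `n ≥ 2` points with `k ≥ 2` terminals embeds into
`ℓ_p^{O(log n + log² k)}` with strong terminal distortion `(O(log k), O(log n))`. -/
theorem strong_terminal_embedding_log :
    ∃ C : ℝ, 0 < C ∧
      ∀ (X : Type) [MetricSpace X] [Fintype X] (K : Finset X) (p : ℝ),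
        2 ≤ Fintype.card X → 2 ≤ K.card → 1 ≤ p →
        ∃ (m : ℕ) (F : X → Fin m → ℝ) (c c' : ℝ),
          (m : ℝ) ≤ C * (Real.log (Fintype.card X) + Real.log K.card ^ 2) ∧
          0 < c ∧ 0 < c' ∧
          (∀ v ∈ K, ∀ u : X,
            dist v u ≤ c * lpNorm p (F v - F u) ∧
            c * lpNorm p (F v - F u) ≤ C * Real.log K.card * dist v u) ∧
          (∀ u w : X,
            dist u w ≤ c' * lpNorm p (F u - F w) ∧
            c' * lpNorm p (F u - F w) ≤ C * Real.log (Fintype.card X) * dist u w) := by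
  classical
  refine ⟨384 * 16384, by norm_num, fun X _ _ K p hX hK hp => ?_⟩
  set n := Fintype.card X
  set k := #K
  obtain ⟨κ, hκ⟩ : ∃ κ, κ = Nat.log 2 n + 1 := ⟨_, rfl⟩
  have hnκ : n < 2 ^ κ := hκ ▸ Nat.lt_pow_succ_log_self one_lt_two n
  have hKcard : Fintype.card K = k := Fintype.card_coe K
  obtain ⟨h, hh, hgood⟩ := exists_nonexpansive_coords (id : X → X) hX hnκ
  obtain ⟨g, hg, ggood⟩ := exists_nonexpansive_coords (Subtype.val : K → X) (κ := κ)
    (by rwa [hKcard]) (by rw [hKcard]; exact (card_le_univ K).trans_lt hnκ)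
  rw [hKcard] at ggood
  have hln : 1 ≤ 2 * Real.log n := one_le_two_mul_log hX
  have hlk : 1 ≤ 2 * Real.log k := one_le_two_mul_log hK
  have hln0 : 0 < Real.log n := by linarith
  have hlk0 : 0 < Real.log k := by linarith
  set Φ : Fin 3 → Fin (128 * κ) → X → ℝ :=
    ![h, g, fun _ x => Metric.infDist x K]
  set m := 3 * (128 * κ) with hm
  set F : X → Fin m → ℝ :=
    fun x i => Φ (finProdFinEquiv.symm i).1 (finProdFinEquiv.symm i).2 x with hF
  have hlip : ∀ l i x y, |Φ l i x - Φ l i y| ≤ dist x y := by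
    intro l i x y
    fin_cases l
    · exact hh i x y
    · exact hg i x y
    · exact abs_infDist_sub_le _ x y
  have hm0 : (0 : ℝ) < (m : ℝ) ^ (1 / p) :=
    Real.rpow_pos_of_pos (by rw [hm, hκ]; positivity) _
  have hupper : ∀ x y, lpNorm p (F x - F y) ≤ (m : ℝ) ^ (1 / p) * dist x y := fun x y =>
    lpNorm_le_of_forall_abs_le hp dist_nonneg fun i => hlip _ _ x y
  have hlower : ∀ l x y b, 0 ≤ b → κ ≤ #{i | b ≤ |Φ l i x - Φ l i y|} →
      (m : ℝ) ^ (1 / p) * b / 384 ≤ lpNorm p (F x - F y) := by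
    intro l x y b hb hcard
    refine le_lpNorm_of_le_card (κ := κ) (a := 384) hp hb (by norm_num) (by omega)
      (hcard.trans ?_)
    refine card_le_card_of_injOn (fun i => finProdFinEquiv (l, i)) (fun i hi => ?_)
      fun i _ j _ hij => by simpa using hij
    simp only [coe_filter, mem_univ, true_and, Set.mem_ofPred_eq] at hi ⊢
    simpa only [hF, Pi.sub_apply, Equiv.symm_apply_apply] using hi
  have hdistortion : ∀ r, 0 < r → ∀ x y,
      (m : ℝ) ^ (1 / p) * (dist x y / (16384 * r)) / 384 ≤ lpNorm p (F x - F y) →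
      dist x y ≤ 384 * 16384 * r / (m : ℝ) ^ (1 / p) * lpNorm p (F x - F y) ∧
      384 * 16384 * r / (m : ℝ) ^ (1 / p) * lpNorm p (F x - F y)
        ≤ 384 * 16384 * r * dist x y := by
    intro r hr x y hxy
    constructor
    · calc dist x y = 384 * 16384 * r / (m : ℝ) ^ (1 / p) *
            ((m : ℝ) ^ (1 / p) * (dist x y / (16384 * r)) / 384) := by field_simp
        _ ≤ _ := by gcongr
    · calc 384 * 16384 * r / (m : ℝ) ^ (1 / p) * lpNorm p (F x - F y)
          ≤ 384 * 16384 * r / (m : ℝ) ^ (1 / p) * ((m : ℝ) ^ (1 / p) * dist x y) := by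
            gcongr; exact hupper x y
        _ = _ := by field_simp
  refine ⟨m, F, 384 * 16384 * Real.log k / (m : ℝ) ^ (1 / p),
    384 * 16384 * Real.log n / (m : ℝ) ^ (1 / p), ?_, by positivity, by positivity,
    fun v hv u => hdistortion _ (by assumption) v u ?_,
    fun u w => hdistortion _ (by assumption) u w ?_⟩
  · have h1 : (Nat.log 2 n : ℝ) ≤ 2 * Real.log n := natLog_two_le_two_mul_log (by omega)
    have h2 : (m : ℝ) = 384 * (Nat.log 2 n + 1) := by
      rw [hm, hκ]
      push_cast
      ring
    nlinarith [sq_nonneg (Real.log k)]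
  · set d := dist v u
    set q := 4096 * Real.log k with hq
    have hq1 : 1 ≤ q := by linarith
    have hb : d / (16384 * Real.log k) = d / q / 4 := by
      rw [hq, div_div]; congr 1; ring
    have hd0 : 0 ≤ d := dist_nonneg
    have hdq : d / q ≤ d := div_le_self hd0 hq1
    have hdq0 : 0 ≤ d / q := by positivity
    obtain ⟨t, ht, hmin⟩ := exists_min_image K (fun t => dist u t) ⟨v, hv⟩
    rw [hb]
    by_cases hfar : d / q / 4 ≤ dist u t
    · refine hlower 2 v u _ (by positivity) ?_
      have hall : ∀ i, d / q / 4 ≤ |Φ 2 i v - Φ 2 i u| := by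
        intro i
        have h0 : Φ 2 i v = 0 := Metric.infDist_zero_of_mem (by exact_mod_cast hv)
        have h1 : dist u t ≤ Φ 2 i u :=
          (Metric.le_infDist ⟨v, by exact_mod_cast hv⟩).mpr fun w hw =>
            hmin w (by exact_mod_cast hw)
        rw [h0, zero_sub, abs_neg]
        exact (hfar.trans h1).trans (le_abs_self _)
      simp only [hall, filter_true, card_univ, Fintype.card_fin]
      omega
    · refine hlower 1 v u _ (by positivity) ((ggood ⟨v, hv⟩ ⟨t, ht⟩).trans ?_)
      refine card_le_card fun i hi => ?_
      simp only [mem_filter, mem_univ, true_and] at hi ⊢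
      have h1 : d - dist u t ≤ dist v t := by
        linarith [dist_triangle_right v u t]
      have h2 : (d - d / q / 4) / q ≤ dist v t / q := by
        gcongr; linarith
      have h3 : (3 / 4 : ℝ) * (d / q) ≤ (d - d / q / 4) / q := by
        rw [← mul_div_assoc]; gcongr; linarith
      have h4 : |g i v - g i t| ≤ |g i v - g i u| + |g i u - g i t| := abs_sub_le _ _ _
      change d / q / 4 ≤ |g i v - g i u|
      linarith [hg i u t]
  · refine hlower 0 u w _ (by positivity) ((hgood u w).trans ?_)
    refine card_le_card fun i hi => ?_
    simp only [mem_filter, mem_univ, true_and, id] at hi ⊢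
    refine le_trans ?_ hi
    gcongr
    norm_num
end

section
/- There exists a universal constant C > 0 such that for every finite metric space (X,d), every set of terminals K ⊆ X with |K| = k ≥ 2, and every integer t ≥ 1, there exist a natural number m ≤ C·t·k^{1/t}·log k, a map F : X → ℝ^m, and a constant c > 0 such that for all v ∈ K and u ∈ X, d(v,u) ≤ c·‖F(v)−F(u)‖_∞ ≤ C·t·d(v,u), where ‖x‖_∞ = max_i |x_i| is the ℓ_∞ norm on ℝ^m and log denotes the natural logarithm. -/
open Finset in
/-- A positive proportion of the `s`-tuples in `Ω` hit `S` and avoid `T`. -/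
theorem le_card_tuples_hit_avoid {Ω : Type*} [Fintype Ω] [DecidableEq Ω] [Nonempty Ω]
    (s : ℕ) (S T : Finset Ω) (hST : Disjoint S T) (hT : 2 * (s * #T) ≤ Fintype.card Ω)
    (y : ℝ) (hy0 : 0 ≤ y) (hy1 : y ≤ 1 / 4) (hS : y * Fintype.card Ω ≤ s * #S) :
    2 / 5 * y * Fintype.card (Fin s → Ω) ≤
      #{f : Fin s → Ω | (∃ i, f i ∈ S) ∧ ∀ i, f i ∉ T} := by
  set N := Fintype.card Ω with hN
  have hNpos : (0 : ℝ) < N := by exact_mod_cast Fintype.card_pos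
  have hset : ({f : Fin s → Ω | (∃ i, f i ∈ S) ∧ ∀ i, f i ∉ T} : Finset _) =
      Fintype.piFinset (fun _ : Fin s => Tᶜ) \ Fintype.piFinset (fun _ : Fin s => (S ∪ T)ᶜ) := by
    ext f
    simp only [mem_filter, mem_univ, true_and, mem_sdiff, Fintype.mem_piFinset, mem_compl,
      mem_union, not_or, not_forall]
    grind
  have hsub : Fintype.piFinset (fun _ : Fin s => (S ∪ T)ᶜ) ⊆
      Fintype.piFinset (fun _ : Fin s => Tᶜ) :=
    Fintype.piFinset_subset _ _ fun _ => compl_subset_compl.2 subset_union_right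
  have hcard : (#{f : Fin s → Ω | (∃ i, f i ∈ S) ∧ ∀ i, f i ∉ T} : ℝ) =
      ((N : ℝ) - #T) ^ s - (N - #S - #T) ^ s := by
    rw [hset, cast_card_sdiff hsub, Fintype.card_piFinset_const, Fintype.card_piFinset_const]
    push_cast
    rw [card_compl, card_compl, Nat.cast_sub (card_le_univ _), Nat.cast_sub (card_le_univ _),
      card_union_of_disjoint hST, Nat.cast_add]
    ring
  have hle : (#S : ℝ) + #T ≤ N := by
    rw [← Nat.cast_add, ← card_union_of_disjoint hST]
    exact_mod_cast card_le_univ _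
  set σ : ℝ := (#S : ℝ) / (N : ℝ) with hσ
  set τ : ℝ := (#T : ℝ) / (N : ℝ) with hτ
  have hSσ : (#S : ℝ) = σ * N := (div_mul_cancel₀ _ hNpos.ne').symm
  have hTτ : (#T : ℝ) = τ * N := (div_mul_cancel₀ _ hNpos.ne').symm
  have hσ0 : 0 ≤ σ := div_nonneg (Nat.cast_nonneg _) hNpos.le
  have hτ0 : 0 ≤ τ := div_nonneg (Nat.cast_nonneg _) hNpos.le
  have hστ : σ + τ ≤ 1 := by
    rw [hσ, hτ, ← add_div]
    exact (div_le_one hNpos).2 hle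
  have hsτ : s * τ ≤ 1 / 2 := by
    have h : (2 : ℝ) * (s * #T) ≤ N := by exact_mod_cast hT
    rw [hTτ] at h
    nlinarith
  have hsσ : y ≤ s * σ := by
    rw [hSσ] at hS
    nlinarith
  have hmiss : 1 / 2 ≤ (1 - τ) ^ s := by
    have h := one_add_mul_le_pow (a := -τ) (by linarith) s
    rw [← sub_eq_add_neg] at h
    linarith
  have hpow : (1 - σ) ^ s * (1 + y) ≤ 1 := by
    have h1 : 1 + y ≤ (1 + σ) ^ s := by
      have := one_add_mul_le_pow (a := σ) (by linarith) s
      linarith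
    calc (1 - σ) ^ s * (1 + y) ≤ (1 - σ) ^ s * (1 + σ) ^ s := by
          gcongr; exact pow_nonneg (by linarith) _
      _ = (1 - σ ^ 2) ^ s := by rw [← mul_pow]; ring
      _ ≤ 1 := pow_le_one₀ (by nlinarith) (by nlinarith)
  have hhit : 4 / 5 * y ≤ 1 - (1 - σ) ^ s := by
    have h0 : 0 ≤ (1 - σ) ^ s := pow_nonneg (by linarith) _
    by_contra! h
    nlinarith
  have hprod : (1 - σ - τ) ^ s ≤ (1 - τ) ^ s * (1 - σ) ^ s := by
    rw [← mul_pow]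
    exact pow_le_pow_left₀ (by linarith) (by nlinarith) _
  have hmain : 2 / 5 * y ≤ (1 - τ) ^ s - (1 - σ - τ) ^ s := by nlinarith
  rw [hcard, Fintype.card_fun, Fintype.card_fin, ← hN, hSσ, hTτ]
  push_cast
  calc 2 / 5 * y * (N : ℝ) ^ s ≤ ((1 - τ) ^ s - (1 - σ - τ) ^ s) * (N : ℝ) ^ s := by gcongr
    _ = _ := by rw [sub_mul, ← mul_pow, ← mul_pow]; ring

open Finset in
/-- If every demand is met by a proportion at least `q` of `Ω`, then some short tuple of elements
of `Ω` meets all demands. -/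
theorem exists_tuple_forall_demand {Ω ι : Type*} [Fintype Ω] [Nonempty Ω]
    (D : Finset ι) (good : Ω → ι → Prop) [∀ ω d, Decidable (good ω d)]
    (q : ℝ) (hq : q ≤ 1) (N : ℕ)
    (hgood : ∀ d ∈ D, q * Fintype.card Ω ≤ #{ω | good ω d})
    (hN : (#D : ℝ) * Real.exp (-(q * N)) < 1) :
    ∃ f : Fin N → Ω, ∀ d ∈ D, ∃ n, good (f n) d := by
  classical
  by_contra! hcon
  have hcover : (univ : Finset (Fin N → Ω)) ⊆
      D.biUnion fun d => Fintype.piFinset fun _ : Fin N => ({ω | ¬ good ω d} : Finset Ω) := by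
    intro f _
    obtain ⟨d, hd, hf⟩ := hcon f
    exact mem_biUnion.2 ⟨d, hd, by simpa using hf⟩
  have hpos : (0 : ℝ) < Fintype.card Ω := by exact_mod_cast Fintype.card_pos
  have hbad : ∀ d ∈ D, (#({ω | ¬ good ω d} : Finset Ω) : ℝ) ≤ (1 - q) * Fintype.card Ω := by
    intro d hd
    have h := card_filter_add_card_filter_not (s := (univ : Finset Ω)) (fun ω => good ω d)
    rw [card_univ] at h
    have h' : (#{ω | good ω d} : ℝ) + #({ω | ¬ good ω d} : Finset Ω) = Fintype.card Ω := by
      exact_mod_cast h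
    linarith [hgood d hd]
  have hcount : (Fintype.card Ω : ℝ) ^ N ≤ ∑ d ∈ D, ((1 - q) * Fintype.card Ω) ^ N := by
    calc (Fintype.card Ω : ℝ) ^ N = #(univ : Finset (Fin N → Ω)) := by simp
      _ ≤ ∑ d ∈ D, (#(Fintype.piFinset fun _ : Fin N =>
            ({ω | ¬ good ω d} : Finset Ω)) : ℝ) := by
          exact_mod_cast (card_le_card hcover).trans card_biUnion_le
      _ ≤ _ := by
          refine sum_le_sum fun d hd => ?_
          rw [Fintype.card_piFinset_const]
          push_cast
          exact pow_le_pow_left₀ (by positivity) (hbad d hd) _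
  have hexp : (1 - q) ^ N ≤ Real.exp (-(q * N)) := by
    rw [show -(q * N) = N * (-q) by ring, Real.exp_nat_mul]
    exact pow_le_pow_left₀ (by linarith) (Real.one_sub_le_exp_neg q) _
  rw [sum_const, nsmul_eq_mul, mul_pow, ← mul_assoc] at hcount
  have : (#D : ℝ) * (1 - q) ^ N < 1 := lt_of_le_of_lt (by gcongr) hN
  have := mul_lt_mul_of_pos_right this (pow_pos hpos N)
  linarith

open Finset in
/-- A family of few subsets of `V` such that each given disjoint pair `(S d, T d)`, with `#(T d)` not
much larger than `#(S d)`, is separated by a member of the family. -/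
theorem exists_family_hit_avoid {V ι : Type*} [Fintype V] [Nonempty V] (D : Finset ι)
    (S T : ι → Finset V) (s N : ℕ) (y : ℝ) (hy0 : 0 ≤ y) (hy1 : y ≤ 1 / 4)
    (hST : ∀ d ∈ D, Disjoint (S d) (T d)) (hT : ∀ d ∈ D, s * #(T d) ≤ Fintype.card V)
    (hS : ∀ d ∈ D, y * (2 * Fintype.card V) ≤ s * #(S d))
    (hN : (#D : ℝ) * Real.exp (-(2 / 5 * y * N)) < 1) :
    ∃ A : Fin N → Set V, ∀ d ∈ D, ∃ n, (∃ a ∈ A n, a ∈ S d) ∧ ∀ a ∈ A n, a ∉ T d := by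
  classical
  obtain ⟨f, hf⟩ := exists_tuple_forall_demand (Ω := Fin s → V × Bool) D
    (fun f d => (∃ i, f i ∈ S d ×ˢ {true}) ∧ ∀ i, f i ∉ T d ×ˢ {true}) (2 / 5 * y)
    (by linarith) N (by
      intro d hd
      refine le_card_tuples_hit_avoid s _ _ (disjoint_product.2 (Or.inl (hST d hd))) ?_ y hy0 hy1 ?_
      · simp only [card_product, card_singleton, mul_one, Fintype.card_prod, Fintype.card_bool]
        linarith [hT d hd]
      · simp only [card_product, card_singleton, mul_one, Fintype.card_prod, Fintype.card_bool]
        push_cast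
        linarith [hS d hd]) hN
  refine ⟨fun n => {a | ∃ i, f n i = (a, true)}, fun d hd => ?_⟩
  obtain ⟨n, ⟨i, hi⟩, hn⟩ := hf d hd
  simp only [mem_product, mem_singleton] at hi hn
  refine ⟨n, ⟨(f n i).1, ⟨i, Prod.ext rfl hi.2⟩, hi.1⟩, ?_⟩
  rintro a ⟨j, hj⟩ ha
  exact hn j ⟨by rw [hj]; exact ha, by rw [hj]⟩

/-- For two sequences bounded by `k` after `t` steps, there is a scale at which one exceeds
`k ^ (i / t)` while the next term of the other is at most `k ^ ((i + 1) / t)`. -/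
theorem exists_scale_of_growth (t : ℕ) (ht : 1 ≤ t) (k : ℝ) (a b : ℕ → ℝ)
    (ha0 : 1 ≤ a 0) (hat : a t ≤ k) (hbt : b t ≤ k) :
    ∃ i < t, (k ^ ((i : ℝ) / t) ≤ a i ∧ b (i + 1) ≤ k ^ (((i + 1 : ℕ) : ℝ) / t)) ∨
      (k ^ ((i : ℝ) / t) ≤ b i ∧ a (i + 1) ≤ k ^ (((i + 1 : ℕ) : ℝ) / t)) := by
  have ht0 : (t : ℝ) ≠ 0 := by positivity
  by_contra! h
  have key : ∀ i < t, k ^ ((i : ℝ) / t) ≤ a i ∨ k ^ ((i : ℝ) / t) ≤ b i := by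
    intro i
    induction i with
    | zero => intro _; left; simpa using ha0
    | succ i ih =>
      intro hi
      rcases ih (by omega) with h' | h'
      · exact Or.inr ((h i (by omega)).1 h').le
      · exact Or.inl ((h i (by omega)).2 h').le
  have hlast : k ^ (((t - 1 + 1 : ℕ) : ℝ) / t) = k := by
    rw [Nat.sub_add_cancel ht, div_self ht0, Real.rpow_one]
  rcases key (t - 1) (by omega) with h' | h'
  · have := (h (t - 1) (by omega)).1 h'
    rw [hlast, Nat.sub_add_cancel ht] at this
    linarith
  · have := (h (t - 1) (by omega)).2 h'
    rw [hlast, Nat.sub_add_cancel ht] at this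
    linarith

open Finset in
/-- Embedding theorem of Matoušek: distances to few sets distinguish points of a finite metric space up to a
factor `2 * t`. -/
theorem exists_family_infDist {V : Type*} [Fintype V] [MetricSpace V] [Nonempty V]
    (t : ℕ) (ht : 1 ≤ t) (N : ℕ)
    (hN : 20 * (Fintype.card V : ℝ) ^ (1 / (t : ℝ)) * Real.log (Fintype.card V) < N) :
    ∃ A : Fin t → Fin N → Set V, ∀ x y, x ≠ y → ∃ i n,
      dist x y / (2 * t) ≤ |Metric.infDist x (A i n) - Metric.infDist y (A i n)| := by
  classical
  set k : ℝ := (Fintype.card V : ℝ) with hk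
  have hk1 : 1 ≤ k := by rw [hk]; exact_mod_cast Fintype.card_pos (α := V)
  have hk0 : 0 < k := by linarith
  have ht0 : (0 : ℝ) < t := by exact_mod_cast ht
  set cb : V → ℝ → Finset V := fun x r => {a | dist a x ≤ r} with hcb
  have hcbk : ∀ x r, (#(cb x r) : ℝ) ≤ k := fun x r => by rw [hk]; exact_mod_cast card_le_univ _
  set D : ℕ → Finset (V × V) := fun i => {p | p.1 ≠ p.2 ∧
    k ^ ((i : ℝ) / t) ≤ #(cb p.1 (i * (dist p.1 p.2 / (2 * t)))) ∧
    #(cb p.2 ((i + 1 : ℕ) * (dist p.1 p.2 / (2 * t)))) ≤ k ^ (((i + 1 : ℕ) : ℝ) / t)} with hD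
  have hfam : ∀ i : Fin t, ∃ A : Fin N → Set V, ∀ p ∈ D i, ∃ n,
      (∃ a ∈ A n, a ∈ cb p.1 ((i : ℕ) * (dist p.1 p.2 / (2 * t)))) ∧
      ∀ a ∈ A n, a ∉ cb p.2 (((i : ℕ) + 1 : ℕ) * (dist p.1 p.2 / (2 * t))) := by
    intro i
    set z : ℝ := k ^ (1 - (((i : ℕ) + 1 : ℕ) : ℝ) / t) with hz
    have hz1 : 1 ≤ z := by
      refine Real.one_le_rpow hk1 ?_
      rw [sub_nonneg, div_le_one ht0]
      exact_mod_cast i.2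
    have hzs : (⌊z⌋₊ : ℝ) ≤ z := Nat.floor_le (by linarith)
    have hsz : z / 2 ≤ ⌊z⌋₊ := by
      have h1 := Nat.lt_floor_add_one z
      have h2 : (1 : ℝ) ≤ ⌊z⌋₊ := by exact_mod_cast (Nat.one_le_floor_iff z).2 hz1
      linarith
    have hroot : (1 : ℝ) ≤ k ^ (1 / (t : ℝ)) := Real.one_le_rpow hk1 (by positivity)
    refine exists_family_hit_avoid (D i) _ _ ⌊z⌋₊ N (1 / (4 * k ^ (1 / (t : ℝ)))) (by positivity)
      ?_ ?_ ?_ ?_ ?_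
    · gcongr; linarith
    · intro p hp
      simp only [hD, mem_filter, mem_univ, true_and] at hp
      rw [disjoint_left]
      intro a ha ha'
      simp only [hcb, mem_filter, mem_univ, true_and] at ha ha'
      have hd : 0 < dist p.1 p.2 := dist_pos.2 hp.1
      have htri := dist_triangle_left p.1 p.2 a
      have hi : ((i : ℕ) : ℝ) + 1 ≤ t := by exact_mod_cast i.2
      have hΔ : t * (dist p.1 p.2 / (2 * t)) = dist p.1 p.2 / 2 := by field_simp
      have hΔ0 : 0 < dist p.1 p.2 / (2 * t) := by positivity
      push_cast at ha'
      nlinarith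
    · intro p hp
      simp only [hD, mem_filter, mem_univ, true_and] at hp
      have : (⌊z⌋₊ : ℝ) * #(cb p.2 (((i : ℕ) + 1 : ℕ) * (dist p.1 p.2 / (2 * t)))) ≤ k := by
        calc _ ≤ z * k ^ ((((i : ℕ) + 1 : ℕ) : ℝ) / t) := by
              gcongr; exact hp.2.2
          _ = k := by rw [hz, ← Real.rpow_add hk0, sub_add_cancel, Real.rpow_one]
      rw [hk] at this
      exact_mod_cast this
    · intro p hp
      simp only [hD, mem_filter, mem_univ, true_and] at hp
      have hzk : z * k ^ (((i : ℕ) : ℝ) / t) = k / k ^ (1 / (t : ℝ)) := by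
        rw [eq_div_iff (by positivity), hz, ← Real.rpow_add hk0, ← Real.rpow_add hk0]
        conv_rhs => rw [← Real.rpow_one k]
        congr 1
        push_cast
        ring
      calc 1 / (4 * k ^ (1 / (t : ℝ))) * (2 * k) = z / 2 * k ^ (((i : ℕ) : ℝ) / t) := by
            rw [div_mul_eq_mul_div, div_mul_eq_mul_div, hzk]; field_simp; norm_num
        _ ≤ _ := by
            gcongr; exact hp.2.1
    · have hDk : (#(D i) : ℝ) ≤ k ^ 2 := by
        have h := card_le_univ (D i)
        rw [Fintype.card_prod] at h
        rw [sq, hk]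
        exact_mod_cast h
      have hexp : 2 * Real.log k < 2 / 5 * (1 / (4 * k ^ (1 / (t : ℝ)))) * N := by
        have : 2 / 5 * (1 / (4 * k ^ (1 / (t : ℝ)))) * N = N / (10 * k ^ (1 / (t : ℝ))) := by
          field_simp; ring
        rw [this, lt_div_iff₀ (by positivity)]
        linarith
      calc (#(D i) : ℝ) * Real.exp (-(2 / 5 * (1 / (4 * k ^ (1 / (t : ℝ)))) * N))
          ≤ k ^ 2 * Real.exp (-(2 / 5 * (1 / (4 * k ^ (1 / (t : ℝ)))) * N)) := by gcongr
        _ < k ^ 2 * Real.exp (-(2 * Real.log k)) := by gcongr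
        _ = 1 := by
            rw [Real.exp_neg, two_mul, Real.exp_add, Real.exp_log hk0]
            field_simp
  choose A hA using hfam
  have hsep : ∀ i : Fin t, ∀ x y, (x, y) ∈ D i → ∃ n,
      dist x y / (2 * t) ≤ |Metric.infDist x (A i n) - Metric.infDist y (A i n)| := by
    intro i x y hxy
    obtain ⟨n, ⟨a, haA, ha⟩, hn⟩ := hA i (x, y) hxy
    simp only [hcb, mem_filter, mem_univ, true_and, not_le] at ha hn
    have hx : Metric.infDist x (A i n) ≤ (i : ℕ) * (dist x y / (2 * t)) :=
      (Metric.infDist_le_dist_of_mem haA).trans (by rwa [dist_comm])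
    have hy : (((i : ℕ) + 1 : ℕ) : ℝ) * (dist x y / (2 * t)) ≤ Metric.infDist y (A i n) :=
      (Metric.le_infDist ⟨a, haA⟩).2 fun b hb =>
        (hn b hb).le.trans_eq (dist_comm _ _)
    refine ⟨n, ?_⟩
    rw [abs_sub_comm]
    refine le_trans ?_ (le_abs_self _)
    push_cast at hy
    linarith
  refine ⟨A, fun x y hxy => ?_⟩
  obtain ⟨i, hi, h⟩ := exists_scale_of_growth t ht k
    (fun i => #(cb x (i * (dist x y / (2 * t))))) (fun i => #(cb y (i * (dist x y / (2 * t)))))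
    (by
      have : x ∈ cb x ((0 : ℕ) * (dist x y / (2 * t))) := by simp [hcb]
      exact_mod_cast card_pos.2 ⟨x, this⟩)
    (hcbk _ _) (hcbk _ _)
  rcases h with h | h
  · obtain ⟨n, hn⟩ := hsep ⟨i, hi⟩ x y (by simpa [hD, hxy] using h)
    exact ⟨⟨i, hi⟩, n, hn⟩
  · obtain ⟨n, hn⟩ := hsep ⟨i, hi⟩ y x (by
      simpa [hD, hxy.symm, dist_comm y x] using h)
    exact ⟨⟨i, hi⟩, n, by rwa [dist_comm, abs_sub_comm]⟩

/-- A `1`-Lipschitz map that dominates distances between terminals up to a factor `2 * t`, and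
distances to the terminal set, dominates all terminal distances up to a factor `5 * t`. -/
theorem dist_le_of_terminal_expansion {X E : Type*} [PseudoMetricSpace X]
    [SeminormedAddCommGroup E] (K : Finset X) (F : X → E) (t : ℝ) (ht : 1 ≤ t)
    (hF : ∀ u v, ‖F v - F u‖ ≤ dist v u)
    (hK : ∀ v ∈ K, ∀ w ∈ K, dist v w / (2 * t) ≤ ‖F v - F w‖)
    (hdist : ∀ v ∈ K, ∀ u, Metric.infDist u K ≤ ‖F v - F u‖) (v : X) (hv : v ∈ K) (u : X) :
    dist v u ≤ 5 * t * ‖F v - F u‖ := by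
  obtain ⟨w, hw, huw⟩ := K.finite_toSet.isCompact.exists_infDist_eq_dist ⟨v, hv⟩ u
  have h1 := hdist v hv u
  rw [huw] at h1
  have h2 := hK v hv w hw
  rw [div_le_iff₀ (by positivity)] at h2
  have h3 := norm_sub_le_norm_sub_add_norm_sub (F v) (F u) (F w)
  have h4 := hF w u
  have h5 := dist_triangle_right v u w
  have h6 : 0 ≤ ‖F v - F u‖ := norm_nonneg _
  nlinarith


/-- Every finite metric space with `k ≥ 2` terminals embeds into
`ℓ_∞^{O(t·k^{1/t}·log k)}` with terminal distortion `O(t)`.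
Here `Fin m → ℝ` carries the sup (ℓ_∞) norm `‖x‖ = max_i |x i|`. -/
theorem terminal_embedding_linfty :
    ∃ C : ℝ, 0 < C ∧
      ∀ (X : Type) [MetricSpace X] [Fintype X] (K : Finset X) (t : ℕ),
        2 ≤ K.card → 1 ≤ t →
        ∃ (m : ℕ) (F : X → Fin m → ℝ) (c : ℝ),
          (m : ℝ) ≤ C * (t : ℝ) * (K.card : ℝ) ^ (1 / (t : ℝ)) * Real.log K.card ∧
          0 < c ∧
          ∀ v ∈ K, ∀ u : X,
            dist v u ≤ c * ‖F v - F u‖ ∧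
            c * ‖F v - F u‖ ≤ C * (t : ℝ) * dist v u := by
  refine ⟨30, by norm_num, fun X _ _ K t hK ht => ?_⟩
  classical
  have hK2 : (2 : ℝ) ≤ K.card := by exact_mod_cast hK
  have ht1 : (1 : ℝ) ≤ t := by exact_mod_cast ht
  obtain ⟨v₀, hv₀⟩ : K.Nonempty := Finset.card_pos.1 (by omega)
  have : Nonempty K := ⟨⟨v₀, hv₀⟩⟩
  set L : ℝ := (K.card : ℝ) ^ (1 / (t : ℝ)) * Real.log K.card with hL
  have hroot : (1 : ℝ) ≤ (K.card : ℝ) ^ (1 / (t : ℝ)) :=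
    Real.one_le_rpow (by linarith) (by positivity)
  have hlog : 1 / 2 ≤ Real.log K.card := by
    have := Real.log_two_gt_d9
    have := Real.log_le_log (by norm_num) hK2
    linarith
  have hL2 : 1 / 2 ≤ L := by nlinarith
  set N : ℕ := ⌊20 * L⌋₊ + 1 with hN
  have hNL : (N : ℝ) ≤ 22 * L := by
    have := Nat.floor_le (show 0 ≤ 20 * L by linarith)
    push_cast [hN]
    linarith
  obtain ⟨A, hA⟩ := exists_family_infDist (V := K) t ht N (by
    rw [Fintype.card_coe, mul_assoc, ← hL, hN]
    push_cast
    exact Nat.lt_floor_add_one _)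
  let S : Option (Fin t × Fin N) → Set X := fun o =>
    o.elim (K : Set X) fun p => Subtype.val '' A p.1 p.2
  let e := Fintype.equivFin (Option (Fin t × Fin N))
  let F : X → Fin (Fintype.card (Option (Fin t × Fin N))) → ℝ := fun u j =>
    Metric.infDist u (S (e.symm j))
  have hcoord : ∀ o u v, |Metric.infDist v (S o) - Metric.infDist u (S o)| ≤ ‖F v - F u‖ := by
    intro o u v
    simpa [F] using norm_le_pi_norm (F v - F u) (e o)
  have hF : ∀ u v, ‖F v - F u‖ ≤ dist v u := fun u v =>
    (pi_norm_le_iff_of_nonneg dist_nonneg).2 fun j => by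
      simpa [Real.dist_eq] using (Metric.lipschitz_infDist_pt (S (e.symm j))).dist_le_mul v u
  refine ⟨_, F, 5 * t, ?_, by positivity, fun v hv u =>
    ⟨dist_le_of_terminal_expansion K F t ht1 hF ?_ ?_ v hv u, ?_⟩⟩
  · simp only [Fintype.card_option, Fintype.card_prod, Fintype.card_fin]
    push_cast
    rw [mul_assoc _ _ (Real.log _), ← hL]
    nlinarith
  · intro v hv w hw
    rcases eq_or_ne v w with rfl | hvw
    · simp
    obtain ⟨i, n, h⟩ := hA ⟨v, hv⟩ ⟨w, hw⟩ (by simpa using hvw)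
    rw [← Metric.infDist_image isometry_subtype_coe,
      ← Metric.infDist_image (x := (⟨w, hw⟩ : K)) isometry_subtype_coe] at h
    exact h.trans (hcoord (some (i, n)) w v)
  · intro v hv u
    have h := hcoord none u v
    simp only [S, Option.elim] at h
    rw [Metric.infDist_zero_of_mem (show v ∈ (K : Set X) from hv), zero_sub, abs_neg] at h
    exact (le_abs_self _).trans h
  · calc 5 * t * ‖F v - F u‖ ≤ 5 * t * dist v u := by gcongr; exact hF u v
      _ ≤ 30 * t * dist v u := by gcongr; norm_num
end

section
/- There exists a universal constant C > 0 such that the following holds. Let G be a connected simple graph on a finite vertex set V with |V| = n, with a weight function w assigning a positive real to each edge, let K ⊆ V be a set of terminals with |K| = k ≥ 1, and let t ≥ 1 be an integer. Then there exists a connected spanning subgraph H of G with at most C·(n + √n·k^{1+1/t}) edges such that for every v ∈ K and u ∈ V, d_{H,w}(u,v) ≤ (4t−1)·d_{G,w}(u,v). -/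
/-- The weighted shortest-path distance in a graph `G` with edge weights `w`:
the infimum of the weighted lengths of walks from `u` to `v` (the weighted length of a
walk is the sum of the weights of its edges, with multiplicity). -/
noncomputable def wdist {V : Type} (G : SimpleGraph V) (w : Sym2 V → ℝ) (u v : V) : ℝ :=
  sInf {L : ℝ | ∃ p : G.Walk u v, L = (p.edges.map w).sum}

namespace SimpleGraph

open Finset

variable {V : Type}

namespace Walk

variable {G H : SimpleGraph V} {u v x y z : V}

/-- The weighted length of a walk. -/
noncomputable def weight (w : Sym2 V → ℝ) (p : G.Walk u v) : ℝ := (p.edges.map w).sum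

variable {w : Sym2 V → ℝ}

@[simp] lemma weight_nil : (nil : G.Walk u u).weight w = 0 := by simp [weight]

@[simp] lemma weight_cons (h : G.Adj u v) (p : G.Walk v z) :
    (cons h p).weight w = w s(u, v) + p.weight w := by simp [weight]

@[simp] lemma weight_append (p : G.Walk u v) (q : G.Walk v z) :
    (p.append q).weight w = p.weight w + q.weight w := by simp [weight]

@[simp] lemma weight_reverse (p : G.Walk u v) : p.reverse.weight w = p.weight w := by
  simp [weight, List.sum_reverse]

@[simp] lemma weight_mapLe (h : G ≤ H) (p : G.Walk u v) : (p.mapLe h).weight w = p.weight w := by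
  simp [weight]

@[simp] lemma weight_transfer (p : G.Walk u v) (h : ∀ e ∈ p.edges, e ∈ H.edgeSet) :
    (p.transfer H h).weight w = p.weight w := by
  simp [weight]

lemma weight_nonneg (hw : ∀ e ∈ G.edgeSet, 0 < w e) (p : G.Walk u v) : 0 ≤ p.weight w := by
  apply List.sum_nonneg
  simp only [List.mem_map, forall_exists_index, and_imp, forall_apply_eq_imp_iff₂]
  exact fun e he => (hw e (p.edges_subset_edgeSet he)).le

lemma weight_bypass_le [DecidableEq V] (hw : ∀ e ∈ G.edgeSet, 0 < w e) (p : G.Walk u v) :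
    p.bypass.weight w ≤ p.weight w := by
  apply (p.edges_bypass_sublist_edges.map w).sum_le_sum
  simp only [List.mem_map, forall_exists_index, and_imp, forall_apply_eq_imp_iff₂]
  exact fun e he => (hw e (p.edges_subset_edgeSet he)).le

lemma weight_le_length_mul (p : G.Walk u v) {c : ℝ} (h : ∀ e ∈ p.edges, w e ≤ c) :
    p.weight w ≤ p.length * c := by
  have := List.sum_le_card_nsmul (p.edges.map w) c (by simpa using h)
  simpa [weight] using this

lemma exists_append_of_getVert_eq (p : G.Walk u v) {n : ℕ} (hn : n ≤ p.length)
    (hz : p.getVert n = z) :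
    ∃ (q : G.Walk u z) (r : G.Walk z v), p = q.append r ∧ q.length = n := by
  subst hz
  exact ⟨p.take n, p.drop n, by simp, by simpa using hn⟩

lemma mem_of_mem_edges_iff (p : G.Walk u v) {e : Sym2 V} :
    x ∈ e ∧ e ∈ p.edges ↔ ∃ n < p.length, e = s(p.getVert n, p.getVert (n + 1)) ∧
      (x = p.getVert n ∨ x = p.getVert (n + 1)) := by
  induction e with | _ a b
  rw [mk_mem_edges_iff_exists]
  constructor
  · rintro ⟨hx, n, hn, h⟩
    rw [← h] at hx ⊢
    exact ⟨n, hn, rfl, by simpa using hx⟩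
  · rintro ⟨n, hn, h, hx⟩
    exact ⟨by rw [h]; simpa using hx, n, hn, h.symm⟩

/-- A path uses at most two edges at any given vertex. -/
lemma IsPath.ncard_incident_edges_le {p : G.Walk u v} (hp : p.IsPath) (x : V) :
    {e | x ∈ e ∧ e ∈ p.edges}.ncard ≤ 2 := by
  have hsub : {e | x ∈ e ∧ e ∈ p.edges} ⊆
      {e | ∃ n < p.length, e = s(p.getVert n, p.getVert (n + 1)) ∧ x = p.getVert n} ∪
      {e | ∃ n < p.length, e = s(p.getVert n, p.getVert (n + 1)) ∧ x = p.getVert (n + 1)} := by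
    intro e he
    obtain ⟨n, hn, h, hx | hx⟩ := (mem_of_mem_edges_iff p).1 he
    · exact Or.inl ⟨n, hn, h, hx⟩
    · exact Or.inr ⟨n, hn, h, hx⟩
  have h1 : {e | ∃ n < p.length, e = s(p.getVert n, p.getVert (n + 1)) ∧
      x = p.getVert n}.Subsingleton := by
    rintro _ ⟨n, hn, rfl, hx⟩ _ ⟨m, hm, rfl, hx'⟩
    rw [hp.getVert_injOn (show n ≤ p.length by lia) (show m ≤ p.length by lia)
      (hx.symm.trans hx')]
  have h2 : {e | ∃ n < p.length, e = s(p.getVert n, p.getVert (n + 1)) ∧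
      x = p.getVert (n + 1)}.Subsingleton := by
    rintro _ ⟨n, hn, rfl, hx⟩ _ ⟨m, hm, rfl, hx'⟩
    have := hp.getVert_injOn (show n + 1 ≤ p.length by lia) (show m + 1 ≤ p.length by lia)
      (hx.symm.trans hx')
    obtain rfl : n = m := by lia
    rfl
  calc _ ≤ _ := Set.ncard_le_ncard hsub (h1.finite.union h2.finite)
    _ ≤ _ := Set.ncard_union_le _ _
    _ ≤ 1 + 1 := add_le_add ((Set.ncard_le_one h1.finite).2 fun a ha b hb => h1 ha hb)
        ((Set.ncard_le_one h2.finite).2 fun a ha b hb => h2 ha hb)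

lemma exists_append_cons_of_mem_edges (p : G.Walk u v) {a b : V} (h : s(a, b) ∈ p.edges) :
    ∃ (x y : V) (q : G.Walk u x) (hxy : G.Adj x y) (r : G.Walk y v),
      s(x, y) = s(a, b) ∧ p = q.append (cons hxy r) := by
  induction p with
  | nil => simp at h
  | @cons c d _ hcd p ih =>
    rw [edges_cons, List.mem_cons] at h
    obtain h | h := h
    · exact ⟨c, d, nil, hcd, p, h.symm, rfl⟩
    · obtain ⟨x, y, q, hxy, r, he, rfl⟩ := ih h
      exact ⟨x, y, cons hcd q, hxy, r, he, rfl⟩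

end Walk

section Distance

variable {G H : SimpleGraph V} {w : Sym2 V → ℝ} {u v x y z : V}

lemma Walk.wdist_le_weight (hw : ∀ e ∈ G.edgeSet, 0 < w e) (p : G.Walk u v) :
    wdist G w u v ≤ p.weight w :=
  csInf_le ⟨0, by rintro _ ⟨q, rfl⟩; exact q.weight_nonneg hw⟩ ⟨p, rfl⟩

lemma Walk.wdist_le_weight_of_le (hw : ∀ e ∈ G.edgeSet, 0 < w e) (h : H ≤ G)
    (p : H.Walk u v) : wdist G w u v ≤ p.weight w := by
  simpa using (p.mapLe h).wdist_le_weight hw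

lemma wdist_comm (G : SimpleGraph V) (w : Sym2 V → ℝ) (u v : V) :
    wdist G w u v = wdist G w v u := by
  unfold wdist
  congr 1
  ext L
  constructor <;> rintro ⟨p, rfl⟩ <;> exact ⟨p.reverse, (p.weight_reverse (w := w)).symm⟩

lemma wdist_nonneg (hw : ∀ e ∈ G.edgeSet, 0 < w e) (u v : V) : 0 ≤ wdist G w u v :=
  Real.sInf_nonneg (by rintro _ ⟨p, rfl⟩; exact p.weight_nonneg hw)

variable [Fintype V]

lemma Connected.exists_isPath_isLeast (hG : G.Connected) (hw : ∀ e ∈ G.edgeSet, 0 < w e)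
    (u v : V) : ∃ p : G.Walk u v, p.IsPath ∧
      IsLeast {L : ℝ | ∃ p : G.Walk u v, L = (p.edges.map w).sum} (p.weight w) := by
  classical
  have : Nonempty (G.Path u v) := (hG u v).elim fun p => ⟨p.toPath⟩
  obtain ⟨p, hp⟩ := Finite.exists_min fun p : G.Path u v => p.1.weight w
  refine ⟨p.1, p.2, ⟨p.1, rfl⟩, ?_⟩
  rintro _ ⟨q, rfl⟩
  exact (hp q.toPath).trans (q.weight_bypass_le hw)

lemma Connected.exists_weight_eq_wdist (hG : G.Connected) (hw : ∀ e ∈ G.edgeSet, 0 < w e)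
    (u v : V) : ∃ p : G.Walk u v, p.weight w = wdist G w u v := by
  obtain ⟨p, -, hp⟩ := hG.exists_isPath_isLeast hw u v
  exact ⟨p, hp.csInf_eq.symm⟩

lemma Connected.wdist_triangle (hG : G.Connected) (hw : ∀ e ∈ G.edgeSet, 0 < w e) (u v z : V) :
    wdist G w u z ≤ wdist G w u v + wdist G w v z := by
  obtain ⟨p, hp⟩ := hG.exists_weight_eq_wdist hw u v
  obtain ⟨q, hq⟩ := hG.exists_weight_eq_wdist hw v z
  simpa [← hp, ← hq] using (p.append q).wdist_le_weight hw

end Distance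
section Spanner

variable {U : Type} {S T : SimpleGraph U} {t : ℕ}

lemma ncard_neighborSet (S : SimpleGraph U) (a : U) [Fintype (S.neighborSet a)] :
    (S.neighborSet a).ncard = S.degree a := by
  rw [Set.ncard_eq_toFinset_card', ← card_neighborFinset_eq_degree, neighborFinset]

/-- Every detour around an edge has at least `2 * t` edges; equivalently, the girth exceeds
`2 * t`. -/
def HasLongDetours (S : SimpleGraph U) (t : ℕ) : Prop :=
  ∀ ⦃a b : U⦄, S.Adj a b → ∀ p : S.Walk a b, s(a, b) ∉ p.edges → 2 * t ≤ p.length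

lemma HasLongDetours.mono (hS : S.HasLongDetours t) (h : T ≤ S) : T.HasLongDetours t :=
  fun a b hab p hp => by simpa using hS (h hab) (p.mapLe h) (by simpa using hp)

/-- In a graph of girth exceeding `2 * t`, paths of length at most `t` with the same endpoints
coincide; here we record that they have the same first step. -/
lemma HasLongDetours.eq_of_isPath_cons (hS : S.HasLongDetours t) {x v z z' : U}
    (h : S.Adj x z) (h' : S.Adj x z') (p : S.Walk z v) (p' : S.Walk z' v)
    (hp : (Walk.cons h p).IsPath) (hp' : (Walk.cons h' p').IsPath)
    (hl : p.length < t) (hl' : p'.length < t) : z = z' := by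
  by_contra hne
  rw [Walk.cons_isPath_iff] at hp hp'
  have := hS h ((Walk.cons h' p').append p.reverse) (by
    simp only [Walk.edges_append, Walk.edges_cons, Walk.edges_reverse, List.mem_append,
      List.mem_cons, List.mem_reverse, not_or]
    refine ⟨⟨?_, fun hm => hp'.2 (p'.fst_mem_support_of_mem_edges hm)⟩,
      fun hm => hp.2 (p.fst_mem_support_of_mem_edges hm)⟩
    simp only [Sym2.eq_iff]
    rintro (⟨-, h1⟩ | ⟨h1, h2⟩)
    · exact hne h1
    · exact h'.ne h1)
  simp at this
  lia

lemma HasLongDetours.pow_le_ncard [Finite U] (hS : S.HasLongDetours t) {d : ℕ}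
    (hd : ∀ a b, S.Adj a b → d + 1 ≤ (S.neighborSet a).ncard) {l : ℕ} (hl : l ≤ t) {x y : U}
    (hxy : S.Adj x y) :
    d ^ l ≤ {v | ∃ p : S.Walk x v, p.IsPath ∧ p.length = l ∧ s(x, y) ∉ p.edges}.ncard := by
  classical
  have := Fintype.ofFinite U
  induction l generalizing x y with
  | zero =>
    rw [pow_zero, Nat.one_le_iff_ne_zero, ← Nat.pos_iff_ne_zero, Set.ncard_pos]
    exact ⟨x, Walk.nil, by simp⟩
  | succ l ih =>
    set N := (S.neighborFinset x).erase y with hN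
    set B : U → Finset U := fun z =>
      {v | ∃ p : S.Walk z v, p.IsPath ∧ p.length = l ∧ s(z, x) ∉ p.edges} with hB
    have hcons : ∀ z (h : S.Adj x z) v (p : S.Walk z v), p.IsPath → p.length = l →
        s(z, x) ∉ p.edges → (Walk.cons h p).IsPath := by
      intro z h v p hp hpl hzx
      rw [Walk.cons_isPath_iff]
      refine ⟨hp, fun hx => ?_⟩
      have := hS h.symm (p.takeUntil x hx) fun hm => hzx (p.edges_takeUntil_subset_edges hx hm)
      have := p.length_takeUntil_le_length hx
      lia
    have hNc : d ≤ #N := by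
      rw [hN, card_erase_of_mem (by simpa using hxy), card_neighborFinset_eq_degree]
      have := hd x y hxy
      rw [ncard_neighborSet] at this
      lia
    have hBc : ∀ z ∈ N, d ^ l ≤ #(B z) := by
      intro z hz
      have hxz : S.Adj x z := by simpa using (mem_erase.1 hz).2
      have := ih (by lia) hxz.symm
      rwa [Set.ncard_eq_toFinset_card', Set.toFinset_ofPred] at this
    have hdisj : (N : Set U).PairwiseDisjoint B := by
      intro z hz z' hz' hne
      have hxz : S.Adj x z := by simpa using (mem_erase.1 hz).2
      have hxz' : S.Adj x z' := by simpa using (mem_erase.1 hz').2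
      rw [Function.onFun, Finset.disjoint_left]
      intro v hv hv'
      simp only [hB, mem_filter_univ] at hv hv'
      obtain ⟨p, hp, hpl, hpe⟩ := hv
      obtain ⟨p', hp', hpl', hpe'⟩ := hv'
      exact hne (hS.eq_of_isPath_cons hxz hxz' p p' (hcons _ _ _ p hp hpl hpe)
        (hcons _ _ _ p' hp' hpl' hpe') (by lia) (by lia))
    calc d ^ (l + 1) = d * d ^ l := by ring
      _ ≤ #N * d ^ l := by gcongr
      _ ≤ ∑ z ∈ N, #(B z) := by simpa using card_nsmul_le_sum N (fun z => #(B z)) _ hBc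
      _ = #(N.biUnion B) := (card_biUnion hdisj).symm
      _ ≤ _ := by
        rw [← Set.ncard_coe_finset]
        refine Set.ncard_le_ncard (fun v hv => ?_) (Set.toFinite _)
        simp only [coe_biUnion, Set.mem_iUnion, mem_coe, exists_prop, hB, mem_filter_univ] at hv
        obtain ⟨z, hz, p, hp, hpl, hpe⟩ := hv
        have hxz : S.Adj x z := by simpa using (mem_erase.1 hz).2
        have hcp := hcons z hxz v p hp hpl hpe
        refine ⟨Walk.cons hxz p, hcp, by simp [hpl], ?_⟩
        rw [Walk.cons_isPath_iff] at hcp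
        simp only [Walk.edges_cons, List.mem_cons, not_or]
        refine ⟨?_, fun hm => hcp.2 (p.fst_mem_support_of_mem_edges hm)⟩
        simp only [Sym2.eq_iff]
        rintro (⟨-, h1⟩ | ⟨h1, h2⟩)
        · exact (mem_erase.1 hz).1 h1.symm
        · exact hxz.ne h1

/-- A graph with more than `d` edges per vertex contains a nonempty subgraph in which every
non-isolated vertex has degree greater than `d`. -/
lemma exists_le_forall_lt_ncard_neighborSet [Finite U] {d : ℕ}
    (h : d * Nat.card U < S.edgeSet.ncard) :
    ∃ T ≤ S, T.edgeSet.Nonempty ∧ ∀ a b, T.Adj a b → d + 1 ≤ (T.neighborSet a).ncard := by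
  classical
  have := Fintype.ofFinite U
  obtain ⟨T, hTS, hT⟩ := exists_minimal_le_of_wellFoundedLT
    (fun T : SimpleGraph U => d * T.support.ncard < T.edgeSet.ncard) S
    (lt_of_le_of_lt (Nat.mul_le_mul_left d (Set.ncard_le_card _)) h)
  refine ⟨T, hTS, ?_, fun a b hab => ?_⟩
  · rw [← Set.ncard_pos]
    exact lt_of_le_of_lt (Nat.zero_le _) hT.1
  by_contra hlt
  have hlt : T.degree a ≤ d := by
    rw [ncard_neighborSet] at hlt
    lia
  have haT : a ∈ T.support := ⟨b, hab⟩
  have hdel : d * (T.deleteIncidenceSet a).support.ncard <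
      (T.deleteIncidenceSet a).edgeSet.ncard := by
    have h1 : (T.deleteIncidenceSet a).support.ncard + 1 ≤ T.support.ncard := by
      rw [← Set.ncard_sdiff_singleton_add_one haT]
      gcongr
      · exact Set.toFinite _
      · exact support_deleteIncidenceSet_subset T a
    have h2 : T.edgeSet.ncard ≤ (T.deleteIncidenceSet a).edgeSet.ncard + T.degree a := by
      have := card_edgeFinset_deleteIncidenceSet T a
      rw [← coe_edgeFinset, ← coe_edgeFinset, Set.ncard_coe_finset, Set.ncard_coe_finset]
      lia
    have h3 := hT.1
    have h4 := Nat.mul_le_mul_left d h1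
    simp only at h3
    lia
  have := hT.2 hdel (deleteIncidenceSet_le T a) hab
  rw [deleteIncidenceSet_adj] at this
  exact this.2.1 rfl

/-- The Moore bound: a graph on `k` vertices of girth exceeding `2 * t` has `O(k ^ (1 + 1 / t))`
edges. -/
lemma HasLongDetours.ncard_edgeSet_le [Finite U] [Nonempty U] (hS : S.HasLongDetours t)
    (ht : 1 ≤ t) :
    (S.edgeSet.ncard : ℝ) ≤ 2 * (Nat.card U : ℝ) ^ ((1 : ℝ) + 1 / t) := by
  classical
  have hk : (1 : ℝ) ≤ Nat.card U := by exact_mod_cast Nat.card_pos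
  have hk0 : (0 : ℝ) < Nat.card U := by linarith
  set r : ℝ := (Nat.card U : ℝ) ^ ((1 : ℝ) / t) with hr
  have hr1 : 1 ≤ r := Real.one_le_rpow hk (by positivity)
  set d : ℕ := ⌊r⌋₊ + 1 with hd
  have hrd : r < d := by push_cast [hd]; exact Nat.lt_floor_add_one r
  have hdr : (d : ℝ) ≤ r + 1 := by
    push_cast [hd]; gcongr; exact Nat.floor_le (by linarith)
  have hle : S.edgeSet.ncard ≤ d * Nat.card U := by
    by_contra! hlt
    obtain ⟨T, hTS, ⟨e, he⟩, hdeg⟩ := exists_le_forall_lt_ncard_neighborSet hlt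
    induction e with | _ a b
    have h1 := ((hS.mono hTS).pow_le_ncard hdeg le_rfl he).trans (Set.ncard_le_card _)
    have h2 : (Nat.card U : ℝ) < (d : ℝ) ^ t := by
      calc (Nat.card U : ℝ) = r ^ t := by
            rw [hr, ← Real.rpow_natCast, ← Real.rpow_mul hk0.le, one_div,
              inv_mul_cancel₀ (by positivity), Real.rpow_one]
        _ < d ^ t := by gcongr
    exact absurd h1 (by exact_mod_cast not_le.2 h2)
  calc (S.edgeSet.ncard : ℝ) ≤ d * Nat.card U := by exact_mod_cast hle
    _ ≤ (2 * r) * Nat.card U := by gcongr; linarith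
    _ = _ := by rw [Real.rpow_add hk0, Real.rpow_one]; ring

/-- The greedy spanner of the pairs in `E`. -/
lemma exists_greedy_spanner [Finite U] (δ : Sym2 U → ℝ) (hδ : ∀ e, 0 ≤ δ e) (ht : 1 ≤ t)
    (E : Finset (Sym2 U)) :
    ∃ S : SimpleGraph U, S.edgeSet ⊆ E ∧ S.HasLongDetours t ∧
      ∀ a b, a ≠ b → s(a, b) ∈ E → ∃ p : S.Walk a b, p.weight δ ≤ (2 * t - 1) * δ s(a, b) := by
  classical
  induction E using Finset.induction_on_max_value δ with
  | empty => exact ⟨⊥, by simp, fun a b h => h.elim, by simp⟩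
  | insert e E he hmax ih =>
    obtain ⟨S, hSE, hS, hspan⟩ := ih
    induction e with | _ a b
    by_cases hgood : a = b ∨ ∃ p : S.Walk a b, p.weight δ ≤ (2 * t - 1) * δ s(a, b)
    · refine ⟨S, hSE.trans (by simp), hS, fun c d hcd hm => ?_⟩
      obtain hm | hm := mem_insert.1 hm
      · obtain rfl | ⟨p, hp⟩ := hgood
        · simp only [Sym2.eq_iff] at hm; grind
        · rcases Sym2.eq_iff.1 hm with ⟨rfl, rfl⟩ | ⟨rfl, rfl⟩
          · exact ⟨p, hp⟩
          · exact ⟨p.reverse, by rwa [Walk.weight_reverse, hm]⟩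
      · exact hspan c d hcd hm
    · push Not at hgood
      obtain ⟨hab, hbad⟩ := hgood
      have hlong : ∀ p : S.Walk a b, 2 * t ≤ p.length := by
        intro p
        by_contra! hlt
        have h1 := p.weight_le_length_mul (w := δ) (c := δ s(a, b)) fun f hf =>
          hmax f (hSE (p.edges_subset_edgeSet hf))
        have h2 : (p.length : ℝ) ≤ 2 * t - 1 := by
          have : p.length + 1 ≤ 2 * t := hlt
          have : (p.length : ℝ) + 1 ≤ 2 * t := by exact_mod_cast this
          linarith
        exact absurd (hbad p)
          (not_lt.2 (h1.trans (mul_le_mul_of_nonneg_right h2 (hδ _))))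
      have hedge : ∀ f, f ∈ (S ⊔ edge a b).edgeSet ↔ f ∈ S.edgeSet ∨ f = s(a, b) := by
        intro f
        rw [edgeSet_sup, edgeSet_edge_of_ne hab]
        rfl
      have hback : ∀ {c d : U} (p : (S ⊔ edge a b).Walk c d), s(a, b) ∉ p.edges →
          ∀ f ∈ p.edges, f ∈ S.edgeSet := by
        intro c d p hp f hf
        obtain h | rfl := (hedge f).1 (p.edges_subset_edgeSet hf)
        · exact h
        · exact absurd hf hp
      refine ⟨S ⊔ edge a b, ?_, ?_, ?_⟩
      · intro f hf
        obtain h | rfl := (hedge f).1 hf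
        · exact mem_insert_of_mem (hSE h)
        · exact mem_insert_self _ _
      · intro c d hcd q hq
        have hcd' := (hedge s(c, d)).1 hcd
        by_cases hqab : s(a, b) ∈ q.bypass.edges
        · have hne : s(c, d) ≠ s(a, b) := fun h => hq (h ▸ q.edges_bypass_subset_edges hqab)
          have hScd : S.Adj c d := hcd'.resolve_right hne
          have hnd := q.bypass_isPath.isTrail.edges_nodup
          have hlen := q.length_bypass_le_length
          obtain ⟨x, y, r, hxy, r', hxyab, hqr⟩ :=
            q.bypass.exists_append_cons_of_mem_edges hqab
          rw [hqr] at hnd hlen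
          simp only [Walk.edges_append, Walk.edges_cons, hxyab] at hnd
          have h1 : s(a, b) ∉ r.edges := by
            intro h; rw [List.nodup_append] at hnd; exact hnd.2.2 _ h _ (by simp) rfl
          have h2 : s(a, b) ∉ r'.edges := by
            rw [List.nodup_append, List.nodup_cons] at hnd; exact hnd.2.1.1
          let W : S.Walk x y := (r.transfer S (hback r h1)).reverse.append
            (Walk.cons hScd (r'.transfer S (hback r' h2)).reverse)
          have hW : W.length ≤ q.length := by
            simp [W] at hlen ⊢
            lia
          refine le_trans ?_ hW
          rcases Sym2.eq_iff.1 hxyab with ⟨rfl, rfl⟩ | ⟨rfl, rfl⟩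
          · exact hlong W
          · simpa using hlong W.reverse
        · have hlen := q.length_bypass_le_length
          have htr := hback q.bypass hqab
          obtain h | h := hcd'
          · have := hS h (q.bypass.transfer S htr)
              (by simpa using fun h => hq (q.edges_bypass_subset_edges h))
            simp at this
            lia
          · rcases Sym2.eq_iff.1 h with ⟨rfl, rfl⟩ | ⟨rfl, rfl⟩
            · have := hlong (q.bypass.transfer S htr)
              simp at this
              lia
            · have := hlong (q.bypass.transfer S htr).reverse
              simp at this
              lia
      · intro c d hcd hm
        obtain hm | hm := mem_insert.1 hm
        · have hadj : (S ⊔ edge a b).Adj c d := (hedge s(c, d)).2 (Or.inr hm)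
          refine ⟨Walk.cons hadj Walk.nil, ?_⟩
          have : (1 : ℝ) ≤ t := by exact_mod_cast ht
          have := hδ s(c, d)
          simp
          nlinarith
        · obtain ⟨p, hp⟩ := hspan c d hcd hm
          exact ⟨p.mapLe le_sup_left, by simpa using hp⟩

end Spanner
section Preserver

variable {G H : SimpleGraph V} {w : Sym2 V → ℝ} {s t s' t' u v x z : V}

lemma Walk.exists_mem_support_split [DecidableEq V] (p : H.Walk u v) (hx : x ∈ p.support)
    (hz : z ∈ p.support) :
    (∃ (a : H.Walk u x) (b : H.Walk x z) (c : H.Walk z v), p = a.append (b.append c)) ∨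
      ∃ (a : H.Walk u z) (b : H.Walk z x) (c : H.Walk x v), p = a.append (b.append c) := by
  rw [← p.take_spec hx, mem_support_append_iff] at hz
  obtain hz | hz := hz
  · exact Or.inr ⟨(p.takeUntil x hx).takeUntil z hz, (p.takeUntil x hx).dropUntil z hz,
      p.dropUntil x hx, by rw [append_assoc, take_spec, take_spec]⟩
  · exact Or.inl ⟨p.takeUntil x hx, (p.dropUntil x hx).takeUntil z hz,
      (p.dropUntil x hx).dropUntil z hz, by rw [take_spec, take_spec]⟩

variable [Fintype V]

/-- The part of a shortest walk between two of its vertices is a shortest walk. -/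
lemma Walk.exists_edges_subset_of_mem_support (hG : G.Connected) (hw : ∀ e ∈ G.edgeSet, 0 < w e)
    (hH : H ≤ G) (q : H.Walk s t) (hq : q.weight w ≤ wdist G w s t) (hx : x ∈ q.support)
    (hz : z ∈ q.support) :
    ∃ r : H.Walk x z, r.edges ⊆ q.edges ∧ r.weight w ≤ wdist G w x z := by
  classical
  have key : ∀ {x z : V} (a : H.Walk s x) (b : H.Walk x z) (c : H.Walk z t),
      q = a.append (b.append c) → b.weight w ≤ wdist G w x z := by
    intro x z a b c h
    have h1 := hG.wdist_triangle hw s x t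
    have h2 := hG.wdist_triangle hw x z t
    have h3 := a.wdist_le_weight_of_le hw hH
    have h4 := c.wdist_le_weight_of_le hw hH
    rw [h, weight_append, weight_append] at hq
    linarith
  obtain ⟨a, b, c, h⟩ | ⟨a, b, c, h⟩ := q.exists_mem_support_split hx hz
  · exact ⟨b, by rw [h]; intro e; simp; tauto, key a b c h⟩
  · refine ⟨b.reverse, by rw [h]; intro e; simp; tauto, ?_⟩
    rw [weight_reverse, wdist_comm]
    exact key a b c h

/-- If all shortest walks from `s` to `t` in `H` use a given edge of the shortest path `p`, and
that edge lies on `p` between two vertices of a shortest walk `q`, then `q` uses the edge. -/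
lemma Walk.mem_edges_of_mem_support (hG : G.Connected) (hw : ∀ e ∈ G.edgeSet, 0 < w e)
    (hH : H ≤ G) {p : H.Walk s t} (hp : p.IsPath) (hpw : p.weight w ≤ wdist G w s t)
    {q : H.Walk s' t'} (hq : q.weight w ≤ wdist G w s' t') {a b n : ℕ}
    (han : a ≤ n) (hnb : n < b) (hb : b ≤ p.length)
    (hcrit : ∀ p' : H.Walk s t, p'.weight w ≤ wdist G w s t →
      s(p.getVert n, p.getVert (n + 1)) ∈ p'.edges)
    (ha' : p.getVert a ∈ q.support) (hb' : p.getVert b ∈ q.support) :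
    s(p.getVert n, p.getVert (n + 1)) ∈ q.edges := by
  obtain ⟨p₁, p', hpp', hl₁⟩ := p.exists_append_of_getVert_eq (n := a) (by lia) rfl
  have hlen : p.length = p₁.length + p'.length := by rw [← length_append, ← hpp']
  obtain ⟨p₂, p₃, hp₂₃, hl₂⟩ := p'.exists_append_of_getVert_eq (n := b - a)
    (z := p.getVert b) (by lia) (by
      conv_rhs => rw [hpp', getVert_append]
      rw [if_neg (by lia), hl₁])
  obtain ⟨r, hr, hrw⟩ := q.exists_edges_subset_of_mem_support hG hw hH hq ha' hb'
  set e := s(p.getVert n, p.getVert (n + 1)) with he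
  have hedges : p.edges = p₁.edges ++ (p₂.edges ++ p₃.edges) := by
    rw [← edges_append, ← edges_append, ← hp₂₃, ← hpp']
  have hmem : e ∈ p₂.edges := by
    have h1 : p.edges[n]? = some e := by
      rw [List.getElem?_eq_getElem (by simp; lia), getElem_edges]
    rw [hedges, List.getElem?_append_right (by simp; lia),
      List.getElem?_append_left (by simp; lia)] at h1
    exact List.mem_of_getElem? h1
  have hnd := hp.isTrail.edges_nodup
  rw [hedges, List.nodup_append, List.nodup_append] at hnd
  have h₁ : e ∉ p₁.edges := fun h => hnd.2.2 _ h _ (by simp [hmem]) rfl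
  have h₃ : e ∉ p₃.edges := fun h => hnd.2.1.2.2 _ hmem _ h rfl
  have hweight : p.weight w = p₁.weight w + (p₂.weight w + p₃.weight w) := by
    rw [← weight_append, ← weight_append, ← hp₂₃, ← hpp']
  have h₂ := p₂.wdist_le_weight_of_le hw hH
  have := hcrit (p₁.append (r.append p₃)) (by
    rw [weight_append, weight_append]; linarith)
  simp only [edges_append, List.mem_append] at this
  exact hr (by tauto)

/-- Two shortest walks diverge at most twice, as far as indispensable edges of the first one are
concerned. -/
lemma Walk.ncard_branching_le (hG : G.Connected) (hw : ∀ e ∈ G.edgeSet, 0 < w e)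
    (hH : H ≤ G) {p : H.Walk s t} (hp : p.IsPath) (hpw : p.weight w ≤ wdist G w s t)
    {q : H.Walk s' t'} (hq : q.weight w ≤ wdist G w s' t') :
    {c : V × Sym2 V | c.1 ∈ c.2 ∧ (∀ p' : H.Walk s t, p'.weight w ≤ wdist G w s t →
      c.2 ∈ p'.edges) ∧ c.1 ∈ q.support ∧ c.2 ∉ q.edges}.ncard ≤ 2 := by
  set B := {c : V × Sym2 V | c.1 ∈ c.2 ∧ (∀ p' : H.Walk s t, p'.weight w ≤ wdist G w s t →
      c.2 ∈ p'.edges) ∧ c.1 ∈ q.support ∧ c.2 ∉ q.edges} with hB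
  have hsub : B ⊆
      {c ∈ B | ∃ n < p.length, c = (p.getVert n, s(p.getVert n, p.getVert (n + 1)))} ∪
      {c ∈ B | ∃ n < p.length, c = (p.getVert (n + 1), s(p.getVert n, p.getVert (n + 1)))} := by
    rintro ⟨x, e⟩ hc
    obtain ⟨n, hn, h, hx | hx⟩ := (mem_of_mem_edges_iff p).1 ⟨hc.1, hc.2.1 p hpw⟩
    · exact Or.inl ⟨hc, n, hn, Prod.ext hx h⟩
    · exact Or.inr ⟨hc, n, hn, Prod.ext hx h⟩
  have h1 : {c ∈ B | ∃ n < p.length,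
      c = (p.getVert n, s(p.getVert n, p.getVert (n + 1)))}.Subsingleton := by
    have : ∀ n m, n < m → m < p.length →
        (p.getVert n, s(p.getVert n, p.getVert (n + 1))) ∈ B →
        (p.getVert m, s(p.getVert m, p.getVert (m + 1))) ∈ B → False :=
      fun n m hnm hm hn' hm' => hn'.2.2.2 <| mem_edges_of_mem_support hG hw hH hp hpw hq
        (le_refl n) hnm hm.le hn'.2.1 hn'.2.2.1 hm'.2.2.1
    rintro _ ⟨hc, n, hn, rfl⟩ _ ⟨hc', m, hm, rfl⟩
    obtain h | rfl | h := lt_trichotomy n m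
    · exact (this n m h hm hc hc').elim
    · rfl
    · exact (this m n h hn hc' hc).elim
  have h2 : {c ∈ B | ∃ n < p.length,
      c = (p.getVert (n + 1), s(p.getVert n, p.getVert (n + 1)))}.Subsingleton := by
    have : ∀ n m, n < m → m < p.length →
        (p.getVert (n + 1), s(p.getVert n, p.getVert (n + 1))) ∈ B →
        (p.getVert (m + 1), s(p.getVert m, p.getVert (m + 1))) ∈ B → False :=
      fun n m hnm hm hn' hm' => hm'.2.2.2 <| mem_edges_of_mem_support hG hw hH hp hpw hq
        hnm (Nat.lt_succ_self m) hm hm'.2.1 hn'.2.2.1 hm'.2.2.1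
    rintro _ ⟨hc, n, hn, rfl⟩ _ ⟨hc', m, hm, rfl⟩
    obtain h | rfl | h := lt_trichotomy n m
    · exact (this n m h hm hc hc').elim
    · rfl
    · exact (this m n h hn hc' hc).elim
  calc _ ≤ _ := Set.ncard_le_ncard hsub (h1.finite.union h2.finite)
    _ ≤ _ := Set.ncard_union_le _ _
    _ ≤ 1 + 1 := add_le_add ((Set.ncard_le_one h1.finite).2 fun a ha b hb => h1 ha hb)
        ((Set.ncard_le_one h2.finite).2 fun a ha b hb => h2 ha hb)

/-- Counting pairs of edges at a common vertex: if the edges of `H` are distributed among paths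
that pairwise branch at most twice, then `H` has few such pairs. -/
lemma sum_degree_sq_le [DecidableEq V] [DecidableRel H.Adj] {ι : Type} [Fintype ι] {s t : ι → V}
    (P : ∀ i, H.Walk (s i) (t i)) (hP : ∀ i, (P i).IsPath) (o : Sym2 V → ι)
    (ho : ∀ e ∈ H.edgeSet, e ∈ (P (o e)).edges)
    (hB : ∀ i j, {c : V × Sym2 V | c.1 ∈ c.2 ∧ c.2 ∈ H.edgeSet ∧ o c.2 = i ∧
      c.1 ∈ (P j).support ∧ c.2 ∉ (P j).edges}.ncard ≤ 2) :
    ∑ x, H.degree x ^ 2 ≤ 2 * ∑ x, H.degree x + 4 * Fintype.card ι ^ 2 := by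
  classical
  set I : V → Finset (Sym2 V) := fun x => H.incidenceFinset x with hI
  have hIc : ∀ x, #(I x) = H.degree x := fun x => H.card_incidenceFinset_eq_degree x
  have hmI : ∀ {x e}, e ∈ I x ↔ e ∈ H.edgeSet ∧ x ∈ e := by
    intro x e
    simp [hI, incidenceSet]
  set T : Finset (Σ _ : V, Sym2 V × Sym2 V) := univ.sigma fun x => I x ×ˢ I x with hT
  have hTc : ∑ x, H.degree x ^ 2 = #T := by
    rw [hT, card_sigma]
    exact sum_congr rfl fun x _ => by rw [card_product, hIc, sq]
  have hinc : ∀ i x, #{e | x ∈ e ∧ e ∈ (P i).edges} ≤ 2 := by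
    intro i x
    rw [← Set.ncard_coe_finset]
    simpa using (hP i).ncard_incident_edges_le x
  have h1 : #{c ∈ T | c.2.1 ∈ (P (o c.2.2)).edges} ≤ 2 * ∑ x, H.degree x := by
    have hc : #(univ.sigma I) = ∑ x, H.degree x := by
      rw [card_sigma]; exact sum_congr rfl fun x _ => hIc x
    rw [← hc]
    refine card_le_mul_card_image_of_maps_to
      (f := fun c => (⟨c.1, c.2.2⟩ : Σ _ : V, Sym2 V)) ?_ 2 ?_
    · rintro ⟨x, e, f⟩ h
      simp only [hT, mem_filter, mem_sigma, mem_product] at h ⊢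
      exact ⟨mem_univ _, h.1.2.2⟩
    · rintro ⟨x, f⟩ -
      refine le_trans (card_le_card_of_injOn (fun c => c.2.1) ?_ ?_) (hinc (o f) x)
      · rintro ⟨x', e, f'⟩ h
        simp only [hT, coe_filter, mem_filter, mem_sigma, mem_product, Set.mem_ofPred_eq,
          Sigma.mk.injEq, heq_eq_eq, mem_univ, true_and, hmI] at h ⊢
        obtain ⟨⟨⟨h1, h2⟩, h3⟩, rfl, rfl⟩ := h
        exact ⟨h1.2, h3⟩
      · rintro ⟨x', e, f'⟩ h ⟨x'', e', f''⟩ h' heq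
        simp only [coe_filter, Set.mem_ofPred_eq, Sigma.mk.injEq, heq_eq_eq] at h h' heq
        obtain ⟨-, rfl, rfl⟩ := h
        obtain ⟨-, rfl, rfl⟩ := h'
        rw [heq]
  set Br : Finset (Σ _ : ι × ι, V × Sym2 V) := univ.sigma fun i =>
    {c | c.1 ∈ c.2 ∧ c.2 ∈ H.edgeSet ∧ o c.2 = i.1 ∧
      c.1 ∈ (P i.2).support ∧ c.2 ∉ (P i.2).edges} with hBr
  have hBrc : #Br ≤ 2 * Fintype.card ι ^ 2 := by
    rw [hBr, card_sigma]
    calc _ ≤ ∑ _i : ι × ι, 2 := by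
          refine sum_le_sum fun i _ => ?_
          rw [← Set.ncard_coe_finset]
          simpa using hB i.1 i.2
      _ = _ := by simp; ring
  have h2 : #{c ∈ T | ¬ c.2.1 ∈ (P (o c.2.2)).edges} ≤ 2 * #Br := by
    refine card_le_mul_card_image_of_maps_to (f := fun c =>
      (⟨(o c.2.1, o c.2.2), (c.1, c.2.1)⟩ : Σ _ : ι × ι, V × Sym2 V)) ?_ 2 ?_
    · rintro ⟨x, e, f⟩ h
      simp only [hT, hBr, mem_filter, mem_sigma, mem_product, hmI, mem_univ, true_and] at h ⊢
      obtain ⟨⟨⟨h1, h2⟩, h3, h4⟩, h5⟩ := h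
      exact ⟨h2, h1, Walk.mem_support_of_mem_edges (ho f h3) h4, h5⟩
    · rintro ⟨⟨i, j⟩, x, e⟩ -
      refine le_trans (card_le_card_of_injOn (fun c => c.2.2) ?_ ?_) (hinc j x)
      · rintro ⟨x', e', f⟩ h
        simp only [hT, coe_filter, mem_filter, mem_sigma, mem_product, Set.mem_ofPred_eq,
          Sigma.mk.injEq, heq_eq_eq, Prod.mk.injEq, mem_univ, true_and, hmI] at h ⊢
        obtain ⟨⟨⟨h1, h2, h3⟩, h4⟩, ⟨rfl, rfl⟩, rfl, rfl⟩ := h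
        exact ⟨h3, ho f h2⟩
      · rintro ⟨x', e', f⟩ h ⟨x'', e'', f'⟩ h' heq
        simp only [coe_filter, Set.mem_ofPred_eq, Sigma.mk.injEq, heq_eq_eq,
          Prod.mk.injEq] at h h' heq
        obtain ⟨-, -, rfl, rfl⟩ := h
        obtain ⟨-, -, rfl, rfl⟩ := h'
        rw [heq]
  have := card_filter_add_card_filter_not (s := T) fun c => c.2.1 ∈ (P (o c.2.2)).edges
  rw [hTc]
  lia

/-- Distance preservers: `p` distances of a weighted graph on `n` vertices are preserved by a
subgraph with at most `n + √n * p` edges. -/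
lemma Connected.exists_distance_preserver (hG : G.Connected) (hw : ∀ e ∈ G.edgeSet, 0 < w e)
    {ι : Type} [Fintype ι] (s t : ι → V) :
    ∃ H ≤ G, (∀ i, ∃ p : H.Walk (s i) (t i), p.weight w ≤ wdist G w (s i) (t i)) ∧
      (H.edgeSet.ncard : ℝ) ≤ Fintype.card V + √(Fintype.card V) * Fintype.card ι := by
  classical
  obtain hι | hι := isEmpty_or_nonempty ι
  · exact ⟨⊥, bot_le, fun i => hι.elim i, by simp⟩
  obtain ⟨H, hH, hmin⟩ := exists_minimal_le_of_wellFoundedLT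
    (fun H : SimpleGraph V =>
      ∀ i, ∃ p : H.Walk (s i) (t i), p.weight w ≤ wdist G w (s i) (t i)) G
    fun i => (hG.exists_weight_eq_wdist hw (s i) (t i)).imp fun p hp => hp.le
  refine ⟨H, hH, hmin.1, ?_⟩
  have hwH : ∀ e ∈ H.edgeSet, 0 < w e := fun e he => hw e (edgeSet_mono hH he)
  have hpath : ∀ i, ∃ p : H.Walk (s i) (t i), p.IsPath ∧ p.weight w ≤ wdist G w (s i) (t i) :=
    fun i => (hmin.1 i).elim fun p hp =>
      ⟨p.bypass, p.bypass_isPath, (p.weight_bypass_le hwH).trans hp⟩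
  choose P hP hPw using hpath
  have hcrit : ∀ e ∈ H.edgeSet, ∃ i, ∀ p : H.Walk (s i) (t i),
      p.weight w ≤ wdist G w (s i) (t i) → e ∈ p.edges := by
    intro e he
    by_contra! hcon
    have := hmin.2 (y := H.deleteEdges {e}) (fun i => by
      obtain ⟨p, hp, hpe⟩ := hcon i
      exact ⟨p.toDeleteEdge e hpe, by simpa [Walk.toDeleteEdge, Walk.toDeleteEdges] using hp⟩)
      (deleteEdges_le _)
    have := edgeSet_mono this he
    simp at this
  choose! o ho using hcrit
  have hsum := sum_degree_sq_le P hP o (fun e he => ho e he _ (hPw _)) fun i j => by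
    refine le_trans (Set.ncard_le_ncard ?_ (Set.toFinite _))
      (Walk.ncard_branching_le hG hw hH (hP i) (hPw i) (hPw j))
    rintro c ⟨h1, h2, rfl, h4, h5⟩
    exact ⟨h1, ho c.2 h2, h4, h5⟩
  have hcs := sq_sum_le_card_mul_sum_sq (s := univ) (f := fun x => H.degree x)
  rw [sum_degrees_eq_twice_card_edges] at hsum hcs
  have hm : H.edgeSet.ncard = #H.edgeFinset := by
    rw [← coe_edgeFinset, Set.ncard_coe_finset]
  rw [hm]
  have hreal : (#H.edgeFinset : ℝ) ^ 2 ≤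
      Fintype.card V * #H.edgeFinset + Fintype.card V * (Fintype.card ι : ℝ) ^ 2 := by
    have : (2 * #H.edgeFinset) ^ 2 ≤
        Fintype.card V * (2 * (2 * #H.edgeFinset) + 4 * Fintype.card ι ^ 2) :=
      hcs.trans (Nat.mul_le_mul_left _ hsum)
    have : (2 * (#H.edgeFinset : ℝ)) ^ 2 ≤
        Fintype.card V * (2 * (2 * #H.edgeFinset) + 4 * (Fintype.card ι : ℝ) ^ 2) := by
      exact_mod_cast this
    linarith
  by_contra! hlt
  have hs := Real.sqrt_nonneg (Fintype.card V : ℝ)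
  set m : ℝ := (#H.edgeFinset : ℝ)
  set n : ℝ := (Fintype.card V : ℝ)
  set k : ℝ := (Fintype.card ι : ℝ)
  have hk : 0 ≤ k := Nat.cast_nonneg _
  have hn : 0 ≤ n := Nat.cast_nonneg _
  have hsk := mul_nonneg hs hk
  have h1 : m * (n + √n * k) < m * m :=
    mul_lt_mul_of_pos_left hlt (by linarith)
  have h2 : (√n * k) * (√n * k) ≤ m * (√n * k) :=
    mul_le_mul_of_nonneg_right (by linarith) hsk
  have h3 : (√n * k) * (√n * k) = n * k ^ 2 := by
    rw [mul_mul_mul_comm, Real.mul_self_sqrt hn, sq]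
  nlinarith

end Preserver

section TerminalSpanner

variable {G : SimpleGraph V} {w : Sym2 V → ℝ} [Fintype V]

/-- A shortest-path forest rooted at a nonempty set `K` of vertices. -/
lemma Connected.exists_shortest_path_forest (hG : G.Connected) (hw : ∀ e ∈ G.edgeSet, 0 < w e)
    {K : Finset V} (hK : K.Nonempty) :
    ∃ F ≤ G, F.edgeSet.ncard ≤ Fintype.card V ∧
      ∀ u, ∃ k ∈ K, ∃ p : F.Walk u k, ∀ v ∈ K, p.weight w ≤ wdist G w u v := by
  classical
  choose c hcK hc using fun u => K.exists_min_image (fun v => wdist G w u v) hK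
  have hpar : ∀ u, ∃ y, u ∉ K → G.Adj u y ∧ w s(u, y) + wdist G w y (c y) ≤ wdist G w u (c u) := by
    intro u
    obtain ⟨p, hp⟩ := hG.exists_weight_eq_wdist hw u (c u)
    have hcu := hcK u
    rw [← hp]
    generalize c u = z at p hcu
    cases p with
    | nil => exact ⟨u, fun h => (h hcu).elim⟩
    | @cons _ y _ h q =>
      refine ⟨y, fun _ => ⟨h, ?_⟩⟩
      rw [Walk.weight_cons]
      gcongr
      exact (hc y z hcu).trans (q.wdist_le_weight hw)
  choose r hr using hpar
  let F : SimpleGraph V := fromEdgeSet ((fun u => s(u, r u)) '' {u | u ∉ K})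
  have hF : ∀ u, u ∉ K → F.Adj u (r u) := fun u hu =>
    (fromEdgeSet_adj _).2 ⟨⟨u, hu, rfl⟩, (hr u hu).1.ne⟩
  refine ⟨F, ?_, ?_, fun u => ?_⟩
  · intro a b h
    obtain ⟨⟨u, hu, he⟩, -⟩ := (fromEdgeSet_adj _).1 h
    rw [← mem_edgeSet, ← he]
    exact (hr u hu).1
  · calc F.edgeSet.ncard ≤ ((fun u => s(u, r u)) '' {u | u ∉ K}).ncard :=
          Set.ncard_le_ncard (by rw [edgeSet_fromEdgeSet]; exact Set.sdiff_subset) (Set.toFinite _)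
      _ ≤ {u | u ∉ K}.ncard := Set.ncard_image_le (Set.toFinite _)
      _ ≤ _ := by simpa using Set.ncard_le_card {u | u ∉ K}
  · suffices ∃ k ∈ K, ∃ p : F.Walk u k, p.weight w ≤ wdist G w u (c u) by
      obtain ⟨k, hk, p, hp⟩ := this
      exact ⟨k, hk, p, fun v hv => hp.trans (hc u v hv)⟩
    by_contra hu
    obtain ⟨x, hx, hmin⟩ := Set.exists_min_image
      {u | ¬ ∃ k ∈ K, ∃ p : F.Walk u k, p.weight w ≤ wdist G w u (c u)}
      (fun u => wdist G w u (c u)) (Set.toFinite _) ⟨u, hu⟩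
    refine hx ?_
    by_cases hxK : x ∈ K
    · exact ⟨x, hxK, .nil, by simpa using wdist_nonneg hw x (c x)⟩
    obtain ⟨hadj, hle⟩ := hr x hxK
    have hpos := hw _ (G.mem_edgeSet.2 hadj)
    have hgood : ∃ k ∈ K, ∃ p : F.Walk (r x) k, p.weight w ≤ wdist G w (r x) (c (r x)) := by
      by_contra h
      have := hmin (r x) h
      linarith
    obtain ⟨k, hk, p, hp⟩ := hgood
    exact ⟨k, hk, .cons (hF x hxK) p, by rw [Walk.weight_cons]; linarith⟩

/-- Distances inside a set `K` of terminals are approximated by a sparse subgraph: a greedy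
spanner of the metric on `K`, realised by a distance preserver. -/
lemma Connected.exists_subset_spanner (hG : G.Connected) (hw : ∀ e ∈ G.edgeSet, 0 < w e)
    {K : Finset V} (hK : K.Nonempty) {t : ℕ} (ht : 1 ≤ t) :
    ∃ H ≤ G, (H.edgeSet.ncard : ℝ) ≤ Fintype.card V +
        √(Fintype.card V) * (2 * (#K : ℝ) ^ ((1 : ℝ) + 1 / t)) ∧
      ∀ a ∈ K, ∀ b ∈ K, ∃ p : H.Walk a b, p.weight w ≤ (2 * t - 1) * wdist G w a b := by
  classical
  have : Nonempty K := hK.to_subtype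
  let δ : Sym2 K → ℝ :=
    Sym2.lift ⟨fun a b => wdist G w a b, fun a b => wdist_comm G w a b⟩
  have hδ : ∀ a b : K, δ s(a, b) = wdist G w a b := fun a b => rfl
  obtain ⟨S, -, hS, hspan⟩ := exists_greedy_spanner (U := K) δ
    (fun e => by induction e with | _ a b => exact wdist_nonneg hw _ _) ht univ
  have hends : ∀ e : Sym2 K, ∃ a b, e = s(a, b) := fun e => by
    induction e with | _ a b => exact ⟨a, b, rfl⟩
  choose x y hxy using hends
  obtain ⟨H, hH, hwalk, hcard⟩ := hG.exists_distance_preserver hw (ι := S.edgeSet)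
    (fun e => (x e : V)) (fun e => (y e : V))
  have hedge : ∀ a b : K, S.Adj a b → ∃ p : H.Walk (a : V) b, p.weight w ≤ δ s(a, b) := by
    intro a b hab
    obtain ⟨p, hp⟩ := hwalk ⟨s(a, b), hab⟩
    have h := hxy s(a, b)
    rw [← hδ, ← hxy] at hp
    dsimp only at p hp
    revert p
    rw [Sym2.eq_iff] at h
    obtain ⟨h1, h2⟩ | ⟨h1, h2⟩ := h
    · rw [← h1, ← h2]
      exact fun p hp => ⟨p, hp⟩
    · rw [← h1, ← h2]
      exact fun p hp => ⟨p.reverse, by rwa [Walk.weight_reverse]⟩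
  have htrans : ∀ (a b : K) (q : S.Walk a b), ∃ p : H.Walk (a : V) b, p.weight w ≤ q.weight δ := by
    intro a b q
    induction q with
    | nil => exact ⟨.nil, by simp⟩
    | cons h q ih =>
      obtain ⟨p₁, h₁⟩ := hedge _ _ h
      obtain ⟨p₂, h₂⟩ := ih
      exact ⟨p₁.append p₂, by rw [Walk.weight_append, Walk.weight_cons]; gcongr⟩
  refine ⟨H, hH, hcard.trans ?_, fun a ha b hb => ?_⟩
  · have := hS.ncard_edgeSet_le ht
    rw [Nat.card_eq_fintype_card, Fintype.card_coe, ← Nat.card_coe_set_eq,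
      Nat.card_eq_fintype_card] at this
    gcongr
  · have ht' : (1 : ℝ) ≤ t := by exact_mod_cast ht
    by_cases hab : a = b
    · subst hab
      exact ⟨.nil, by
        rw [Walk.weight_nil]
        exact mul_nonneg (by linarith) (wdist_nonneg hw a a)⟩
    · obtain ⟨q, hq⟩ := hspan ⟨a, ha⟩ ⟨b, hb⟩ (by simpa using hab) (mem_univ _)
      obtain ⟨p, hp⟩ := htrans _ _ q
      exact ⟨p, hp.trans hq⟩

end TerminalSpanner

end SimpleGraph

/-- Every connected weighted graph on `n` vertices with `k ≥ 1` terminals admits a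
connected spanning subgraph (a `(4t-1)`-terminal graph spanner) with at most
`C·(n + √n·k^{1+1/t})` edges, in which every terminal-to-vertex distance is stretched
by at most `4t - 1`. -/
theorem terminal_graph_spanner :
    ∃ C : ℝ, 0 < C ∧
      ∀ (V : Type) [Fintype V] (G : SimpleGraph V) (w : Sym2 V → ℝ)
        (K : Finset V) (t : ℕ),
        G.Connected → (∀ e ∈ G.edgeSet, 0 < w e) → 1 ≤ K.card → 1 ≤ t →
        ∃ H : SimpleGraph V, H ≤ G ∧ H.Connected ∧
          (H.edgeSet.ncard : ℝ) ≤
            C * ((Fintype.card V : ℝ) +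
              Real.sqrt (Fintype.card V) * (K.card : ℝ) ^ ((1 : ℝ) + 1 / (t : ℝ))) ∧
          ∀ v ∈ K, ∀ u : V,
            wdist H w u v ≤ (4 * (t : ℝ) - 1) * wdist G w u v := by
  refine ⟨2, two_pos, fun V _ G w K t hG hw hK ht => ?_⟩
  have hK : K.Nonempty := Finset.card_pos.1 hK
  obtain ⟨F, hFG, hFc, hF⟩ := hG.exists_shortest_path_forest hw hK
  obtain ⟨S, hSG, hSc, hS⟩ := hG.exists_subset_spanner hw hK ht
  have hle : F ⊔ S ≤ G := sup_le hFG hSG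
  have hwH : ∀ e ∈ (F ⊔ S).edgeSet, 0 < w e := fun e he =>
    hw e (SimpleGraph.edgeSet_mono hle he)
  have ht' : (1 : ℝ) ≤ t := by exact_mod_cast ht
  have key : ∀ v ∈ K, ∀ u, ∃ p : (F ⊔ S).Walk u v,
      p.weight w ≤ (4 * (t : ℝ) - 1) * wdist G w u v := by
    intro v hv u
    obtain ⟨k, hk, p, hp⟩ := hF u
    obtain ⟨q, hq⟩ := hS k hk v hv
    refine ⟨(p.mapLe le_sup_left).append (q.mapLe le_sup_right), ?_⟩
    rw [SimpleGraph.Walk.weight_append, SimpleGraph.Walk.weight_mapLe,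
      SimpleGraph.Walk.weight_mapLe]
    have h1 := hG.wdist_triangle hw k u v
    have h2 := p.wdist_le_weight_of_le hw hFG
    rw [SimpleGraph.wdist_comm] at h2
    have h3 := hp v hv
    have h4 : (2 * (t : ℝ) - 1) * wdist G w k v ≤ (2 * (t : ℝ) - 1) * (2 * wdist G w u v) :=
      mul_le_mul_of_nonneg_left (by linarith) (by linarith)
    linarith
  refine ⟨F ⊔ S, hle, ?_, ?_, fun v hv u => ?_⟩
  · obtain ⟨v, hv⟩ := hK
    have hr : ∀ u, (F ⊔ S).Reachable u v := fun u => (key v hv u).elim fun p _ => p.reachable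
    exact { preconnected := fun a b => (hr a).trans (hr b).symm, nonempty := ⟨v⟩ }
  · have h1 : (F ⊔ S).edgeSet.ncard ≤ F.edgeSet.ncard + S.edgeSet.ncard := by
      rw [SimpleGraph.edgeSet_sup]
      exact Set.ncard_union_le _ _
    have h1 : ((F ⊔ S).edgeSet.ncard : ℝ) ≤ F.edgeSet.ncard + S.edgeSet.ncard := by
      exact_mod_cast h1
    have h2 : (F.edgeSet.ncard : ℝ) ≤ Fintype.card V := by exact_mod_cast hFc
    linarith
  · obtain ⟨p, hp⟩ := key v hv u
    exact (p.wdist_le_weight hwH).trans hp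
end

section
/- Let G be a connected simple graph on a finite vertex set V with a weight function w assigning a positive real to each edge, let K ⊆ V be a nonempty set of terminals with |K| = k, and let α > 1 be a real parameter. Then there exists a spanning tree T of G (a subgraph of G on the full vertex set that is connected and acyclic) such that: (i) for every v ∈ K and u ∈ V, d_{T,w}(v,u) ≤ (k·α + (k−1)·α²)·d_{G,w}(v,u); and (ii) for every spanning tree T' of G, w(T) ≤ (2α + 1 + 2/(α−1))·w(T'). -/
namespace LightTerminal

open SimpleGraph

/-- The weighted length of a walk. -/
def wlen {V : Type} {H : SimpleGraph V} (w : Sym2 V → ℝ) {u v : V} (p : H.Walk u v) : ℝ :=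
  (p.edges.map w).sum

/-- There is a walk from `u` to `v` in `H` of weighted length at most `L`. -/
def Within {V : Type} (H : SimpleGraph V) (w : Sym2 V → ℝ) (u v : V) (L : ℝ) : Prop :=
  ∃ p : H.Walk u v, wlen w p ≤ L

section Walks

variable {V : Type} {H H' : SimpleGraph V} {w : Sym2 V → ℝ} {u v x : V} {L L' : ℝ}

@[simp] lemma wlen_nil : wlen w (Walk.nil : H.Walk u u) = 0 := by simp [wlen]

@[simp] lemma wlen_cons (h : H.Adj u v) (p : H.Walk v x) :
    wlen w (Walk.cons h p) = w s(u, v) + wlen w p := by simp [wlen]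

@[simp] lemma wlen_append (p : H.Walk u v) (q : H.Walk v x) :
    wlen w (p.append q) = wlen w p + wlen w q := by simp [wlen]

@[simp] lemma wlen_reverse (p : H.Walk u v) : wlen w p.reverse = wlen w p := by
  simp [wlen, List.sum_reverse]

@[simp] lemma wlen_mapLe (h : H ≤ H') (p : H.Walk u v) : wlen w (p.mapLe h) = wlen w p := by
  simp [wlen]

lemma wlen_nonneg (hw : ∀ e ∈ H.edgeSet, 0 ≤ w e) (p : H.Walk u v) : 0 ≤ wlen w p := by
  refine List.sum_nonneg fun y hy => ?_
  obtain ⟨e, he, rfl⟩ := List.mem_map.1 hy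
  exact hw e (p.edges_subset_edgeSet he)

lemma wlen_bypass_le [DecidableEq V] (hw : ∀ e ∈ H.edgeSet, 0 ≤ w e) (p : H.Walk u v) :
    wlen w p.bypass ≤ wlen w p := by
  refine (p.edges_bypass_sublist_edges.map w).sum_le_sum fun y hy => ?_
  obtain ⟨e, he, rfl⟩ := List.mem_map.1 hy
  exact hw e (p.edges_subset_edgeSet he)

lemma Within.refl (h : 0 ≤ L) : Within H w u u L := ⟨.nil, by simpa using h⟩

lemma Within.of_adj (h : H.Adj u v) : Within H w u v (w s(u, v)) := ⟨.cons h .nil, by simp⟩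

lemma Within.trans (h : Within H w u v L) (h' : Within H w v x L') : Within H w u x (L + L') := by
  obtain ⟨p, hp⟩ := h
  obtain ⟨q, hq⟩ := h'
  exact ⟨p.append q, by rw [wlen_append]; linarith⟩

lemma Within.symm (h : Within H w u v L) : Within H w v u L := by
  obtain ⟨p, hp⟩ := h
  exact ⟨p.reverse, by simpa using hp⟩

lemma Within.mono (h : Within H w u v L) (hH : H ≤ H') (hL : L ≤ L') : Within H' w u v L' := by
  obtain ⟨p, hp⟩ := h
  exact ⟨p.mapLe hH, by simpa using hp.trans hL⟩

lemma Within.reachable (h : Within H w u v L) : H.Reachable u v := h.choose.reachable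

lemma Within.wdist_le (hw : ∀ e ∈ H.edgeSet, 0 ≤ w e) (h : Within H w u v L) :
    wdist H w u v ≤ L := by
  obtain ⟨p, hp⟩ := h
  have h : wdist H w u v ≤ wlen w p := by
    refine csInf_le ⟨0, ?_⟩ ⟨p, rfl⟩
    rintro _ ⟨q, rfl⟩
    exact wlen_nonneg hw q
  exact h.trans hp

lemma wdist_nonneg (hw : ∀ e ∈ H.edgeSet, 0 ≤ w e) : 0 ≤ wdist H w u v := by
  refine Real.sInf_nonneg ?_
  rintro _ ⟨q, rfl⟩
  exact wlen_nonneg hw q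

lemma wdist_comm : wdist H w u v = wdist H w v u := by
  unfold wdist
  congr 1
  ext L
  constructor <;> rintro ⟨p, rfl⟩ <;> exact ⟨p.reverse, (wlen_reverse p).symm⟩

lemma exists_wlen_eq_wdist [Fintype V] (hw : ∀ e ∈ H.edgeSet, 0 ≤ w e) (hr : H.Reachable u v) :
    ∃ p : H.Walk u v, wlen w p = wdist H w u v := by
  classical
  obtain ⟨q⟩ := hr
  have : Nonempty (H.Path u v) := ⟨q.toPath⟩
  obtain ⟨p, hp⟩ := Finite.exists_min fun p : H.Path u v => wlen w (p : H.Walk u v)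
  refine ⟨p, le_antisymm (le_csInf ⟨_, q, rfl⟩ ?_) (Within.wdist_le hw ⟨p, le_rfl⟩)⟩
  rintro _ ⟨r, rfl⟩
  exact (hp r.toPath).trans (wlen_bypass_le hw r)

end Walks

section Connectivity

variable {V : Type}

lemma reachable_of_forall_adj {H H' : SimpleGraph V}
    (h : ∀ a b, H.Adj a b → H'.Reachable a b) {a b : V} (hab : H.Reachable a b) :
    H'.Reachable a b := by
  obtain ⟨p⟩ := hab
  induction p with
  | nil => rfl
  | cons hadj _ ih => exact (h _ _ hadj).trans ih

lemma connected_of_forall_adj {H H' : SimpleGraph V} (hH : H.Connected)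
    (h : ∀ a b, H.Adj a b → H'.Reachable a b) : H'.Connected := by
  have := hH.nonempty
  exact ⟨fun a b => reachable_of_forall_adj h (hH.preconnected a b)⟩

lemma fromEdgeSet_le {G : SimpleGraph V} {E : Set (Sym2 V)} (hE : E ⊆ G.edgeSet) :
    fromEdgeSet E ≤ G := by
  intro a b h
  exact hE ((fromEdgeSet_adj _).1 h).1

lemma edgeSet_fromEdgeSet_of_subset {G : SimpleGraph V} {E : Set (Sym2 V)}
    (hE : E ⊆ G.edgeSet) : (fromEdgeSet E).edgeSet = E := by
  rw [edgeSet_fromEdgeSet]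
  refine sdiff_eq_left.2 (Set.disjoint_left.2 fun e he hd => ?_)
  exact G.not_isDiag_of_mem_edgeSet (hE he) hd

lemma reachable_fromEdgeSet {E : Set (Sym2 V)} {a b : V} (h : s(a, b) ∈ E) :
    (fromEdgeSet E).Reachable a b := by
  by_cases hab : a = b
  · subst hab; rfl
  · exact Adj.reachable ((fromEdgeSet_adj _).2 ⟨h, hab⟩)

lemma sum_union_le_add [DecidableEq V] {w : V → ℝ} {A B : Finset V} (hw : ∀ e ∈ A ∪ B, 0 ≤ w e) :
    ∑ e ∈ A ∪ B, w e ≤ ∑ e ∈ A, w e + ∑ e ∈ B, w e := by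
  rw [← Finset.sum_union_inter]
  have : 0 ≤ ∑ e ∈ A ∩ B, w e := Finset.sum_nonneg fun e he =>
    hw e (Finset.mem_union_left _ (Finset.mem_inter.1 he).1)
  linarith

lemma sum_toFinset_le_sum_map [DecidableEq V] {w : V → ℝ} (l : List V) (hw : ∀ e ∈ l, 0 ≤ w e) :
    ∑ e ∈ l.toFinset, w e ≤ (l.map w).sum := by
  induction l with
  | nil => simp
  | cons a l ih =>
    have ih' := ih fun e he => hw e (List.mem_cons_of_mem _ he)
    rw [List.toFinset_cons, List.map_cons, List.sum_cons]
    by_cases ha : a ∈ l.toFinset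
    · rw [Finset.insert_eq_of_mem ha]
      have := hw a List.mem_cons_self
      linarith
    · rw [Finset.sum_insert ha]
      linarith

end Connectivity

section MinimumSpanning

variable {V : Type}

/-- A connected graph with positive weights has a spanning tree of minimum weight among all
connected spanning subgraphs; it is given by its set of edges. -/
lemma exists_minimum_spanning [Fintype V] {G : SimpleGraph V} {w : Sym2 V → ℝ} (hG : G.Connected)
    (hw : ∀ e ∈ G.edgeSet, 0 < w e) :
    ∃ B : Finset (Sym2 V), (B : Set (Sym2 V)) ⊆ G.edgeSet ∧
      (fromEdgeSet (B : Set (Sym2 V))).Connected ∧ B.card + 1 = Fintype.card V ∧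
      ∀ B' : Finset (Sym2 V), (B' : Set (Sym2 V)) ⊆ G.edgeSet →
        (fromEdgeSet (B' : Set (Sym2 V))).Connected → ∑ e ∈ B, w e ≤ ∑ e ∈ B', w e := by
  classical
  let S : Finset (Finset (Sym2 V)) := Finset.univ.filter fun B =>
    (B : Set (Sym2 V)) ⊆ G.edgeSet ∧ (fromEdgeSet (B : Set (Sym2 V))).Connected
  have hS : S.Nonempty := ⟨G.edgeFinset, by simp [S, hG]⟩
  obtain ⟨B, hB, hmin⟩ := S.exists_min_image (fun B => ∑ e ∈ B, w e) hS
  obtain ⟨hBG, hBc⟩ := (Finset.mem_filter.1 hB).2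
  refine ⟨B, hBG, hBc, ?_, fun B' h1 h2 => hmin B' (by simp [S, h1, h2])⟩
  obtain ⟨T, hTB, hT⟩ := hBc.exists_isTree_le
  have hsub : T.edgeFinset ⊆ B := by
    intro e he
    have := edgeSet_mono hTB (mem_edgeFinset.1 he)
    rw [edgeSet_fromEdgeSet_of_subset hBG] at this
    exact this
  have hTm := hmin T.edgeFinset (by
    simp only [S, Finset.mem_filter, Finset.mem_univ, true_and, coe_edgeFinset,
      fromEdgeSet_edgeSet]
    exact ⟨edgeSet_mono (hTB.trans (fromEdgeSet_le hBG)), hT.connected⟩)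
  have heq : T.edgeFinset = B := by
    by_contra hne
    obtain ⟨e, heB, heT⟩ := Finset.exists_of_ssubset (hsub.ssubset_of_ne hne)
    have := Finset.sum_lt_sum_of_subset hsub heB heT (hw e (hBG heB))
      (fun j hj _ => (hw j (hBG hj)).le)
    linarith
  rw [← heq]
  exact hT.card_edgeFinset

/-- The edges of `C` of weight at most `r`. -/
def threshold (C : SimpleGraph V) (q : Sym2 V → ℝ) (r : ℝ) : SimpleGraph V where
  Adj a b := C.Adj a b ∧ q s(a, b) ≤ r
  symm := ⟨fun a b h => ⟨h.1.symm, by rw [Sym2.eq_swap]; exact h.2⟩⟩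
  loopless := ⟨fun a h => C.loopless.irrefl a h.1⟩

lemma threshold_le (C : SimpleGraph V) (q : Sym2 V → ℝ) (r : ℝ) : threshold C q r ≤ C :=
  fun _ _ h => h.1

/-- A path with a heavy edge contains a heavy edge whose removal keeps the rest of the path. -/
lemma exists_heavy_edge {S : SimpleGraph V} {q : Sym2 V → ℝ} {r : ℝ} {x y : V} (p : S.Walk x y)
    (hp : p.IsPath) (h : ¬ (threshold S q r).Reachable x y) :
    ∃ a b, S.Adj a b ∧ r < q s(a, b) ∧ (S.deleteEdges {s(a, b)}).Reachable x a ∧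
      (S.deleteEdges {s(a, b)}).Reachable b y := by
  induction p with
  | nil => exact absurd (Reachable.refl _) h
  | @cons x x' y hadj p' ih =>
    obtain ⟨hp', hx⟩ := (Walk.cons_isPath_iff hadj p').1 hp
    by_cases hq : q s(x, x') ≤ r
    · have hr : (threshold S q r).Adj x x' := ⟨hadj, hq⟩
      obtain ⟨a, b, hab, hlt, h1, h2⟩ := ih hp' fun h' => h (hr.reachable.trans h')
      refine ⟨a, b, hab, hlt, Reachable.trans (Adj.reachable ?_) h1, h2⟩
      rw [deleteEdges_adj]
      refine ⟨hadj, fun he => ?_⟩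
      rw [Set.mem_singleton_iff] at he
      rw [he] at hq
      linarith
    · refine ⟨x, x', hadj, not_le.1 hq, Reachable.refl _, ⟨p'.toDeleteEdges _ fun e he h' => ?_⟩⟩
      rw [Set.mem_singleton_iff] at h'
      subst h'
      exact hx (p'.fst_mem_support_of_mem_edges he)

/-- Minimum spanning subgraphs are bottleneck-optimal. -/
lemma reachable_threshold_of_minimum {C : SimpleGraph V} {q : Sym2 V → ℝ}
    {B : Finset (Sym2 V)} (hB : (B : Set (Sym2 V)) ⊆ C.edgeSet)
    (hBc : (fromEdgeSet (B : Set (Sym2 V))).Connected)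
    (hmin : ∀ B' : Finset (Sym2 V), (B' : Set (Sym2 V)) ⊆ C.edgeSet →
        (fromEdgeSet (B' : Set (Sym2 V))).Connected → ∑ e ∈ B, q e ≤ ∑ e ∈ B', q e)
    (hq : ∀ e ∈ C.edgeSet, 0 ≤ q e)
    {r : ℝ} {x y : V} (h : (threshold C q r).Reachable x y) :
    (threshold (fromEdgeSet (B : Set (Sym2 V))) q r).Reachable x y := by
  classical
  refine reachable_of_forall_adj (fun x y hxy => ?_) h
  by_contra hne
  obtain ⟨p, hp⟩ := hBc.exists_isPath x y
  obtain ⟨a, b, hab, hlt, h1, h2⟩ := exists_heavy_edge p hp hne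
  have habB : s(a, b) ∈ B := ((fromEdgeSet_adj _).1 hab).1
  let B' := insert s(x, y) (B.erase s(a, b))
  have hle : (fromEdgeSet (B : Set (Sym2 V))).deleteEdges {s(a, b)} ≤
      fromEdgeSet (B' : Set (Sym2 V)) := by
    intro c d hcd
    rw [deleteEdges_adj, fromEdgeSet_adj, Set.mem_singleton_iff] at hcd
    rw [fromEdgeSet_adj]
    exact ⟨by simp [B', hcd.2, hcd.1.1], hcd.1.2⟩
  have hr : (fromEdgeSet (B' : Set (Sym2 V))).Reachable a b :=
    ((h1.mono hle).symm.trans (reachable_fromEdgeSet (by simp [B']))).trans (h2.mono hle).symm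
  have hc : (fromEdgeSet (B' : Set (Sym2 V))).Connected := by
    refine connected_of_forall_adj hBc fun c d hcd => ?_
    by_cases he : s(c, d) = s(a, b)
    · rcases Sym2.eq_iff.1 he with ⟨rfl, rfl⟩ | ⟨rfl, rfl⟩
      · exact hr
      · exact hr.symm
    · have h' := deleteEdges_adj.2 ⟨hcd, Set.mem_singleton_iff.not.2 he⟩
      exact h'.reachable.mono hle
  have hsub : (B' : Set (Sym2 V)) ⊆ C.edgeSet := by
    intro e he
    rcases Finset.mem_insert.1 he with rfl | he
    · exact hxy.1
    · exact hB (Finset.mem_of_mem_erase he)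
  have h3 := hmin B' hsub hc
  have h4 : ∑ e ∈ B', q e ≤ q s(x, y) + ∑ e ∈ B.erase s(a, b), q e := by
    have := sum_union_le_add (w := q) (A := {s(x, y)}) (B := B.erase s(a, b))
      (fun e he => hq e (hsub (by
        simpa [B', and_comm] using he)))
    simpa [B', ← Finset.insert_eq] using this
  have h5 := Finset.sum_erase_add B q habB
  have := hxy.2
  linarith

lemma reachable_or_of_insert {E : Set (Sym2 V)} {s t : V}
    (h : (fromEdgeSet (insert s(s, t) E)).Connected) (z : V) :
    (fromEdgeSet E).Reachable s z ∨ (fromEdgeSet E).Reachable t z := by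
  by_contra hz
  push Not at hz
  obtain ⟨p⟩ := h.preconnected s z
  obtain ⟨d, -, h1, h2⟩ := p.exists_boundary_dart
    {z | (fromEdgeSet E).Reachable s z ∨ (fromEdgeSet E).Reachable t z}
    (Or.inl (Reachable.refl _)) (by simpa using hz)
  obtain ⟨⟨a, b⟩, hab⟩ := d
  rw [fromEdgeSet_adj] at hab
  simp only [Set.mem_ofPred_eq, not_or] at h1 h2
  rcases hab.1 with he | he
  · rcases Sym2.eq_iff.1 he with ⟨rfl, rfl⟩ | ⟨rfl, rfl⟩
    · exact h2.2 (Reachable.refl _)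
    · exact h2.1 (Reachable.refl _)
  · have := reachable_fromEdgeSet he
    rcases h1 with h1 | h1
    · exact h2.1 (h1.trans this)
    · exact h2.2 (h1.trans this)

/-- The edges of a connected graph whose ends are joined by light walks in `C` can be exchanged for
edges of `C`. -/
lemma exists_exchange {C : SimpleGraph V} {q r : Sym2 V → ℝ} (hr : ∀ e, 0 ≤ r e)
    (hq : ∀ e ∈ C.edgeSet, 0 ≤ q e)
    (E : Finset (Sym2 V)) (hE : ∀ s t, (threshold C q (r s(s, t))).Reachable s t)
    (B : Finset (Sym2 V)) (hB : (B : Set (Sym2 V)) ⊆ C.edgeSet)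
    (hc : (fromEdgeSet (E ∪ B : Set (Sym2 V))).Connected) :
    ∃ B' : Finset (Sym2 V), (B' : Set (Sym2 V)) ⊆ C.edgeSet ∧
      (fromEdgeSet (B' : Set (Sym2 V))).Connected ∧
      ∑ e ∈ B', q e ≤ ∑ e ∈ E, r e + ∑ e ∈ B, q e := by
  classical
  induction E using Finset.induction_on generalizing B with
  | empty => exact ⟨B, hB, by simpa using hc, by simp⟩
  | insert e E he ih =>
    induction e using Sym2.ind with | _ s t
    rw [Finset.sum_insert he]
    rw [Finset.coe_insert, Set.insert_union] at hc
    by_cases hst : (fromEdgeSet (E ∪ B : Set (Sym2 V))).Reachable s t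
    · obtain ⟨B', h1, h2, h3⟩ := ih B hB (connected_of_forall_adj hc fun a b hab => by
        rw [fromEdgeSet_adj] at hab
        rcases hab.1 with h | h
        · rcases Sym2.eq_iff.1 h with ⟨rfl, rfl⟩ | ⟨rfl, rfl⟩
          · exact hst
          · exact hst.symm
        · exact reachable_fromEdgeSet h)
      exact ⟨B', h1, h2, by linarith [hr s(s, t)]⟩
    · obtain ⟨p⟩ := hE s t
      obtain ⟨⟨⟨x, y⟩, hxy⟩, -, hx, hy⟩ := p.exists_boundary_dart
        {z | (fromEdgeSet (E ∪ B : Set (Sym2 V))).Reachable s z} (Reachable.refl _) hst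
      simp only [Set.mem_ofPred_eq] at hx hy
      have hty := (reachable_or_of_insert hc y).resolve_left hy
      have hle : fromEdgeSet (E ∪ B : Set (Sym2 V)) ≤
          fromEdgeSet (E ∪ (insert s(x, y) B : Finset (Sym2 V)) : Set (Sym2 V)) := by
        apply fromEdgeSet_mono
        rw [Finset.coe_insert]
        exact Set.union_subset_union_right _ (Set.subset_insert _ _)
      have hst' := ((hx.mono hle).trans (reachable_fromEdgeSet (by simp))).trans
        (hty.mono hle).symm
      have hB' : ((insert s(x, y) B : Finset (Sym2 V)) : Set (Sym2 V)) ⊆ C.edgeSet := by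
        rw [Finset.coe_insert]
        exact Set.insert_subset hxy.1 hB
      obtain ⟨B', h1, h2, h3⟩ := ih (insert s(x, y) B) hB'
        (connected_of_forall_adj hc fun a b hab => by
          rw [fromEdgeSet_adj] at hab
          rcases hab.1 with h | h
          · rcases Sym2.eq_iff.1 h with ⟨rfl, rfl⟩ | ⟨rfl, rfl⟩
            · exact hst'
            · exact hst'.symm
          · exact (reachable_fromEdgeSet h).mono hle)
      refine ⟨B', h1, h2, ?_⟩
      have h4 : ∑ e ∈ insert s(x, y) B, q e ≤ q s(x, y) + ∑ e ∈ B, q e := by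
        have := sum_union_le_add (w := q) (A := {s(x, y)}) (B := B)
          (fun e he => hq e (hB' (by simpa using he)))
        simpa [← Finset.insert_eq] using this
      have := hxy.2
      linarith

end MinimumSpanning

section Tours

variable {V : Type} {G : SimpleGraph V} {w : Sym2 V → ℝ}

/-- A connected spanning subgraph can be traversed by a closed walk using every edge at most
twice. -/
lemma exists_tour [Fintype V] {E : Finset (Sym2 V)}
    (hE : (E : Set (Sym2 V)) ⊆ G.edgeSet) (hw : ∀ e ∈ G.edgeSet, 0 ≤ w e)
    (hc : (fromEdgeSet (E : Set (Sym2 V))).Connected) (r : V) :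
    ∃ p : G.Walk r r, (∀ x, x ∈ p.support) ∧ (∀ e ∈ p.edges, e ∈ E) ∧
      wlen w p ≤ 2 * ∑ e ∈ E, w e := by
  classical
  have key : ∀ n : ℕ, n + 1 ≤ Fintype.card V → ∃ p : G.Walk r r, n + 1 ≤ p.support.toFinset.card ∧
      (∀ e ∈ p.edges, e ∈ E) ∧ wlen w p ≤ 2 * ∑ e ∈ p.edges.toFinset, w e := by
    intro n
    induction n with
    | zero => exact fun _ => ⟨.nil, by simp, by simp, by simp⟩
    | succ n ih =>
      intro hn
      obtain ⟨p, h1, h2, h3⟩ := ih (by omega)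
      by_cases hall : ∀ x, x ∈ p.support
      · refine ⟨p, ?_, h2, h3⟩
        have : p.support.toFinset = Finset.univ := by ext; simp [hall]
        rw [this, Finset.card_univ]
        exact hn
      · push Not at hall
        obtain ⟨y, hy⟩ := hall
        obtain ⟨g⟩ := hc.preconnected r y
        obtain ⟨⟨⟨a, b⟩, hab⟩, -, ha, hb⟩ := g.exists_boundary_dart {z | z ∈ p.support}
          p.start_mem_support hy
        simp only [Set.mem_ofPred_eq] at ha hb
        have habE : s(a, b) ∈ E := ((fromEdgeSet_adj _).1 hab).1
        have habG : G.Adj a b := hE habE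
        let p' := (p.takeUntil a ha).append (.cons habG (.cons habG.symm (p.dropUntil a ha)))
        have hedges : ∀ e, e ∈ p'.edges ↔ e = s(a, b) ∨ e ∈ p.edges := by
          intro e
          conv_rhs => rw [← p.take_spec ha]
          simp only [p', Walk.edges_append, Walk.edges_cons, List.mem_append, List.mem_cons,
            Sym2.eq_swap (a := b) (b := a)]
          tauto
        have hlen : wlen w p' = 2 * w s(a, b) + wlen w p := by
          conv_rhs => rw [← p.take_spec ha]
          simp only [p', wlen_append, wlen_cons, Sym2.eq_swap (a := b) (b := a)]
          ring
        have hsupp : insert b p.support.toFinset ⊆ p'.support.toFinset := by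
          intro z hz
          have hz' : z = b ∨ z ∈ p.support := by simpa using hz
          conv at hz' => rw [← p.take_spec ha]
          simp only [p', Walk.mem_support_append_iff, List.mem_toFinset, Walk.support_cons,
            List.mem_cons] at hz' ⊢
          tauto
        have hnew : s(a, b) ∉ p.edges.toFinset := fun h =>
          hb (p.snd_mem_support_of_mem_edges (List.mem_toFinset.1 h))
        refine ⟨p', ?_, fun e he => ?_, ?_⟩
        · refine le_trans ?_ (Finset.card_le_card hsupp)
          rw [Finset.card_insert_of_notMem (by simpa using hb)]
          omega
        · rcases (hedges e).1 he with rfl | he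
          · exact habE
          · exact h2 e he
        · have : p'.edges.toFinset = insert s(a, b) p.edges.toFinset := by
            ext e
            simp only [List.mem_toFinset, Finset.mem_insert, hedges]
          rw [this, Finset.sum_insert hnew, hlen]
          linarith
  have hpos : 0 < Fintype.card V := Fintype.card_pos_iff.2 ⟨r⟩
  obtain ⟨p, h1, h2, h3⟩ := key (Fintype.card V - 1) (by omega)
  have huniv : p.support.toFinset = Finset.univ :=
    Finset.eq_univ_of_card _ (le_antisymm (Finset.card_le_univ _) (by omega))
  refine ⟨p, fun x => ?_, h2, h3.trans ?_⟩
  · rw [← List.mem_toFinset, huniv]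
    exact Finset.mem_univ x
  · have := Finset.sum_le_sum_of_subset_of_nonneg (f := w) (s := p.edges.toFinset) (t := E)
      (fun e he => h2 e (List.mem_toFinset.1 he)) (fun e he _ => hw e (hE he))
    linarith

/-- The distance as a function on unordered pairs. -/
noncomputable def sdist (G : SimpleGraph V) (w : Sym2 V → ℝ) : Sym2 V → ℝ :=
  Sym2.lift ⟨wdist G w, fun _ _ => wdist_comm⟩

@[simp] lemma sdist_mk (a b : V) : sdist G w s(a, b) = wdist G w a b := rfl

lemma sdist_nonneg (hw : ∀ e ∈ G.edgeSet, 0 ≤ w e) (e : Sym2 V) : 0 ≤ sdist G w e := by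
  induction e using Sym2.ind with | _ a b
  exact wdist_nonneg hw

/-- The terminals met by a walk can be connected at the cost of the length of the walk. -/
lemma exists_terminal_edges (hw : ∀ e ∈ G.edgeSet, 0 ≤ w e) {K : Finset V} {a b : V}
    (p : G.Walk a b) (s : K) {L : ℝ} (hL : Within G w s a L) :
    ∃ E : Finset (Sym2 K),
      (∀ t : K, (t : V) ∈ p.support → (fromEdgeSet (E : Set (Sym2 K))).Reachable s t) ∧
      ∑ e ∈ E, sdist G w (e.map (↑)) ≤ L + wlen w p := by
  classical
  induction p generalizing s L with
  | @nil a =>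
    by_cases ha : a ∈ K
    · refine ⟨{s(s, ⟨a, ha⟩)}, fun t ht => ?_, ?_⟩
      · have : t = ⟨a, ha⟩ := Subtype.ext (by simpa using ht)
        subst this
        exact reachable_fromEdgeSet (by simp)
      · simpa using hL.wdist_le hw
    · refine ⟨∅, fun t ht => absurd t.2 ?_, ?_⟩
      · have : (t : V) = a := by simpa using ht
        rwa [this]
      · simpa using (wdist_nonneg hw).trans (hL.wdist_le hw)
  | @cons a a' b hadj p ih =>
    by_cases ha : a ∈ K
    · obtain ⟨E, h1, h2⟩ := ih ⟨a, ha⟩ (Within.of_adj hadj)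
      have hle : fromEdgeSet (E : Set (Sym2 K)) ≤
          fromEdgeSet ((insert s(s, ⟨a, ha⟩) E : Finset (Sym2 K)) : Set (Sym2 K)) :=
        fromEdgeSet_mono (by simp)
      have hsa := reachable_fromEdgeSet
        (E := ((insert s(s, ⟨a, ha⟩) E : Finset (Sym2 K)) : Set (Sym2 K)))
        (a := s) (b := ⟨a, ha⟩) (by simp)
      refine ⟨insert s(s, ⟨a, ha⟩) E, fun t ht => ?_, ?_⟩
      · rcases List.mem_cons.1 (by simpa using ht : (t : V) ∈ a :: p.support) with h | h
        · have : t = ⟨a, ha⟩ := Subtype.ext h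
          rwa [this]
        · exact hsa.trans ((h1 t h).mono hle)
      · have h3 := sum_union_le_add (w := fun e => sdist G w (e.map (↑)))
          (A := {s(s, ⟨a, ha⟩)}) (B := E) (fun e _ => sdist_nonneg hw _)
        rw [← Finset.insert_eq, Finset.sum_singleton] at h3
        have h4 := hL.wdist_le hw
        simp only [Sym2.map_mk, sdist_mk] at h3
        rw [wlen_cons]
        linarith
    · obtain ⟨E, h1, h2⟩ := ih s (hL.trans (Within.of_adj hadj))
      refine ⟨E, fun t ht => h1 t ?_, by rw [wlen_cons]; linarith⟩
      rcases List.mem_cons.1 (by simpa using ht : (t : V) ∈ a :: p.support) with h | h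
      · exact absurd (h ▸ t.2) ha
      · exact h

end Tours

section ShallowLight

variable {V : Type} {G : SimpleGraph V} {w : Sym2 V → ℝ} {K : Finset V} {δ : V → ℝ}

/-- Following a walk, shortest paths to the terminals are added whenever the current connection
is too long. -/
lemma exists_shortcuts {α : ℝ} (hα : 1 < α) (hw : ∀ e ∈ G.edgeSet, 0 ≤ w e)
    (hδ : ∀ u, ∃ t ∈ K, ∃ p : G.Walk u t, wlen w p = δ u)
    {a b : V} (p : G.Walk a b) (E₀ : Finset (Sym2 V)) (hE₀ : (E₀ : Set (Sym2 V)) ⊆ G.edgeSet)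
    (hp : ∀ e ∈ p.edges, e ∈ E₀) {c : ℝ} (hc : c ≤ α * δ a)
    (ha : ∃ t ∈ K, Within (fromEdgeSet (E₀ : Set (Sym2 V))) w a t c) :
    ∃ E : Finset (Sym2 V), E₀ ⊆ E ∧ (E : Set (Sym2 V)) ⊆ G.edgeSet ∧
      (∀ x ∈ p.support, ∃ t ∈ K, Within (fromEdgeSet (E : Set (Sym2 V))) w x t (α * δ x)) ∧
      (α - 1) * (∑ e ∈ E, w e - ∑ e ∈ E₀, w e) ≤ c + wlen w p := by
  classical
  induction p generalizing E₀ c with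
  | @nil a =>
    obtain ⟨t, htK, ht⟩ := ha
    refine ⟨E₀, subset_rfl, hE₀, fun x hx => ?_, ?_⟩
    · have : x = a := by simpa using hx
      subst this
      exact ⟨t, htK, ht.mono le_rfl hc⟩
    · have := (wdist_nonneg hw).trans ((ht.mono (fromEdgeSet_le hE₀) le_rfl).wdist_le hw)
      simpa using this
  | @cons a a' b hadj p ih =>
    obtain ⟨t, htK, ht⟩ := ha
    have haE : s(a, a') ∈ E₀ := hp _ (by simp)
    have hpE : ∀ e ∈ p.edges, e ∈ E₀ := fun e he => hp e (by simp [he])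
    have hadj₀ : (fromEdgeSet (E₀ : Set (Sym2 V))).Adj a a' :=
      (fromEdgeSet_adj _).2 ⟨haE, hadj.ne⟩
    have hsupp : ∀ E : Finset (Sym2 V), E₀ ⊆ E →
        (∀ x ∈ p.support, ∃ t ∈ K, Within (fromEdgeSet (E : Set (Sym2 V))) w x t (α * δ x)) →
        ∀ x ∈ (Walk.cons hadj p).support,
          ∃ t ∈ K, Within (fromEdgeSet (E : Set (Sym2 V))) w x t (α * δ x) := by
      intro E hE h x hx
      rcases List.mem_cons.1 (by simpa using hx : x ∈ a :: p.support) with rfl | h'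
      · exact ⟨t, htK, ht.mono (fromEdgeSet_mono (Finset.coe_subset.2 hE)) hc⟩
      · exact h x h'
    by_cases hc' : w s(a, a') + c ≤ α * δ a'
    · obtain ⟨E, h1, h2, h3, h4⟩ := ih E₀ hE₀ hpE hc'
        ⟨t, htK, by
          have := (Within.of_adj (w := w) hadj₀).symm.trans ht
          exact this⟩
      exact ⟨E, h1, h2, hsupp E h1 h3, by rw [wlen_cons]; linarith⟩
    · obtain ⟨t', ht'K, g, hg⟩ := hδ a'
      have hE₁ : ((E₀ ∪ g.edges.toFinset : Finset (Sym2 V)) : Set (Sym2 V)) ⊆ G.edgeSet := by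
        intro e he
        rcases Finset.mem_union.1 he with he | he
        · exact hE₀ he
        · exact g.edges_subset_edgeSet (List.mem_toFinset.1 he)
      have hδ0 : 0 ≤ δ a' := hg ▸ wlen_nonneg hw g
      have hg' : Within (fromEdgeSet ((E₀ ∪ g.edges.toFinset : Finset (Sym2 V)) : Set (Sym2 V)))
          w a' t' (δ a') := by
        refine ⟨g.transfer _ fun e he => ?_, ?_⟩
        · rw [edgeSet_fromEdgeSet_of_subset hE₁]
          simp [he]
        · rw [← hg, wlen, wlen, Walk.edges_transfer]
      obtain ⟨E, h1, h2, h3, h4⟩ := ih (E₀ ∪ g.edges.toFinset) hE₁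
        (fun e he => Finset.mem_union_left _ (hpE e he)) (c := δ a') (by nlinarith) ⟨t', ht'K, hg'⟩
      have h5 : E₀ ⊆ E := Finset.subset_union_left.trans h1
      refine ⟨E, h5, h2, hsupp E h5 h3, ?_⟩
      have h6 := sum_union_le_add (w := w) (A := E₀) (B := g.edges.toFinset)
        (fun e he => hw e (hE₁ he))
      have h7 := sum_toFinset_le_sum_map (w := w) g.edges
        (fun e he => hw e (g.edges_subset_edgeSet he))
      have h8 : (g.edges.map w).sum = δ a' := hg
      rw [wlen_cons]
      nlinarith

/-- A shallow-light subgraph with respect to the distance to the terminals. -/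
lemma exists_shallow_light [Fintype V] {α : ℝ} (hα : 1 < α) (hw : ∀ e ∈ G.edgeSet, 0 ≤ w e)
    (hK : K.Nonempty) (hδ : ∀ u, ∃ t ∈ K, ∃ p : G.Walk u t, wlen w p = δ u)
    {M : Finset (Sym2 V)} (hM : (M : Set (Sym2 V)) ⊆ G.edgeSet)
    (hMc : (fromEdgeSet (M : Set (Sym2 V))).Connected) :
    ∃ E : Finset (Sym2 V), (E : Set (Sym2 V)) ⊆ G.edgeSet ∧
      (∀ x, ∃ t ∈ K, Within (fromEdgeSet (E : Set (Sym2 V))) w x t (α * δ x)) ∧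
      ∑ e ∈ E, w e ≤ (1 + 2 / (α - 1)) * ∑ e ∈ M, w e := by
  obtain ⟨r, hr⟩ := hK
  obtain ⟨p, h1, h2, h3⟩ := exists_tour hM hw hMc r
  obtain ⟨_, _, g, hg⟩ := hδ r
  have hδ0 : 0 ≤ δ r := hg ▸ wlen_nonneg hw g
  obtain ⟨E, -, h4, h5, h6⟩ := exists_shortcuts hα hw hδ p M hM h2 (c := 0) (by nlinarith)
    ⟨r, hr, Within.refl le_rfl⟩
  refine ⟨E, h4, fun x => h5 x (h1 x), ?_⟩
  have hα' : 0 < α - 1 := by linarith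
  have h7 : ∑ e ∈ E, w e - ∑ e ∈ M, w e ≤ (2 * ∑ e ∈ M, w e) / (α - 1) := by
    rw [le_div_iff₀ hα']
    linarith
  have h8 : (2 * ∑ e ∈ M, w e) / (α - 1) = 2 / (α - 1) * ∑ e ∈ M, w e := by ring
  linarith

/-- A subgraph contains a forest with one tree per terminal that preserves bounds on the distances
to the nearest terminals. -/
lemma exists_forest [Fintype V] (hw : ∀ e ∈ G.edgeSet, 0 < w e)
    {ρ : V → ℝ} (E : Finset (Sym2 V)) (hE : (E : Set (Sym2 V)) ⊆ G.edgeSet)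
    (h : ∀ x, ∃ t ∈ K, Within (fromEdgeSet (E : Set (Sym2 V))) w x t (ρ x)) :
    ∃ F ⊆ E, F.card + K.card ≤ Fintype.card V ∧
      ∀ x, ∃ t ∈ K, Within (fromEdgeSet (F : Set (Sym2 V))) w x t (ρ x) := by
  classical
  have hwE : ∀ e ∈ (fromEdgeSet (E : Set (Sym2 V))).edgeSet, 0 ≤ w e := fun e he =>
    (hw e (edgeSet_mono (fromEdgeSet_le hE) he)).le
  have hmin : ∀ x, ∃ t ∈ K, (fromEdgeSet (E : Set (Sym2 V))).Reachable x t ∧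
      ∀ t' ∈ K, (fromEdgeSet (E : Set (Sym2 V))).Reachable x t' →
        wdist (fromEdgeSet (E : Set (Sym2 V))) w x t ≤
          wdist (fromEdgeSet (E : Set (Sym2 V))) w x t' := by
    intro x
    obtain ⟨t, htK, ht⟩ := h x
    obtain ⟨t', ht', hle⟩ := (K.filter fun t =>
      (fromEdgeSet (E : Set (Sym2 V))).Reachable x t).exists_min_image
      (fun t => wdist (fromEdgeSet (E : Set (Sym2 V))) w x t) ⟨t, by simp [htK, ht.reachable]⟩
    obtain ⟨h1, h2⟩ := Finset.mem_filter.1 ht'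
    exact ⟨t', h1, h2, fun t'' h3 h4 => hle t'' (by simp [h3, h4])⟩
  choose n hnK hnr hn using hmin
  let d : V → ℝ := fun x => wdist (fromEdgeSet (E : Set (Sym2 V))) w x (n x)
  have hd : ∀ x, ∀ t ∈ K, ∀ L, Within (fromEdgeSet (E : Set (Sym2 V))) w x t L → d x ≤ L :=
    fun x t ht L hL => (hn x t ht hL.reachable).trans (hL.wdist_le hwE)
  have hpar : ∀ x, ∃ y, x ∉ K → s(x, y) ∈ E ∧ x ≠ y ∧ w s(x, y) + d y ≤ d x := by
    intro x
    by_cases hx : x ∈ K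
    · exact ⟨x, fun h => absurd hx h⟩
    · obtain ⟨p, hp⟩ := exists_wlen_eq_wdist hwE (hnr x)
      have hK := hnK x
      change wlen w p = d x at hp
      generalize n x = t at p hK
      cases p with
      | nil => exact absurd hK hx
      | @cons _ y _ hadj p =>
        refine ⟨y, fun _ => ⟨((fromEdgeSet_adj _).1 hadj).1, hadj.ne, ?_⟩⟩
        rw [← hp, wlen_cons]
        have := hd y t hK _ ⟨p, le_rfl⟩
        linarith
  choose par hpar using hpar
  let F : Finset (Sym2 V) := Kᶜ.image fun x => s(x, par x)
  refine ⟨F, fun e he => ?_, ?_, fun x => ?_⟩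
  · obtain ⟨x, hx, rfl⟩ := Finset.mem_image.1 he
    exact (hpar x (Finset.mem_compl.1 hx)).1
  · have h1 : F.card ≤ Kᶜ.card := Finset.card_image_le
    have h2 := Finset.card_compl_add_card K
    omega
  · suffices ∃ t ∈ K, Within (fromEdgeSet (F : Set (Sym2 V))) w x t (d x) by
      obtain ⟨t, ht, h1⟩ := this
      obtain ⟨t', ht', h2⟩ := h x
      exact ⟨t, ht, h1.mono le_rfl (hd x t' ht' _ h2)⟩
    have hwf : WellFounded fun a b : V => d a < d b := by
      have : IsTrans V fun a b : V => d a < d b := ⟨fun _ _ _ => lt_trans⟩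
      have : Std.Irrefl fun a b : V => d a < d b := ⟨fun _ => lt_irrefl _⟩
      exact Finite.wellFounded_of_trans_of_irrefl _
    induction x using hwf.induction with
    | _ x ih =>
      by_cases hx : x ∈ K
      · exact ⟨x, hx, Within.refl (wdist_nonneg hwE)⟩
      · obtain ⟨h1, h2, h3⟩ := hpar x hx
        obtain ⟨t, htK, ht⟩ := ih (par x) (by linarith [hw _ (hE h1)])
        have hadj : (fromEdgeSet (F : Set (Sym2 V))).Adj x (par x) :=
          (fromEdgeSet_adj _).2 ⟨Finset.mem_image.2 ⟨x, by simpa using hx, rfl⟩, h2⟩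
        exact ⟨t, htK, ((Within.of_adj hadj).trans ht).mono le_rfl h3⟩

end ShallowLight

section Contraction

variable {V W : Type}

/-- The graph of parts of the partition of the vertices given by `c`. -/
def contraction (G : SimpleGraph V) (c : V → W) : SimpleGraph W where
  Adj s t := s ≠ t ∧ ∃ x y, G.Adj x y ∧ c x = s ∧ c y = t
  symm := ⟨fun _ _ ⟨h, x, y, hxy, hx, hy⟩ => ⟨h.symm, y, x, hxy.symm, hy, hx⟩⟩
  loopless := ⟨fun _ h => h.1 rfl⟩

lemma exists_cheapest_crossing [Finite V] [Nonempty V] (G : SimpleGraph V) (c : V → W)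
    (f : V × V → ℝ) :
    ∃ φ : Sym2 W → V × V, ∀ e ∈ (contraction G c).edgeSet,
      G.Adj (φ e).1 (φ e).2 ∧ s(c (φ e).1, c (φ e).2) = e ∧
      ∀ x y, G.Adj x y → s(c x, c y) = e → f (φ e) ≤ f (x, y) := by
  have key : ∀ e : Sym2 W, ∃ z : V × V, e ∈ (contraction G c).edgeSet →
      G.Adj z.1 z.2 ∧ s(c z.1, c z.2) = e ∧
      ∀ x y, G.Adj x y → s(c x, c y) = e → f z ≤ f (x, y) := by
    intro e
    by_cases he : e ∈ (contraction G c).edgeSet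
    · induction e using Sym2.ind with | _ s t
      obtain ⟨-, x, y, hxy, hx, hy⟩ := (mem_edgeSet _).1 he
      obtain ⟨z, hz, hmin⟩ := Set.exists_min_image
        {z : V × V | G.Adj z.1 z.2 ∧ s(c z.1, c z.2) = s(s, t)} f (Set.toFinite _)
        ⟨(x, y), hxy, by simp [hx, hy]⟩
      exact ⟨z, fun _ => ⟨hz.1, hz.2, fun x y h1 h2 => hmin (x, y) ⟨h1, h2⟩⟩⟩
    · exact ⟨Classical.arbitrary _, fun h => absurd h he⟩
  choose φ hφ using key
  exact ⟨φ, hφ⟩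

/-- A walk whose edges have contractions of weight at most `r` contracts to a walk of such edges. -/
lemma reachable_contraction {G : SimpleGraph V} {w : Sym2 V → ℝ} {c : V → W} {q : Sym2 W → ℝ}
    {r ℓ : ℝ} {v a u : V} (g : G.Walk v a) (p : G.Walk a u) (hℓ : wlen w g + wlen w p = ℓ)
    (h : ∀ x y (g : G.Walk v x) (g' : G.Walk y u), G.Adj x y → c x ≠ c y →
      wlen w g + w s(x, y) + wlen w g' = ℓ → q s(c x, c y) ≤ r) :
    (threshold (contraction G c) q r).Reachable (c a) (c u) := by
  induction p with
  | nil => rfl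
  | @cons a a' u hadj p ih =>
    rw [wlen_cons] at hℓ
    refine Reachable.trans ?_ (ih (g.append (.cons hadj .nil))
      (by rw [wlen_append, wlen_cons, wlen_nil]; linarith) h)
    by_cases hc : c a = c a'
    · rw [hc]
    · exact Adj.reachable ⟨⟨hc, a, a', hadj, rfl, rfl⟩, h a a' g p hadj hc (by linarith)⟩

end Contraction

lemma Within.of_threshold_walk {V W : Type} {T : SimpleGraph V} {w : Sym2 V → ℝ}
    {S : SimpleGraph W} {q : Sym2 W → ℝ} {r : ℝ} {ι : W → V}
    (h : ∀ s t, S.Adj s t → Within T w (ι s) (ι t) (q s(s, t))) {s t : W}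
    (p : (threshold S q r).Walk s t) : Within T w (ι s) (ι t) (p.length * r) := by
  induction p with
  | nil => exact Within.refl (by simp)
  | cons hadj p ih =>
    refine ((h _ _ hadj.1).trans ih).mono le_rfl ?_
    rw [Walk.length_cons]
    push_cast
    linarith [hadj.2]

lemma exists_distance_to_terminals {V : Type} [Fintype V] {G : SimpleGraph V} {w : Sym2 V → ℝ}
    {K : Finset V} (hG : G.Connected) (hw : ∀ e ∈ G.edgeSet, 0 ≤ w e) (hK : K.Nonempty) :
    ∃ δ : V → ℝ, (∀ u, ∃ t ∈ K, ∃ p : G.Walk u t, wlen w p = δ u) ∧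
      ∀ u, ∀ t ∈ K, ∀ p : G.Walk u t, δ u ≤ wlen w p := by
  choose n hnK hn using fun u => K.exists_min_image (fun t => wdist G w u t) hK
  refine ⟨fun u => wdist G w u (n u), fun u => ⟨n u, hnK u,
    exists_wlen_eq_wdist hw (hG.preconnected _ _)⟩, fun u t ht p => ?_⟩
  exact (hn u t ht).trans (Within.wdist_le hw ⟨p, le_rfl⟩)

/-- Every connected weighted graph has a spanning tree, given by its set of edges, with small
terminal distortion and small weight compared to a given spanning connected subgraph. -/
lemma exists_light_terminal_tree {V : Type} [Fintype V] {G : SimpleGraph V} {w : Sym2 V → ℝ}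
    {K : Finset V} {α : ℝ} (hG : G.Connected) (hw : ∀ e ∈ G.edgeSet, 0 < w e)
    (hK : K.Nonempty) (hα : 1 < α) {M : Finset (Sym2 V)} (hM : (M : Set (Sym2 V)) ⊆ G.edgeSet)
    (hMc : (fromEdgeSet (M : Set (Sym2 V))).Connected) :
    ∃ D : Finset (Sym2 V), (D : Set (Sym2 V)) ⊆ G.edgeSet ∧
      (fromEdgeSet (D : Set (Sym2 V))).IsTree ∧
      (∀ v ∈ K, ∀ u (p : G.Walk v u), Within (fromEdgeSet (D : Set (Sym2 V))) w v u
        ((2 * K.card - 1) * α * wlen w p)) ∧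
      ∑ e ∈ D, w e ≤ (2 * α + 1 + 2 / (α - 1)) * ∑ e ∈ M, w e := by
  classical
  have hw0 : ∀ e ∈ G.edgeSet, 0 ≤ w e := fun e he => (hw e he).le
  have hα0 : 0 < α := by linarith
  obtain ⟨δ, hδ, hδmin⟩ := exists_distance_to_terminals hG hw0 hK
  have hδ0 : ∀ u, 0 ≤ δ u := fun u => by
    obtain ⟨_, _, p, hp⟩ := hδ u
    exact hp ▸ wlen_nonneg hw0 p
  obtain ⟨E, hE, hEρ, hEw⟩ := exists_shallow_light hα hw0 hK hδ hM hMc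
  obtain ⟨F, hFE, hFcard, hFρ⟩ := exists_forest hw E hE hEρ
  have hF : (F : Set (Sym2 V)) ⊆ G.edgeSet := fun e he => hE (hFE he)
  obtain ⟨c, hcK, hc⟩ : ∃ c : V → K, (∀ t : K, c t = t) ∧
      ∀ x, Within (fromEdgeSet (F : Set (Sym2 V))) w x (c x) (α * δ x) := by
    have : ∀ x, ∃ t : K, ((h : x ∈ K) → t = ⟨x, h⟩) ∧
        Within (fromEdgeSet (F : Set (Sym2 V))) w x t (α * δ x) := by
      intro x
      by_cases hx : x ∈ K
      · exact ⟨⟨x, hx⟩, fun _ => rfl, Within.refl (mul_nonneg hα0.le (hδ0 x))⟩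
      · obtain ⟨t, ht, h⟩ := hFρ x
        exact ⟨⟨t, ht⟩, fun h => absurd h hx, h⟩
    choose c hc1 hc2 using this
    exact ⟨c, fun t => hc1 t t.2, hc2⟩
  obtain ⟨r₀, hr₀⟩ := hK
  have : Nonempty V := ⟨r₀⟩
  let C := contraction G c
  obtain ⟨φ, hφ⟩ := exists_cheapest_crossing G c
    fun z => α * δ z.1 + w s(z.1, z.2) + α * δ z.2
  let q : Sym2 K → ℝ := fun e =>
    α * δ (φ e).1 + w s((φ e).1, (φ e).2) + α * δ (φ e).2
  have hwq : ∀ e ∈ C.edgeSet, w s((φ e).1, (φ e).2) ≤ q e := fun e _ => by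
    have h1 := mul_nonneg hα0.le (hδ0 (φ e).1)
    have h2 := mul_nonneg hα0.le (hδ0 (φ e).2)
    simp only [q]
    linarith
  have hqpos : ∀ e ∈ C.edgeSet, 0 < q e := fun e he => (hw _ (hφ e he).1).trans_le (hwq e he)
  have hqmin : ∀ x y, G.Adj x y → c x ≠ c y → q s(c x, c y) ≤ α * δ x + w s(x, y) + α * δ y :=
    fun x y hxy hne =>
      (hφ s(c x, c y) ((mem_edgeSet _).2 ⟨hne, x, y, hxy, rfl, rfl⟩)).2.2 x y hxy rfl
  -- the terminals are connected along a tour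
  obtain ⟨p, hp, -, hpw⟩ := exists_tour hM hw0 hMc r₀
  obtain ⟨R, hR, hRw⟩ := exists_terminal_edges hw0 p ⟨r₀, hr₀⟩ (Within.refl le_rfl)
  have hRc : (fromEdgeSet (R ∪ (∅ : Finset (Sym2 K)) : Set (Sym2 K))).Connected := by
    rw [Finset.coe_empty, Set.union_empty]
    have : Nonempty K := ⟨⟨r₀, hr₀⟩⟩
    exact ⟨fun s t => (hR s (hp s)).symm.trans (hR t (hp t))⟩
  obtain ⟨B, hBC, hBc, hBw⟩ := exists_exchange (C := C) (q := q)
    (r := fun e => α * sdist G w (e.map (↑))) (fun e => mul_nonneg hα0.le (sdist_nonneg hw0 _))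
    (fun e he => (hqpos e he).le) R (fun s t => by
      obtain ⟨g, hg⟩ := exists_wlen_eq_wdist hw0 (hG.preconnected (s : V) t)
      have := reachable_contraction (c := c) (q := q)
        (r := α * sdist G w (Sym2.map (↑) s(s, t))) Walk.nil g
        (ℓ := wdist G w s t) (by rw [wlen_nil, zero_add, hg]) (fun x y g g' hxy hne hl => by
          refine (hqmin x y hxy hne).trans ?_
          have h1 := hδmin x s s.2 g.reverse
          have h2 := hδmin y t t.2 g'
          have h3 := hw s(x, y) hxy
          rw [wlen_reverse] at h1
          rw [Sym2.map_mk, sdist_mk, ← hl]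
          nlinarith)
      rwa [hcK, hcK] at this) ∅ (by simp) hRc
  have hCc : C.Connected := hBc.mono (fromEdgeSet_le hBC)
  obtain ⟨S, hSC, hSc, hScard, hSmin⟩ := exists_minimum_spanning hCc hqpos
  have hSw : ∑ e ∈ S, q e ≤ 2 * α * ∑ e ∈ M, w e := by
    have h1 := hSmin B hBC hBc
    rw [Finset.sum_empty, add_zero, ← Finset.mul_sum] at hBw
    have h2 := mul_le_mul_of_nonneg_left (hRw.trans (by linarith : _ ≤ 2 * ∑ e ∈ M, w e)) hα0.le
    linarith
  -- the forest together with the chosen crossing edges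
  let X : Finset (Sym2 V) := S.image fun e => s((φ e).1, (φ e).2)
  have hXG : (X : Set (Sym2 V)) ⊆ G.edgeSet := by
    intro e he
    obtain ⟨e', he', rfl⟩ := Finset.mem_image.1 he
    exact (hφ e' (hSC he')).1
  have hDG : ((F ∪ X : Finset (Sym2 V)) : Set (Sym2 V)) ⊆ G.edgeSet := by
    rw [Finset.coe_union]
    exact Set.union_subset hF hXG
  have hFD : fromEdgeSet (F : Set (Sym2 V)) ≤
      fromEdgeSet ((F ∪ X : Finset (Sym2 V)) : Set (Sym2 V)) :=
    fromEdgeSet_mono (by simp)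
  have hcD : ∀ x, Within (fromEdgeSet ((F ∪ X : Finset (Sym2 V)) : Set (Sym2 V))) w x (c x)
      (α * δ x) := fun x => (hc x).mono hFD le_rfl
  have hSD : ∀ s t, (fromEdgeSet (S : Set (Sym2 K))).Adj s t →
      Within (fromEdgeSet ((F ∪ X : Finset (Sym2 V)) : Set (Sym2 V))) w s t (q s(s, t)) := by
    intro s t hst
    have hstS := ((fromEdgeSet_adj _).1 hst).1
    obtain ⟨h1, h2, -⟩ := hφ _ (hSC hstS)
    have hadj : (fromEdgeSet ((F ∪ X : Finset (Sym2 V)) : Set (Sym2 V))).Adj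
        (φ s(s, t)).1 (φ s(s, t)).2 :=
      (fromEdgeSet_adj _).2
        ⟨Finset.mem_union_right _ (Finset.mem_image_of_mem _ hstS), h1.ne⟩
    have := ((hcD _).symm.trans (Within.of_adj hadj)).trans (hcD (φ s(s, t)).2)
    rcases Sym2.eq_iff.1 h2 with ⟨h3, h4⟩ | ⟨h3, h4⟩
    · rwa [h3, h4] at this
    · rw [h3, h4] at this
      exact this.symm
  have hDc : (fromEdgeSet ((F ∪ X : Finset (Sym2 V)) : Set (Sym2 V))).Connected := by
    have hKr : ∀ s t : K,
        (fromEdgeSet ((F ∪ X : Finset (Sym2 V)) : Set (Sym2 V))).Reachable (s : V) t := by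
      intro s t
      obtain ⟨g⟩ := hSc.preconnected s t
      induction g with
      | nil => rfl
      | cons hadj _ ih => exact (hSD _ _ hadj).reachable.trans ih
    exact ⟨fun x y => ((hcD x).reachable.trans (hKr _ _)).trans (hcD y).reachable.symm⟩
  refine ⟨F ∪ X, hDG, ?_, ?_, ?_⟩
  · rw [isTree_iff_connected_and_card]
    refine ⟨hDc, le_antisymm ?_ hDc.card_vert_le_card_edgeSet_add_one⟩
    rw [edgeSet_fromEdgeSet_of_subset hDG, Nat.card_eq_fintype_card, Nat.card_eq_fintype_card]
    have h1 := Finset.card_union_le F X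
    have h2 : X.card ≤ S.card := Finset.card_image_le
    rw [Fintype.card_coe] at hScard
    simp only [Finset.coe_sort_coe, Fintype.card_coe]
    omega
  · intro v hv u p
    have hr := reachable_contraction (c := c) (q := q) (r := 2 * α * wlen w p) Walk.nil p
      (ℓ := wlen w p) (by rw [wlen_nil, zero_add]) (fun x y g g' hxy hne hl => by
        refine (hqmin x y hxy hne).trans ?_
        have h1 := hδmin x v hv g.reverse
        have h2 := hδmin y v hv (g.append (.cons hxy .nil)).reverse
        have h3 := hw s(x, y) hxy
        have h4 := wlen_nonneg hw0 g'
        rw [wlen_reverse] at h1 h2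
        rw [wlen_append, wlen_cons, wlen_nil] at h2
        rw [← hl]
        nlinarith [mul_nonneg hα0.le h4])
    rw [show c v = ⟨v, hv⟩ from hcK ⟨v, hv⟩] at hr
    obtain ⟨g, hg⟩ := (reachable_threshold_of_minimum hSC hSc hSmin
      (fun e he => (hqpos e he).le) hr).exists_isPath
    have hlen : (g.length : ℝ) ≤ K.card - 1 := by
      have h1 := hg.length_lt
      rw [Fintype.card_coe] at h1
      have : ((g.length + 1 : ℕ) : ℝ) ≤ K.card := by exact_mod_cast h1
      push_cast at this
      linarith
    have h1 := Within.of_threshold_walk hSD g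
    have h2 := (h1.trans (hcD u).symm)
    refine h2.mono le_rfl ?_
    have h3 := hδmin u v hv p.reverse
    rw [wlen_reverse] at h3
    have h4 := mul_le_mul_of_nonneg_right hlen
      (mul_nonneg (by linarith : 0 ≤ 2 * α) (wlen_nonneg hw0 p))
    nlinarith [mul_le_mul_of_nonneg_left h3 hα0.le]
  · have h1 := sum_union_le_add (w := w) (A := F) (B := X) (fun e he => hw0 e (hDG he))
    have h2 : ∑ e ∈ F, w e ≤ ∑ e ∈ E, w e :=
      Finset.sum_le_sum_of_subset_of_nonneg hFE fun e he _ => hw0 e (hE he)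
    have h3 : ∑ e ∈ X, w e ≤ ∑ e ∈ S, w s((φ e).1, (φ e).2) :=
      Finset.sum_image_le_of_nonneg fun e he => hw0 e (hXG he)
    have h4 : ∑ e ∈ S, w s((φ e).1, (φ e).2) ≤ ∑ e ∈ S, q e :=
      Finset.sum_le_sum fun e he => hwq e (hSC he)
    linarith

end LightTerminal

/-- Light terminal spanning trees: every connected weighted graph with a nonempty set
`K` of `k` terminals and every real `α > 1` admits a spanning tree `T` with terminal
distortion at most `k·α + (k-1)·α²` and lightness at most `2α + 1 + 2/(α-1)`,
i.e. `w(T) ≤ (2α + 1 + 2/(α-1))·w(T')` for every spanning tree `T'` of `G`. -/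
theorem light_terminal_spanning_tree
    (V : Type) [Fintype V] (G : SimpleGraph V) (w : Sym2 V → ℝ)
    (K : Finset V) (α : ℝ)
    (hG : G.Connected) (hw : ∀ e ∈ G.edgeSet, 0 < w e)
    (hK : K.Nonempty) (hα : 1 < α) :
    ∃ T : SimpleGraph V, T ≤ G ∧ T.IsTree ∧
      (∀ v ∈ K, ∀ u : V,
        wdist T w v u ≤
          ((K.card : ℝ) * α + ((K.card : ℝ) - 1) * α ^ 2) * wdist G w v u) ∧
      (∀ T' : SimpleGraph V, T' ≤ G → T'.IsTree →
        (∑ᶠ e ∈ T.edgeSet, w e) ≤ (2 * α + 1 + 2 / (α - 1)) * ∑ᶠ e ∈ T'.edgeSet, w e) := by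
  classical
  have hw0 : ∀ e ∈ G.edgeSet, 0 ≤ w e := fun e he => (hw e he).le
  have hα' : 0 < α - 1 := by linarith
  obtain ⟨M, hMG, hMc, -, hMmin⟩ := LightTerminal.exists_minimum_spanning hG hw
  obtain ⟨D, hDG, hDt, hDd, hDw⟩ :=
    LightTerminal.exists_light_terminal_tree hG hw hK hα hMG hMc
  have hle := LightTerminal.fromEdgeSet_le hDG
  have hk : (1 : ℝ) ≤ K.card := by exact_mod_cast hK.card_pos
  refine ⟨SimpleGraph.fromEdgeSet (D : Set (Sym2 V)), hle, hDt, fun v hv u => ?_,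
    fun T' hT' hT't => ?_⟩
  · obtain ⟨p, hp⟩ := LightTerminal.exists_wlen_eq_wdist hw0 (hG.preconnected v u)
    have h1 := (hDd v hv u p).wdist_le fun e he => hw0 e (SimpleGraph.edgeSet_mono hle he)
    rw [← hp]
    refine h1.trans (mul_le_mul_of_nonneg_right ?_ (LightTerminal.wlen_nonneg hw0 p))
    nlinarith [mul_nonneg (sub_nonneg.2 hk) (mul_nonneg (by linarith : 0 ≤ α) hα'.le)]
  · rw [LightTerminal.edgeSet_fromEdgeSet_of_subset hDG, finsum_mem_coe_finset,
      finsum_mem_eq_finite_toFinset_sum w T'.edgeSet.toFinite]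
    have hmin := hMmin T'.edgeSet.toFinite.toFinset
      (by simpa using SimpleGraph.edgeSet_mono hT') (by simpa using hT't.connected)
    exact hDw.trans (mul_le_mul_of_nonneg_left hmin (by positivity))
end

section
/- Let G be a connected simple graph on a finite vertex set V with a weight function w assigning a positive real to each edge, and let K ⊆ V be a nonempty set of terminals with |K| = k. Then there exists a spanning tree T of G (a subgraph of G on the full vertex set that is connected and acyclic) such that for every v ∈ K and u ∈ V, d_{T,w}(v,u) ≤ (2k−1)·d_{G,w}(v,u). -/
namespace TerminalTree

open SimpleGraph

variable {V : Type}

/-- There is a walk in `G` from `a` to `b` of weighted length at most `L`. -/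
def ReachWithin (G : SimpleGraph V) (w : Sym2 V → ℝ) (a b : V) (L : ℝ) : Prop :=
  ∃ p : G.Walk a b, (p.edges.map w).sum ≤ L

namespace ReachWithin

variable {G H : SimpleGraph V} {w : Sym2 V → ℝ} {a b c : V} {L M : ℝ}

lemma refl (a : V) : ReachWithin G w a a 0 := ⟨.nil, by simp⟩

lemma adj (h : G.Adj a b) : ReachWithin G w a b (w s(a, b)) := ⟨.cons h .nil, by simp⟩

lemma trans (h : ReachWithin G w a b L) (h' : ReachWithin G w b c M) :
    ReachWithin G w a c (L + M) := by
  obtain ⟨p, hp⟩ := h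
  obtain ⟨q, hq⟩ := h'
  exact ⟨p.append q, by simpa using add_le_add hp hq⟩

lemma symm (h : ReachWithin G w a b L) : ReachWithin G w b a L := by
  obtain ⟨p, hp⟩ := h
  exact ⟨p.reverse, by simpa using hp⟩

lemma mono (h : ReachWithin G w a b L) (hLM : L ≤ M) : ReachWithin G w a b M := by
  obtain ⟨p, hp⟩ := h
  exact ⟨p, hp.trans hLM⟩

lemma mono_graph (h : ReachWithin G w a b L) (hGH : G ≤ H) : ReachWithin H w a b L := by
  obtain ⟨p, hp⟩ := h
  exact ⟨p.mapLe hGH, by simpa using hp⟩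

lemma reachable (h : ReachWithin G w a b L) : G.Reachable a b := h.choose.reachable

end ReachWithin

section Distance

variable {G : SimpleGraph V} {w : Sym2 V → ℝ} {a b : V} {L : ℝ}

lemma walk_weight_nonneg (hw : ∀ e ∈ G.edgeSet, 0 < w e) (p : G.Walk a b) :
    0 ≤ (p.edges.map w).sum := by
  refine List.sum_nonneg fun x hx => ?_
  obtain ⟨e, he, rfl⟩ := List.mem_map.1 hx
  exact (hw e (p.edges_subset_edgeSet he)).le

lemma wdist_le (hw : ∀ e ∈ G.edgeSet, 0 < w e) (h : ReachWithin G w a b L) :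
    wdist G w a b ≤ L := by
  obtain ⟨p, hp⟩ := h
  refine le_trans (csInf_le ⟨0, ?_⟩ ⟨p, rfl⟩) hp
  rintro _ ⟨q, rfl⟩
  exact walk_weight_nonneg hw q

lemma wdist_nonneg (hw : ∀ e ∈ G.edgeSet, 0 < w e) : 0 ≤ wdist G w a b := by
  refine Real.sInf_nonneg ?_
  rintro _ ⟨q, rfl⟩
  exact walk_weight_nonneg hw q

lemma bypass_weight_le [DecidableEq V] (hw : ∀ e ∈ G.edgeSet, 0 < w e) (p : G.Walk a b) :
    (p.bypass.edges.map w).sum ≤ (p.edges.map w).sum := by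
  refine (p.edges_bypass_sublist_edges.map w).sum_le_sum fun x hx => ?_
  obtain ⟨e, he, rfl⟩ := List.mem_map.1 hx
  exact (hw e (p.edges_subset_edgeSet he)).le

/-- The infimum defining the weighted distance is attained. -/
lemma reachWithin_wdist [Finite V] (hG : G.Connected) (hw : ∀ e ∈ G.edgeSet, 0 < w e) (a b : V) :
    ReachWithin G w a b (wdist G w a b) := by
  classical
  have := Fintype.ofFinite V
  have : Nonempty (G.Path a b) := ⟨(hG.preconnected a b).some.toPath⟩
  obtain ⟨p, hp⟩ := Finite.exists_min fun p : G.Path a b => (p.1.edges.map w).sum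
  refine ⟨p.1, le_csInf ⟨_, p.1, rfl⟩ ?_⟩
  rintro _ ⟨q, rfl⟩
  exact (hp q.toPath).trans (bypass_weight_le hw q)

end Distance

section Bottleneck

variable {α : Type} {g : Sym2 α → ℝ}

/-- The subgraph of `G` formed by the edges of weight at most `c`. -/
def sublevel (G : SimpleGraph α) (g : Sym2 α → ℝ) (c : ℝ) : SimpleGraph α where
  Adj a b := G.Adj a b ∧ g s(a, b) ≤ c
  symm := ⟨fun a b h => ⟨h.1.symm, by rw [Sym2.eq_swap]; exact h.2⟩⟩
  loopless := ⟨fun _ h => h.1.ne rfl⟩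

lemma sublevel_le (G : SimpleGraph α) (c : ℝ) : sublevel G g c ≤ G := fun _ _ h => h.1

lemma sublevel_mono {G H : SimpleGraph α} (h : G ≤ H) (c : ℝ) :
    sublevel G g c ≤ sublevel H g c := fun _ _ hab => ⟨h hab.1, hab.2⟩

lemma le_sublevel {G : SimpleGraph α} {c : ℝ} (h : ∀ e ∈ G.edgeSet, g e ≤ c) :
    G ≤ sublevel G g c := fun _ _ hab => ⟨hab, h _ hab⟩

/-- A minimum spanning forest preserves reachability in every sublevel graph. -/
lemma exists_isAcyclic_reachable_sublevel [Finite α] (G : SimpleGraph α) (g : Sym2 α → ℝ) :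
    ∃ S ≤ G, S.IsAcyclic ∧
      ∀ c a b, (sublevel G g c).Reachable a b → (sublevel S g c).Reachable a b := by
  induction hn : G.edgeSet.ncard using Nat.strong_induction_on generalizing G with
  | _ n ih =>
  by_cases hne : G.edgeSet.Nonempty
  · obtain ⟨e, he, hmax⟩ := Set.exists_max_image _ g (Set.toFinite G.edgeSet) hne
    have hlt : (G.deleteEdges {e}).edgeSet.ncard < n := by
      rw [← hn, edgeSet_deleteEdges]
      exact Set.ncard_sdiff_singleton_lt_of_mem he
    obtain ⟨S, hS, hacyc, hreach⟩ := ih _ hlt _ rfl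
    obtain ⟨F, hSF, hFG, hF, hFr⟩ := exists_isAcyclic_reachable_eq_le_of_le_of_isAcyclic
      (hS.trans (deleteEdges_le _)) hacyc
    refine ⟨F, hFG, hF, fun c a b hab => ?_⟩
    by_cases hc : g e ≤ c
    · have : F.Reachable a b := by
        rw [hFr]
        exact hab.mono (sublevel_le G c)
      exact this.mono (le_sublevel fun e' he' => (hmax e' (edgeSet_mono hFG he')).trans hc)
    · refine (hreach c a b (hab.mono ?_)).mono (sublevel_mono hSF c)
      refine fun x y hxy => ⟨?_, hxy.2⟩
      rw [deleteEdges_adj]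
      refine ⟨hxy.1, fun h => hc ?_⟩
      rw [← Set.mem_singleton_iff.1 h]
      exact hxy.2
  · refine ⟨G, le_rfl, ?_, fun _ _ _ h => h⟩
    rw [edgeSet_nonempty, not_not] at hne
    exact hne ▸ isAcyclic_bot

/-- A minimum spanning tree preserves reachability in every sublevel graph. -/
lemma exists_isTree_reachable_sublevel [Finite α] {G : SimpleGraph α} (hG : G.Connected)
    (g : Sym2 α → ℝ) :
    ∃ S ≤ G, S.IsTree ∧
      ∀ c a b, (sublevel G g c).Reachable a b → (sublevel S g c).Reachable a b := by
  obtain ⟨S, hS, hacyc, hreach⟩ := exists_isAcyclic_reachable_sublevel G g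
  obtain ⟨T, hST, hTG, hT⟩ := hG.exists_isTree_le_of_le_of_isAcyclic hS hacyc
  exact ⟨T, hTG, hT, fun c a b h => (hreach c a b h).mono (sublevel_mono hST c)⟩

end Bottleneck

/-- The sum of a function over the two endpoints of an unordered pair. -/
def endpointSum (D : V → ℝ) : Sym2 V → ℝ :=
  Sym2.lift ⟨fun a b => D a + D b, fun _ _ => add_comm _ _⟩

/-- Each edge of the graph induced by `G` on the cells of `t` can be represented by a
cheapest edge of `G` between these cells. -/
lemma exists_cheapest_representatives [Finite V] [Nonempty V] {α : Type} (G : SimpleGraph V)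
    (t : V → α)
    (f : Sym2 V → ℝ) :
    ∃ (H : SimpleGraph α) (r : Sym2 α → Sym2 V),
      (∀ x y, G.Adj x y → t x ≠ t y → H.Adj (t x) (t y) ∧ f (r s(t x, t y)) ≤ f s(x, y)) ∧
      ∀ e ∈ H.edgeSet, r e ∈ G.edgeSet ∧ (r e).map t = e := by
  have key (e : Sym2 α) : ∃ e' : Sym2 V, e ∈ Sym2.map t '' G.edgeSet →
      e' ∈ G.edgeSet ∧ e'.map t = e ∧ ∀ e₁ ∈ G.edgeSet, e₁.map t = e → f e' ≤ f e₁ := by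
    by_cases he : e ∈ Sym2.map t '' G.edgeSet
    · obtain ⟨e₀, h₀, h₁⟩ := he
      obtain ⟨e', ⟨h, h'⟩, hmin⟩ := Set.exists_min_image {e' | e' ∈ G.edgeSet ∧ e'.map t = e} f
        (Set.toFinite _) ⟨e₀, h₀, h₁⟩
      exact ⟨e', fun _ => ⟨h, h', fun e₁ h₂ h₃ => hmin e₁ ⟨h₂, h₃⟩⟩⟩
    · exact ⟨Sym2.diag (Classical.arbitrary V), fun h => absurd h he⟩
  choose r hr using key
  refine ⟨fromEdgeSet (Sym2.map t '' G.edgeSet), r, fun x y hxy hne => ?_, fun e he => ?_⟩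
  · have hmem : s(t x, t y) ∈ Sym2.map t '' G.edgeSet := ⟨s(x, y), hxy, rfl⟩
    exact ⟨(fromEdgeSet_adj _).2 ⟨hmem, hne⟩, (hr _ hmem).2.2 _ hxy rfl⟩
  · rw [edgeSet_fromEdgeSet] at he
    exact ⟨(hr e he.1).1, (hr e he.1).2.1⟩

section Reachability

variable {G : SimpleGraph V} {w : Sym2 V → ℝ} {D : V → ℝ}

/-- If a function drops along some edge at every point outside `K` by at least the weight of the
edge, then following these edges leads to `K`. -/
lemma exists_reachWithin_of_parent [Finite V] {K : Finset V} {p : V → V}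
    (hD : ∀ x, 0 ≤ D x) (hp : ∀ x ∉ K, G.Adj x (p x)) (hw : ∀ x ∉ K, 0 < w s(x, p x))
    (hDp : ∀ x ∉ K, w s(x, p x) + D (p x) ≤ D x) (x : V) :
    ∃ s : K, (x ∈ K → s = x) ∧ ReachWithin G w x s (D x) := by
  have hwf : WellFounded fun a b : V => D a < D b :=
    @Finite.wellFounded_of_trans_of_irrefl V _ _ ⟨fun _ _ _ => lt_trans⟩ ⟨fun _ => lt_irrefl _⟩
  induction x using hwf.induction with
  | _ x ih =>
  by_cases hx : x ∈ K
  · exact ⟨⟨x, hx⟩, fun _ => rfl, (ReachWithin.refl x).mono (hD x)⟩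
  · obtain ⟨s, -, hs⟩ := ih (p x) (by linarith [hw x hx, hDp x hx])
    exact ⟨s, fun h => absurd h hx, ((ReachWithin.adj (hp x hx)).trans hs).mono (hDp x hx)⟩

/-- Along a walk of `G`, the cells visited are joined by edges of the cell graph whose weight is
controlled by the length of the walk and by the values of `D` at its ends. -/
lemma sublevel_reachable_of_walk {α : Type} {H : SimpleGraph α} {t : V → α} {g : Sym2 α → ℝ}
    (hH : ∀ x y, G.Adj x y → t x ≠ t y →
      H.Adj (t x) (t y) ∧ g s(t x, t y) ≤ w s(x, y) + (D x + D y))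
    (hD : ∀ x y, G.Adj x y → D x ≤ w s(x, y) + D y) {a b : V} (q : G.Walk a b) {c : ℝ}
    (hc : D a + (q.edges.map w).sum + D b ≤ c) :
    (sublevel H g c).Reachable (t a) (t b) := by
  have hDq {x y : V} (q : G.Walk x y) : D x ≤ (q.edges.map w).sum + D y := by
    induction q with
    | nil => simp
    | cons h q ih =>
      have := hD _ _ h
      simp only [Walk.edges_cons, List.map_cons, List.sum_cons]
      linarith
  induction q with
  | nil => rfl
  | @cons x y z h q ih =>
    simp only [Walk.edges_cons, List.map_cons, List.sum_cons] at hc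
    have hyx := hD _ _ h.symm
    rw [Sym2.eq_swap] at hyx
    refine Reachable.trans ?_ (ih (by linarith))
    by_cases hne : t x = t y
    · rw [hne]
    · obtain ⟨hadj, hg⟩ := hH x y h hne
      exact Adj.reachable ⟨hadj, by linarith [hDq q]⟩

/-- If the edges of a graph on `α` can be simulated by walks of weighted length at most `c`, then
points reachable there are within `(|α| - 1) c`. -/
lemma reachWithin_of_reachable {α : Type} [Fintype α] {S : SimpleGraph α} {ι : α → V} {c : ℝ}
    (hc : 0 ≤ c) (hS : ∀ i j, S.Adj i j → ReachWithin G w (ι i) (ι j) c) {i j : α}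
    (h : S.Reachable i j) :
    ReachWithin G w (ι i) (ι j) (((Fintype.card α : ℝ) - 1) * c) := by
  classical
  have hwalk {i j : α} (p : S.Walk i j) : ReachWithin G w (ι i) (ι j) (p.length * c) := by
    induction p with
    | nil => simpa using ReachWithin.refl _
    | cons h p ih =>
      refine ((hS _ _ h).trans ih).mono (le_of_eq ?_)
      push_cast [Walk.length_cons]
      ring
  obtain ⟨p, hp⟩ := h.exists_isPath
  refine (hwalk p).mono (mul_le_mul_of_nonneg_right ?_ hc)
  have : (p.length : ℝ) + 1 ≤ Fintype.card α := by exact_mod_cast hp.length_lt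
  linarith

end Reachability

/-- The distance to the set `K`, together with a next vertex on a shortest path to `K`. -/
lemma exists_dist_to_terminals [Finite V] {G : SimpleGraph V} {w : Sym2 V → ℝ} {K : Finset V}
    (hG : G.Connected) (hw : ∀ e ∈ G.edgeSet, 0 < w e) (hK : K.Nonempty) :
    ∃ (D : V → ℝ) (p : V → V), (∀ x, 0 ≤ D x) ∧ (∀ x, ∀ s ∈ K, D x ≤ wdist G w x s) ∧
      (∀ x y, G.Adj x y → D x ≤ w s(x, y) + D y) ∧
      ∀ x ∉ K, G.Adj x (p x) ∧ w s(x, p x) + D (p x) ≤ D x := by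
  let D x := K.inf' hK (wdist G w x)
  have hDK (x) (s) (hs : s ∈ K) : D x ≤ wdist G w x s := Finset.inf'_le _ hs
  have hDmem (x) : ∃ s ∈ K, D x = wdist G w x s := K.exists_mem_eq_inf' hK _
  have hparent (x) : ∃ y, x ∉ K → G.Adj x y ∧ w s(x, y) + D y ≤ D x := by
    obtain ⟨s, hs, hxs⟩ := hDmem x
    obtain ⟨q, hq⟩ := reachWithin_wdist hG hw x s
    cases q with
    | nil => exact ⟨x, fun h => absurd hs h⟩
    | @cons _ y _ h q =>
      refine ⟨y, fun _ => ⟨h, ?_⟩⟩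
      have := (hDK y s hs).trans (wdist_le hw ⟨q, le_rfl⟩)
      simp only [Walk.edges_cons, List.map_cons, List.sum_cons] at hq
      linarith
  choose p hp using hparent
  refine ⟨D, p, fun x => ?_, hDK, fun x y hxy => ?_, hp⟩
  · obtain ⟨s, -, h⟩ := hDmem x
    exact h ▸ wdist_nonneg hw
  · obtain ⟨s, hs, h⟩ := hDmem y
    rw [h]
    exact (hDK x s hs).trans
      (wdist_le hw ((ReachWithin.adj hxy).trans (reachWithin_wdist hG hw y s)))

/-- A connected graph whose edges are covered by one edge for each point outside `K` and one for
each edge of a tree on `K` is a tree. -/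
lemma isTree_of_edgeSet_subset [Fintype V] {K : Finset V} {S : SimpleGraph K} (hS : S.IsTree)
    {T : SimpleGraph V} (hT : T.Connected) (f : V → Sym2 V) (r : Sym2 K → Sym2 V)
    (h : T.edgeSet ⊆ f '' {x | x ∉ K} ∪ r '' S.edgeSet) : T.IsTree := by
  classical
  rw [isTree_iff_connected_and_card]
  refine ⟨hT, le_antisymm ?_ hT.card_vert_le_card_edgeSet_add_one⟩
  have h₁ : (f '' {x | x ∉ K}).ncard ≤ Kᶜ.card := by
    refine (Set.ncard_image_le (Set.toFinite _)).trans (le_of_eq ?_)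
    rw [← Set.ncard_coe_finset]
    congr 1
    ext
    simp
  have h₂ : (r '' S.edgeSet).ncard ≤ Nat.card S.edgeSet := Set.ncard_image_le (Set.toFinite _)
  have h₃ := (isTree_iff_connected_and_card.1 hS).2
  have h₄ := (Set.ncard_le_ncard h (Set.toFinite _)).trans (Set.ncard_union_le _ _)
  have h₅ := K.card_add_card_compl
  rw [Nat.card_eq_fintype_card (α := K), Fintype.card_coe] at h₃
  rw [Nat.card_eq_fintype_card (α := V)]
  change Nat.card T.edgeSet ≤ _ at h₄
  omega

end TerminalTree

open TerminalTree SimpleGraph in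
/-- Every connected weighted graph with a nonempty set `K` of `k` terminals admits a
spanning tree with terminal distortion at most `2k - 1`. -/
theorem terminal_spanning_tree
    (V : Type) [Fintype V] (G : SimpleGraph V) (w : Sym2 V → ℝ) (K : Finset V)
    (hG : G.Connected) (hw : ∀ e ∈ G.edgeSet, 0 < w e) (hK : K.Nonempty) :
    ∃ T : SimpleGraph V, T ≤ G ∧ T.IsTree ∧
      ∀ v ∈ K, ∀ u : V,
        wdist T w v u ≤ (2 * (K.card : ℝ) - 1) * wdist G w v u := by
  have : Nonempty V := hG.nonempty
  obtain ⟨D, p, hD, hDK, hDadj, hp⟩ := exists_dist_to_terminals hG hw hK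
  have hcell := exists_reachWithin_of_parent (G := fromEdgeSet ((fun x => s(x, p x)) '' {x | x ∉ K}))
    (w := w) hD (fun x hx => (fromEdgeSet_adj _).2 ⟨⟨x, hx, rfl⟩, (hp x hx).1.ne⟩)
    (fun x hx => hw _ (hp x hx).1) (fun x hx => (hp x hx).2)
  choose t htK ht using hcell
  obtain ⟨H, r, hHG, hr⟩ := exists_cheapest_representatives G t (w + endpointSum D)
  let g (e : Sym2 K) : ℝ := (w + endpointSum D) (r e)
  have hreach {a b : V} (q : G.Walk a b) {c : ℝ} (hc : D a + (q.edges.map w).sum + D b ≤ c) :=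
    sublevel_reachable_of_walk (g := g) hHG hDadj q hc
  have hHconn : H.Connected := by
    have : Nonempty K := hK.to_subtype
    refine ⟨fun i j => ?_⟩
    have := (hreach (hG.preconnected i j).some le_rfl).mono (sublevel_le H _)
    rwa [Subtype.ext (htK i i.2), Subtype.ext (htK j j.2)] at this
  obtain ⟨S, hSH, hStree, hSreach⟩ := exists_isTree_reachable_sublevel hHconn g
  let E := (fun x => s(x, p x)) '' {x | x ∉ K} ∪ r '' S.edgeSet
  have hEG : E ⊆ G.edgeSet := by
    rintro _ (⟨x, hx, rfl⟩ | ⟨e, he, rfl⟩)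
    · exact (hp x hx).1
    · exact (hr e (edgeSet_mono hSH he)).1
  let T := fromEdgeSet E
  have hTE : T.edgeSet ⊆ E := by
    rw [edgeSet_fromEdgeSet]
    exact Set.sdiff_subset
  have hTG : T ≤ G := edgeSet_subset_edgeSet.1 (hTE.trans hEG)
  have hTcell (x : V) : ReachWithin T w x (t x) (D x) :=
    (ht x).mono_graph (fromEdgeSet_mono Set.subset_union_left)
  have hTedge (i j : K) (hij : S.Adj i j) :
      ReachWithin T w i j ((w + endpointSum D) (r s(i, j))) := by
    have hmem : r s(i, j) ∈ E := .inr ⟨_, hij, rfl⟩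
    have hmap := (hr s(i, j) (hSH hij)).2
    generalize r s(i, j) = e at hmem hmap ⊢
    induction e with
    | _ x y =>
    have hxy : T.Adj x y := (fromEdgeSet_adj _).2 ⟨hmem, (hEG hmem : G.Adj x y).ne⟩
    have hwalk : ReachWithin T w (t x) (t y) ((w + endpointSum D) s(x, y)) := by
      refine (((hTcell x).symm.trans (.adj hxy)).trans (hTcell y)).mono (le_of_eq ?_)
      change _ = w s(x, y) + (D x + D y)
      ring
    rw [Sym2.map_mk, Sym2.eq_iff] at hmap
    obtain ⟨rfl, rfl⟩ | ⟨rfl, rfl⟩ := hmap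
    · exact hwalk
    · exact hwalk.symm
  have hTK (c : ℝ) (hc : 0 ≤ c) (i j : K) (h : (sublevel S g c).Reachable i j) :
      ReachWithin T w i j (((K.card : ℝ) - 1) * c) := by
    rw [← Fintype.card_coe]
    exact reachWithin_of_reachable (S := sublevel S g c) (ι := Subtype.val) hc
      (fun i j hij => (hTedge i j hij.1).mono hij.2) h
  have hbound (v : V) (hv : v ∈ K) (u : V) :
      ReachWithin T w v u ((2 * (K.card : ℝ) - 1) * wdist G w v u) := by
    obtain ⟨q, hq⟩ := reachWithin_wdist hG hw v u
    have hDv : D v ≤ 0 := (hDK v v hv).trans (wdist_le hw (.refl v))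
    have hDu : D u ≤ wdist G w v u :=
      (hDK u v hv).trans (wdist_le hw (reachWithin_wdist hG hw v u).symm)
    have h := hTK (2 * wdist G w v u) (by linarith [wdist_nonneg (a := v) (b := u) hw]) _ _
      (hSreach _ _ _ (hreach q (by linarith)))
    rw [htK v hv] at h
    exact (h.trans (hTcell u).symm).mono (by linarith)
  have hTconn : T.Connected := by
    obtain ⟨v, hv⟩ := hK
    exact ⟨fun a b => (hbound v hv a).reachable.symm.trans (hbound v hv b).reachable⟩
  exact ⟨T, hTG, isTree_of_edgeSet_subset hStree hTconn _ r hTE, fun v hv u =>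
    wdist_le (fun e he => hw e (edgeSet_mono hTG he)) (hbound v hv u)⟩
end
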